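/- (Logarithmic bounds) Let γ ∈ [-3,-2], T > 0, μ, k', K' > 0, δ ∈ (0,1), ℓ ∈ ℝ and C_g > 0. Let g = (g_t)_{t∈[0,T]} be a positive classical solution of the Landau equation on [0,T] (C¹ in time, C² in velocity, and C^{2+δ} in velocity on every bounded cylinder), with ∫ g_t = 1 for all t, satisfying the Maxwellian sandwich k' e^{−μ|v|²} ≤ g_t(v) ≤ K' e^{−μ|v|²} for all t ∈ [0,T] and v ∈ ℝ³, and whose initial datum satisfies: ln g₀ is locally C^{2+δ} with sup_{i,j} [∂_{ij} ln g₀]_{δ,B(0,R)} ≤ C_g R^ℓ for all R ≥ 1. Then there exists a constant K > 0 such that for all t ∈ [0,T] and all v ∈ ℝ³: |∇ ln g_t(v)| ≤ K⟨v⟩^κ, ‖∇² ln g_t(v)‖ ≤ K⟨v⟩^ζ and |∂_t ln g_t(v)| ≤ K⟨v⟩^ν, where κ = 2β + (2−γ)/δ, ζ = 2κ, ν = 2β + (4−2γ)/δ, and β = max(2 + (ℓ−2)/(2+δ), 1). -/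

import Mathlib

noncomputable section

open MeasureTheory Real
open scoped ENNReal RealInnerProductSpace

/-- The velocity space ℝ³. -/
abbrev V3 : Type := EuclideanSpace ℝ (Fin 3)

/-- 3×3 real matrices. -/
abbrev Mat3 : Type := Matrix (Fin 3) (Fin 3) ℝ

/-- Japanese bracket ⟨v⟩ = √(1+|v|²). -/
def jap (v : V3) : ℝ := Real.sqrt (1 + ‖v‖ ^ 2)

/-- `i`-th basis vector of ℝ³. -/
def esingle (i : Fin 3) : V3 := EuclideanSpace.single i (1 : ℝ)

/-- Orthogonal projection Π(z) onto z^⊥. -/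
def proj (z : V3) : Mat3 := fun i j =>
  (if i = j then (1 : ℝ) else 0) - (z i / ‖z‖) * (z j / ‖z‖)

/-- Landau kernel a(z) = |z|^{γ+2} Π(z). -/
def landauKernel (γ : ℝ) (z : V3) : Mat3 := fun i j => ‖z‖ ^ (γ + 2) * proj z i j

/-- Cut-off kernel ã(z) = ⟨z⟩^γ |z|² Π(z). -/
def cutoffKernel (γ : ℝ) (z : V3) : Mat3 := fun i j => jap z ^ γ * ‖z‖ ^ 2 * proj z i j

/-- Bilinear form ⟨A w, z⟩. -/
def bilin (A : Mat3) (w z : V3) : ℝ := ∑ i, ∑ j, A i j * w i * z j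

/-- Quadratic form A : w^{⊗2}. -/
def quadForm (A : Mat3) (w : V3) : ℝ := bilin A w w

/-- Matrix dot product A : B. -/
def matDot (A B : Mat3) : ℝ := ∑ i, ∑ j, A i j * B i j

/-- (Frobenius) norm of a 3×3 matrix. -/
def matNorm (A : Mat3) : ℝ := Real.sqrt (∑ i, ∑ j, (A i j) ^ 2)

/-- Entropy H(f) = ∫ f ln f. -/
def entropy (f : V3 → ℝ) : ℝ := ∫ v, f v * Real.log (f v)

/-- Relative entropy H(f|g) = ∫ ((f/g) ln(f/g) − f/g + 1) g ∈ [0,∞]. -/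
def relEntropy (f g : V3 → ℝ) : ℝ≥0∞ :=
  ∫⁻ v, ENNReal.ofReal ((f v / g v * Real.log (f v / g v) - f v / g v + 1) * g v)

/-- Hessian matrix of a function on ℝ³. -/
def hess (φ : V3 → ℝ) (v : V3) : Mat3 := fun i j =>
  iteratedFDeriv ℝ 2 φ v ![esingle i, esingle j]

/-- Hessian matrix within a set. -/
def hessW (φ : V3 → ℝ) (s : Set V3) (v : V3) : Mat3 := fun i j =>
  iteratedFDerivWithin ℝ 2 φ s v ![esingle i, esingle j]

/-- Gradient of the logarithm, ∇ ln φ. -/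
def logGrad (φ : V3 → ℝ) (v : V3) : V3 := gradient (fun w => Real.log (φ w)) v

/-- Hessian of the logarithm, ∇² ln φ. -/
def logHess (φ : V3 → ℝ) (v : V3) : Mat3 := hess (fun w => Real.log (φ w)) v

/-- `G` is the weak gradient of `F` on ℝ⁶ ≃ ℝ³ × ℝ³. -/
def IsWeakGrad6 (F : V3 × V3 → ℝ) (G : V3 × V3 → V3 × V3) : Prop :=
  ∀ φ : V3 × V3 → ℝ, ContDiff ℝ (⊤ : ℕ∞) φ → HasCompactSupport φ →
    ∀ e : V3 × V3,
      (∫ p : V3 × V3, F p * fderiv ℝ φ p e) =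
        - ∫ p : V3 × V3, (⟪(G p).1, e.1⟫ + ⟪(G p).2, e.2⟫) * φ p

/-- `G` is the weak gradient of `F` on ℝ³. -/
def IsWeakGrad3 (F : V3 → ℝ) (G : V3 → V3) : Prop :=
  ∀ φ : V3 → ℝ, ContDiff ℝ (⊤ : ℕ∞) φ → HasCompactSupport φ →
    ∀ e : V3, (∫ v, F v * fderiv ℝ φ v e) = - ∫ v, ⟪G v, e⟫ * φ v

/-- Entropy production functional associated with a weak gradient of √(f f'). -/
def dissipation (γ : ℝ) (G : V3 × V3 → V3 × V3) : ℝ≥0∞ :=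
  ∫⁻ p : V3 × V3,
    ENNReal.ofReal (quadForm (landauKernel γ (p.1 - p.2)) ((G p).1 - (G p).2))

/-- Villani's H-solutions of the Landau equation on [0,T], with weak gradient data
`fGrad s` for √(f_s f_s'). -/
structure IsHSolution (γ T : ℝ) (f : ℝ → V3 → ℝ) (fGrad : ℝ → V3 × V3 → V3 × V3) : Prop where
  nonneg : ∀ t ∈ Set.Icc 0 T, ∀ v, 0 ≤ f t v
  integrable : ∀ t ∈ Set.Icc 0 T, Integrable (f t)
  entIntegrable : ∀ t ∈ Set.Icc 0 T, Integrable (fun v => f t v * Real.log (f t v))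
  contDistrib : ∀ φ : V3 → ℝ, ContDiff ℝ (⊤ : ℕ∞) φ → HasCompactSupport φ →
    ContinuousOn (fun t => ∫ v, φ v * f t v) (Set.Icc 0 T)
  mass : ∀ t ∈ Set.Icc 0 T, (∫ v, f t v) = 1
  momentumIntegrable : ∀ t ∈ Set.Icc 0 T, Integrable (fun v => f t v • v)
  momentum : ∀ t ∈ Set.Icc 0 T, (∫ v, f t v • v) = ∫ v, f 0 v • v
  energyIntegrable : ∀ t ∈ Set.Icc 0 T, Integrable (fun v => ‖v‖ ^ 2 * f t v)
  energy : ∀ t ∈ Set.Icc 0 T, (∫ v, ‖v‖ ^ 2 * f t v) = ∫ v, ‖v‖ ^ 2 * f 0 v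
  weakGrad : ∀ᵐ s ∂(volume.restrict (Set.Icc 0 T)),
    IsWeakGrad6 (fun p => Real.sqrt (f s p.1 * f s p.2)) (fGrad s)
  dissipationFinite : ∀ t ∈ Set.Icc 0 T,
    (∫⁻ s in Set.Ioc (0 : ℝ) t, dissipation γ (fGrad s)) < ⊤
  entropyProd : ∀ t ∈ Set.Icc 0 T,
    entropy (f t) + 2 * (∫⁻ s in Set.Ioc (0 : ℝ) t, dissipation γ (fGrad s)).toReal ≤
      entropy (f 0)
  weakForm : ∀ φ : ℝ → V3 → ℝ,
    ContDiff ℝ 2 (fun q : ℝ × V3 => φ q.1 q.2) →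
    HasCompactSupport (fun q : ℝ × V3 => φ q.1 q.2) →
    ∀ t ∈ Set.Icc 0 T,
      (∫ v, φ t v * f t v) - (∫ v, φ 0 v * f 0 v) =
        (∫ s in (0 : ℝ)..t, ∫ v, deriv (fun r => φ r v) s * f s v) -
          ∫ s in (0 : ℝ)..t, ∫ p : V3 × V3,
            bilin (landauKernel γ (p.1 - p.2))
              (gradient (φ s) p.1 - gradient (φ s) p.2)
              ((fGrad s p).1 - (fGrad s p).2) * Real.sqrt (f s p.1 * f s p.2)

/-- Convolved Landau matrix ā = a ⋆ f. -/
def abar (γ : ℝ) (f : V3 → ℝ) (v : V3) : Mat3 := fun i j =>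
  ∫ w, landauKernel γ (v - w) i j * f w

/-- Zero order coefficient c̄ of the Landau equation in nondivergence form. -/
def cbar (γ : ℝ) (f : V3 → ℝ) (v : V3) : ℝ :=
  if γ = -3 then 8 * Real.pi * f v else 2 * (γ + 3) * ∫ w, ‖v - w‖ ^ γ * f w

/-- Convolution of the cut-off kernel with a density. -/
def cutoffConv (γ : ℝ) (f : V3 → ℝ) (v : V3) : Mat3 := fun i j =>
  ∫ w, cutoffKernel γ (v - w) i j * f w

/-- Classical solution of the Landau equation on a time set `I`
(in nondivergence parabolic form ∂_t g = ā : ∇²g + c̄ g). -/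
structure IsClassicalSolution (γ : ℝ) (I : Set ℝ) (g : ℝ → V3 → ℝ) : Prop where
  pos : ∀ t ∈ I, ∀ v, 0 < g t v
  timeC1 : ∀ v, ContDiffOn ℝ 1 (fun t => g t v) I
  velC2 : ∀ t ∈ I, ContDiff ℝ 2 (g t)
  eqn : ∀ t ∈ I, ∀ v,
    derivWithin (fun s => g s v) I t =
      matDot (abar γ (g t) v) (hess (g t) v) + cbar γ (g t) v * g t v

/-- The moment exponent ρ = max(2κ, 2κ+2γ+4, 2ζ, ν). -/
def rhoExp (γ κ ζ ν : ℝ) : ℝ := max (max (2 * κ) (2 * κ + 2 * γ + 4)) (max (2 * ζ) ν)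

/-- Setting (⋆) of the paper. -/
structure Setting (γ T : ℝ) where
  f : ℝ → V3 → ℝ
  fGrad : ℝ → V3 × V3 → V3 × V3
  g : ℝ → V3 → ℝ
  κ : ℝ
  ν : ℝ
  ζ : ℝ
  K1 : ℝ → ℝ
  K2 : ℝ → ℝ
  K3 : ℝ → ℝ
  Mf : ℝ
  Mg : ℝ
  hγ : γ ∈ Set.Ico (-3 : ℝ) 0
  hT : 0 < T
  hf : IsHSolution γ T f fGrad
  hg : IsClassicalSolution γ (Set.Icc 0 T) g
  hκ : 1 ≤ κ
  hν : 1 ≤ ν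
  hζ : 0 ≤ ζ
  K1nonneg : ∀ t, 0 ≤ K1 t
  K2nonneg : ∀ t, 0 ≤ K2 t
  K3nonneg : ∀ t, 0 ≤ K3 t
  K1meas : Measurable K1
  K2meas : Measurable K2
  K3meas : Measurable K3
  K1bound : ∀ t ∈ Set.Icc 0 T, ∀ v, ‖logGrad (g t) v‖ ≤ K1 t * jap v ^ κ
  K2bound : ∀ t ∈ Set.Icc 0 T, ∀ v,
    |derivWithin (fun s => Real.log (g s v)) (Set.Icc 0 T) t| ≤ K2 t * jap v ^ ν
  K3bound : ∀ t ∈ Set.Icc 0 T, ∀ v, matNorm (logHess (g t) v) ≤ K3 t * jap v ^ ζ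
  Kint : IntegrableOn (fun t => K2 t + K1 t ^ 2 + K3 t ^ 2) (Set.Icc 0 T)
  fMomentInt : ∀ t ∈ Set.Icc 0 T,
    Integrable (fun v => jap v ^ (rhoExp γ κ ζ ν - γ) * f t v)
  fMoment : ∀ t ∈ Set.Icc 0 T, (∫ v, jap v ^ (rhoExp γ κ ζ ν - γ) * f t v) ≤ Mf
  gMomentInt : ∀ t ∈ Set.Icc 0 T,
    Integrable (fun v => jap v ^ (rhoExp γ κ ζ ν - γ) * g t v)
  gMoment : ∀ t ∈ Set.Icc 0 T, (∫ v, jap v ^ (rhoExp γ κ ζ ν - γ) * g t v) ≤ Mg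

/-- The good term 𝒢_s. -/
def goodTerm (γ : ℝ) (f g : ℝ → V3 → ℝ) (fGrad : ℝ → V3 × V3 → V3 × V3) (s : ℝ) : ℝ :=
  2 * ∫ p : V3 × V3,
    quadForm (landauKernel γ (p.1 - p.2))
      (((fGrad s p).1 - (fGrad s p).2) -
        Real.sqrt (f s p.1 * f s p.2) • (logGrad (g s) p.1 - logGrad (g s) p.2))

/-- The vector field a(v−v')(∇−∇')(g g'). -/
def landauFlux (γ : ℝ) (g : V3 → ℝ) (v w : V3) : Fin 3 → ℝ := fun i =>
  ∑ j, landauKernel γ (v - w) i j * (g w * (gradient g v) j - g v * (gradient g w) j)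

/-- (∇−∇')·[a(v−v')(∇−∇')(g g')]. -/
def divDiffFlux (γ : ℝ) (g : V3 → ℝ) (v w : V3) : ℝ :=
  ∑ i, (fderiv ℝ (fun z => landauFlux γ g z w i) v (esingle i) -
        fderiv ℝ (fun z => landauFlux γ g v z i) w (esingle i))

/-- The bad term ℬ_s. -/
def badTerm (γ : ℝ) (f g : ℝ → V3 → ℝ) (s : ℝ) : ℝ :=
  (1 / 2) * ∫ p : V3 × V3,
    (f s p.1 - g s p.1) * (f s p.2 - g s p.2) / (g s p.1 * g s p.2) *
      divDiffFlux γ (g s) p.1 p.2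

/-- Weighted relative Fisher information ∫ |2∇√f − √f ∇ln g|² ⟨v⟩^γ dv. -/
def relFisher (γ : ℝ) (f g : V3 → ℝ) (fGrad3 : V3 → V3) : ℝ :=
  ∫ v, ‖(2 : ℝ) • fGrad3 v - Real.sqrt (f v) • logGrad g v‖ ^ 2 * jap v ^ γ

/-- ‖⟨v⟩^{−κ} ∇ ln g_s‖_{L^∞(ℝ³)} ∈ [0,∞]. -/
def gradLogSup (g : ℝ → V3 → ℝ) (κ s : ℝ) : ℝ≥0∞ :=
  ⨆ v : V3, ENNReal.ofReal (jap v ^ (-κ) * ‖logGrad (g s) v‖)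

/-- ‖⟨v⟩^{−ν} ∂_s ln g_s‖_{L^∞(ℝ³)} ∈ [0,∞]. -/
def dtLogSup (g : ℝ → V3 → ℝ) (T ν s : ℝ) : ℝ≥0∞ :=
  ⨆ v : V3, ENNReal.ofReal
    (jap v ^ (-ν) * |derivWithin (fun r => Real.log (g r v)) (Set.Icc 0 T) s|)

/-- ‖⟨v⟩^{−ζ} ∇² ln g_s‖_{L^∞(ℝ³)} ∈ [0,∞]. -/
def hessLogSup (g : ℝ → V3 → ℝ) (ζ s : ℝ) : ℝ≥0∞ :=
  ⨆ v : V3, ENNReal.ofReal (jap v ^ (-ζ) * matNorm (logHess (g s) v))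

/-- Open cube Σ_R(v₀) = v₀ + (−R,R)³. -/
def cube (v₀ : V3) (R : ℝ) : Set V3 := {v | ∀ i, |v i - v₀ i| < R}

/-- Closed cube v₀ + [−R,R]³ centered at the origin. -/
def ccube (R : ℝ) : Set V3 := {v | ∀ i, |v i| ≤ R}

/-- Distance to the boundary of the cube Σ_R(v₀). -/
def dCube (v₀ : V3) (R : ℝ) (v : V3) : ℝ :=
  Finset.univ.inf' (Finset.univ_nonempty) fun i : Fin 3 => R - |v i - v₀ i|

/-- The moment exponent k(γ,ℓ,δ) of Theorem 2. -/
def kExp (γ ℓ δ : ℝ) : ℝ := 8 * (max (2 + (ℓ - 2) / (2 + δ)) 1 + (2 - γ) / (2 * δ)) - γ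

open MeasureTheory Real
open scoped ENNReal RealInnerProductSpace
set_option linter.unusedSectionVars false

section Generic

variable {E : Type*} [NormedAddCommGroup E] [InnerProductSpace ℝ E] [FiniteDimensional ℝ E]

theorem lb_second_test {f f' : ℝ → ℝ} {c : ℝ} (hf : ∀ τ, HasDerivAt f (f' τ) τ)
    (hc : HasDerivAt f' c 0) (hm : IsLocalMax f 0) : c ≤ 0 := by
  by_contra hcon
  push Not at hcon
  have hd : deriv f = f' := by
    funext τ; exact (hf τ).deriv
  have h0 : f' 0 = 0 := hm.hasDerivAt_eq_zero (hf 0)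
  have hmin : IsLocalMin f 0 := by
    apply isLocalMin_of_deriv_deriv_pos
    · rw [hd, hc.deriv]; exact hcon
    · rw [hd, h0]
    · exact (hf 0).continuousAt
  have hev : ∀ᶠ τ in nhds (0:ℝ), f τ = f 0 := by
    filter_upwards [hm, hmin] with τ h1 h2
    exact le_antisymm h1 h2
  have hev2 : ∀ᶠ τ in nhds (0:ℝ), f' τ = 0 := by
    filter_upwards [eventually_eventually_nhds.2 hev] with τ h1
    have : HasDerivAt f 0 τ := (hasDerivAt_const τ (f 0)).congr_of_eventuallyEq h1
    exact (hf τ).unique this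
  have : HasDerivAt f' 0 0 := (hasDerivAt_const (0:ℝ) (0:ℝ)).congr_of_eventuallyEq hev2
  have := hc.unique this
  linarith

theorem lb_polar (Q : E →L[ℝ] E →L[ℝ] ℝ) (hs : ∀ x y, Q x y = Q y x) {c : ℝ} (hc : 0 ≤ c)
    (h : ∀ e, ‖e‖ = 1 → |Q e e| ≤ c) : ‖Q‖ ≤ c := by
  have hq : ∀ x, |Q x x| ≤ c * ‖x‖ ^ 2 := by
    intro x
    by_cases hx : x = 0
    · simp [hx]
    have hn : 0 < ‖x‖ := norm_pos_iff.2 hx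
    have := h (‖x‖⁻¹ • x) (by rw [norm_smul, norm_inv, norm_norm]; field_simp)
    simp only [map_smul, smul_eq_mul, ContinuousLinearMap.smul_apply, abs_mul, abs_inv, abs_norm] at this
    have h2 : |Q x x| = ‖x‖ ^ 2 * (‖x‖⁻¹ * (‖x‖⁻¹ * |Q x x|)) := by field_simp
    rw [h2]
    nlinarith [sq_nonneg ‖x‖]
  have hu : ∀ x y, ‖x‖ = 1 → ‖y‖ = 1 → |Q x y| ≤ c := by
    intro x y hx hy
    have h4 : Q x y = (Q (x+y) (x+y) - Q (x-y) (x-y)) / 4 := by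
      simp only [map_add, map_sub, ContinuousLinearMap.add_apply, ContinuousLinearMap.sub_apply]
      rw [hs y x]; ring
    have h1 := abs_le.1 (hq (x+y))
    have h2 := abs_le.1 (hq (x-y))
    have h3 := parallelogram_law_with_norm ℝ x y
    rw [hx, hy] at h3
    rw [h4, abs_le]
    constructor <;> nlinarith
  refine Q.opNorm_le_bound₂ hc ?_
  intro x y
  by_cases hx : x = 0
  · simp [hx]
  by_cases hy : y = 0
  · simp [hy]
  have hn : 0 < ‖x‖ := norm_pos_iff.2 hx
  have hn' : 0 < ‖y‖ := norm_pos_iff.2 hy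
  have := hu (‖x‖⁻¹ • x) (‖y‖⁻¹ • y) (by rw [norm_smul, norm_inv, norm_norm]; field_simp)
    (by rw [norm_smul, norm_inv, norm_norm]; field_simp)
  simp only [map_smul, smul_eq_mul, ContinuousLinearMap.smul_apply, abs_mul, abs_inv, abs_norm] at this
  rw [Real.norm_eq_abs]
  have h2 : |Q x y| = ‖x‖ * ‖y‖ * (‖x‖⁻¹ * (‖y‖⁻¹ * |Q x y|)) := by field_simp
  rw [h2]
  have : ‖y‖⁻¹ * (‖x‖⁻¹ * |Q x y|) ≤ c := by first | exact this | (convert this using 1; ring)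
  calc ‖x‖ * ‖y‖ * (‖x‖⁻¹ * (‖y‖⁻¹ * |Q x y|)) = ‖x‖ * ‖y‖ * (‖y‖⁻¹ * (‖x‖⁻¹ * |Q x y|)) := by ring
    _ ≤ ‖x‖ * ‖y‖ * c := by gcongr
    _ = _ := by ring

theorem lb_line_deriv {F : Type*} [NormedAddCommGroup F] [NormedSpace ℝ F] {φ : E → F}
    {D1 : E → E →L[ℝ] F} (h1 : ∀ x, HasFDerivAt φ (D1 x) x) (x e : E) (τ : ℝ) :
    HasDerivAt (fun τ : ℝ => φ (x + τ • e)) (D1 (x + τ • e) e) τ := by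
  have h : HasDerivAt (fun τ : ℝ => x + τ • e) e τ := by
    simpa using ((hasDerivAt_id τ).smul_const e).const_add x
  exact (h1 (x + τ • e)).comp_hasDerivAt τ h

theorem lb_line_deriv2 {φ : E → ℝ}
    {D2 : E → E →L[ℝ] E →L[ℝ] ℝ} {D1 : E → E →L[ℝ] ℝ}
    (h2 : ∀ x, HasFDerivAt D1 (D2 x) x) (x e : E) (τ : ℝ) :
    HasDerivAt (fun τ : ℝ => D1 (x + τ • e) e) (D2 (x + τ • e) e e) τ := by
  have := (lb_line_deriv h2 x e τ).clm_apply (hasDerivAt_const τ e)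
  simpa using this

/-- second difference mean value theorem -/
theorem lb_second_diff {φ : E → ℝ} {D1 : E → E →L[ℝ] ℝ} {D2 : E → E →L[ℝ] E →L[ℝ] ℝ}
    (h1 : ∀ x, HasFDerivAt φ (D1 x) x) (h2 : ∀ x, HasFDerivAt D1 (D2 x) x)
    (x e : E) {h : ℝ} (hh : 0 < h) :
    ∃ τ : ℝ, |τ| ≤ h ∧ φ (x + h • e) + φ (x - h • e) - 2 * φ x = h ^ 2 * D2 (x + τ • e) e e := by
  have hm : ∀ τ : ℝ, HasDerivAt (fun τ : ℝ => φ (x - τ • e)) (- D1 (x - τ • e) e) τ := by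
    intro τ
    have := lb_line_deriv h1 x (-e) τ
    simpa [sub_eq_add_neg] using this
  have hf : ∀ τ : ℝ, HasDerivAt (fun τ : ℝ => φ (x + τ • e) + φ (x - τ • e))
      (D1 (x + τ • e) e + - D1 (x - τ • e) e) τ := fun τ => (lb_line_deriv h1 x e τ).add (hm τ)
  have hg : ∀ τ : ℝ, HasDerivAt (fun τ : ℝ => τ ^ 2) (2 * τ) τ := by
    intro τ; simpa using hasDerivAt_pow 2 τ
  obtain ⟨c, hc, hceq⟩ := exists_ratio_hasDerivAt_eq_ratio_slope _ _ hh
    (fun τ _ => (hf τ).continuousAt.continuousWithinAt) (fun τ _ => hf τ) _ _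
    (fun τ _ => (hg τ).continuousAt.continuousWithinAt) (fun τ _ => hg τ)
  have hc' : -c < c := by linarith [hc.1]
  obtain ⟨τ, hτ, hτeq⟩ := exists_hasDerivAt_eq_slope _ _ hc'
    (fun τ _ => (lb_line_deriv2 (φ := φ) h2 x e τ).continuousAt.continuousWithinAt)
    (fun τ _ => lb_line_deriv2 (φ := φ) h2 x e τ)
  refine ⟨τ, abs_le.2 ⟨by linarith [hτ.1, hc.2], by linarith [hτ.2, hc.2]⟩, ?_⟩
  rw [hτeq]
  simp only [neg_smul, zero_smul, add_zero, sub_zero] at hceq ⊢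
  have hcp := hc.1
  have e1 : x + -(c • e) = x - c • e := by rw [sub_eq_add_neg]
  rw [e1]
  field_simp
  simp only [zero_pow (two_ne_zero), sub_zero] at hceq
  have : c * 2 ≠ 0 := by positivity
  linear_combination (-1) * hceq

set_option maxHeartbeats 1000000 in
/-- Gradient lemma via doubling and the maximum principle. -/
theorem lb_grad {T θ lam Lam r Ω Fb Γ : ℝ} (hθ : 0 < θ) (hlam : 0 < lam)
    (hLam : 0 ≤ Lam) (hr : 0 < r) (hΩ : 0 ≤ Ω) (hFb : 0 < Fb) (hΓ : 0 ≤ Γ) (x₀ : E)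
    (w : ℝ → E → ℝ) (D1 : ℝ → E → E →L[ℝ] ℝ) (D2 : ℝ → E → E →L[ℝ] E →L[ℝ] ℝ)
    (A : ℝ → (E →L[ℝ] E →L[ℝ] ℝ) →L[ℝ] ℝ) (F : ℝ → E → ℝ)
    (h1 : ∀ t ∈ Set.Icc 0 T, ∀ x, HasFDerivAt (w t) (D1 t x) x)
    (h2 : ∀ t ∈ Set.Icc 0 T, ∀ x, HasFDerivAt (D1 t) (D2 t x) x)
    (ht : ∀ t ∈ Set.Icc 0 T, ∀ x ∈ Metric.closedBall x₀ (2 * r),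
      HasDerivWithinAt (fun s => w s x) (θ * (A t (D2 t x) + F t x)) (Set.Icc 0 T) t)
    (hcont : ContinuousOn (fun p : ℝ × E => w p.1 p.2)
      (Set.Icc 0 T ×ˢ Metric.closedBall x₀ (2 * r)))
    (hF : ∀ t ∈ Set.Icc 0 T, ∀ x ∈ Metric.closedBall x₀ (2 * r), |F t x| ≤ Fb)
    (hosc : ∀ t ∈ Set.Icc 0 T, ∀ x ∈ Metric.closedBall x₀ (2 * r),
      ∀ y ∈ Metric.closedBall x₀ (2 * r), |w t x - w t y| ≤ Ω)
    (hinit : ∀ x ∈ Metric.closedBall x₀ (2 * r), ∀ y ∈ Metric.closedBall x₀ (2 * r),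
      |w 0 x - w 0 y| ≤ Γ * ‖x - y‖)
    (hell : ∀ t ∈ Set.Icc 0 T, ∀ e : E, ‖e‖ = 1 → ∀ Q : E →L[ℝ] E →L[ℝ] ℝ, ∀ c : ℝ, 0 ≤ c →
      (∀ l, Q l l ≤ c * ‖l‖ ^ 2) → A t Q ≤ lam * Q e e + c * Lam)
    {t : ℝ} (htI : t ∈ Set.Icc 0 T) {e : E} (he : ‖e‖ = 1) {s : ℝ} (hs0 : 0 ≤ s) (hsr : s ≤ r) :
    w t (x₀ + s • e) - w t (x₀ - s • e) ≤
      2 * s * (Ω / r * (1 + Lam / lam) + 2 * Fb * r / lam + Γ) := by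
  set b : ℝ := Ω / r ^ 2 with hb
  have hb0 : 0 ≤ b := by positivity
  set b' : ℝ := b + (b * Lam + 2 * Fb) / lam with hb'
  have hb'0 : 0 < b' := by positivity
  have hbb : b ≤ b' := by
    have : 0 ≤ (b * Lam + 2 * Fb) / lam := by positivity
    linarith
  have hbr : b * r ^ 2 = Ω := by rw [hb]; field_simp
  -- membership
  have hmem : ∀ z ∈ Metric.closedBall (0:E) r, ∀ σ ∈ Set.Icc 0 r,
      x₀ + z + σ • e ∈ Metric.closedBall x₀ (2 * r) ∧ x₀ + z - σ • e ∈ Metric.closedBall x₀ (2 * r) := by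
    intro z hz σ hσ
    rw [mem_closedBall_zero_iff] at hz
    have hn : ‖σ • e‖ ≤ r := by
      rw [norm_smul, he, mul_one, Real.norm_eq_abs, abs_of_nonneg hσ.1]; exact hσ.2
    constructor
    · rw [mem_closedBall_iff_norm]
      have : x₀ + z + σ • e - x₀ = z + σ • e := by abel
      rw [this]; linarith [norm_add_le z (σ • e)]
    · rw [mem_closedBall_iff_norm]
      have : x₀ + z - σ • e - x₀ = z - σ • e := by abel
      rw [this]; linarith [norm_sub_le z (σ • e)]
  set Ψ : ℝ × E × ℝ → ℝ := fun p => w p.1 (x₀ + p.2.1 + p.2.2 • e) - w p.1 (x₀ + p.2.1 - p.2.2 • e)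
    - (b * ‖p.2.1‖ ^ 2 + b' * (2 * r * p.2.2 - p.2.2 ^ 2) + 2 * Γ * p.2.2) with hΨ
  set K : Set (ℝ × E × ℝ) := Set.Icc 0 T ×ˢ (Metric.closedBall (0:E) r ×ˢ Set.Icc 0 r) with hK
  have hKc : IsCompact K := isCompact_Icc.prod ((isCompact_closedBall _ _).prod isCompact_Icc)
  have hKn : K.Nonempty := ⟨(t, 0, s), htI, by simp [hr.le], hs0, hsr⟩
  have hΨc : ContinuousOn Ψ K := by
    have c1 : ContinuousOn (fun p : ℝ × E × ℝ => w p.1 (x₀ + p.2.1 + p.2.2 • e)) K := by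
      refine hcont.comp (f := fun p : ℝ × E × ℝ => (p.1, x₀ + p.2.1 + p.2.2 • e)) (by fun_prop) ?_
      intro p hp
      exact ⟨hp.1, (hmem _ hp.2.1 _ hp.2.2).1⟩
    have c2 : ContinuousOn (fun p : ℝ × E × ℝ => w p.1 (x₀ + p.2.1 - p.2.2 • e)) K := by
      refine hcont.comp (f := fun p : ℝ × E × ℝ => (p.1, x₀ + p.2.1 - p.2.2 • e)) (by fun_prop) ?_
      intro p hp
      exact ⟨hp.1, (hmem _ hp.2.1 _ hp.2.2).2⟩
    exact (c1.sub c2).sub (by fun_prop)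
  obtain ⟨⟨t', z', s'⟩, hpK, hpmax⟩ := hKc.exists_isMaxOn hKn hΨc
  have hkey : Ψ (t', z', s') ≤ 0 := by
    by_contra hcon
    push Not at hcon
    obtain ⟨ht', hz', hs'⟩ : t' ∈ Set.Icc 0 T ∧ z' ∈ Metric.closedBall (0:E) r ∧ s' ∈ Set.Icc 0 r :=
      ⟨hpK.1, hpK.2.1, hpK.2.2⟩
    have hm := hmem z' hz' s' hs'
    have hosc' := (abs_le.1 (hosc t' ht' _ hm.1 _ hm.2)).2
    have hsq : 0 ≤ 2 * r * s' - s' ^ 2 := by nlinarith [hs'.1, hs'.2]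
    have hG : 0 ≤ 2 * Γ * s' := by have := hs'.1; positivity
    have hz2 : 0 ≤ b * ‖z'‖ ^ 2 := by positivity
    have hq2 : 0 ≤ b' * (2 * r * s' - s' ^ 2) := by positivity
    have hs1 : 0 < s' := by
      rcases hs'.1.lt_or_eq with h | h
      · exact h
      · exfalso
        simp only [hΨ] at hcon
        rw [← h] at hcon
        simp at hcon
        linarith
    have hs2 : s' < r := by
      rcases hs'.2.lt_or_eq with h | h
      · exact h
      · exfalso
        simp only [hΨ] at hcon
        have : b' * (2 * r * s' - s' ^ 2) ≥ Ω := by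
          rw [h, ← hbr]; nlinarith [mul_le_mul_of_nonneg_right hbb (sq_nonneg r)]
        linarith
    have hz1 : ‖z'‖ < r := by
      rcases (mem_closedBall_zero_iff.1 hz').lt_or_eq with h | h
      · exact h
      · exfalso
        simp only [hΨ] at hcon
        rw [h, hbr] at hcon
        linarith
    have ht1 : 0 < t' := by
      rcases ht'.1.lt_or_eq with h | h
      · exact h
      · exfalso
        simp only [hΨ] at hcon
        rw [← h] at hcon
        have h3 := (abs_le.1 (hinit _ hm.1 _ hm.2)).2
        have h4 : ‖x₀ + z' + s' • e - (x₀ + z' - s' • e)‖ = 2 * s' := by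
          have : x₀ + z' + s' • e - (x₀ + z' - s' • e) = (2 * s') • e := by
            rw [mul_smul, two_smul]; abel
          rw [this, norm_smul, he, mul_one, Real.norm_eq_abs, abs_of_pos (by linarith)]
        rw [h4] at h3
        nlinarith
    set Q := D2 t' (x₀ + z' + s' • e) - D2 t' (x₀ + z' - s' • e) with hQ
    -- second derivative in z
    have hQl : ∀ l, Q l l ≤ 2 * b * ‖l‖ ^ 2 := by
      intro l
      have hnear : ∀ᶠ τ : ℝ in nhds 0, z' + τ • l ∈ Metric.closedBall (0:E) r := by
        have : ContinuousAt (fun τ : ℝ => ‖z' + τ • l‖) 0 := by fun_prop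
        have h := this.eventually_lt (continuousAt_const (y := r)) (by simpa using hz1)
        filter_upwards [h] with τ hτ
        exact mem_closedBall_zero_iff.2 hτ.le
      have hmx : IsLocalMax (fun τ : ℝ => Ψ (t', z' + τ • l, s')) 0 := by
        filter_upwards [hnear] with τ hτ
        simp only [zero_smul, add_zero]
        exact hpmax (show (t', z' + τ • l, s') ∈ K from ⟨ht', hτ, hs'⟩)
      have hns : ∀ τ : ℝ, ‖z' + τ • l‖ ^ 2 = ‖z'‖ ^ 2 + 2 * τ * inner ℝ z' l + τ ^ 2 * ‖l‖ ^ 2 := by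
        intro τ
        rw [norm_add_sq_real, inner_smul_right, norm_smul, mul_pow, Real.norm_eq_abs, sq_abs]; ring
      have hd1 : ∀ τ : ℝ, HasDerivAt (fun τ : ℝ => Ψ (t', z' + τ • l, s'))
          (D1 t' (x₀ + z' + s' • e + τ • l) l - D1 t' (x₀ + z' - s' • e + τ • l) l
            - (b * (2 * inner ℝ z' l + 2 * τ * ‖l‖ ^ 2))) τ := by
        intro τ
        have a1 := lb_line_deriv (h1 t' ht') (x₀ + z' + s' • e) l τ
        have a2 := lb_line_deriv (h1 t' ht') (x₀ + z' - s' • e) l τ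
        have a3 : HasDerivAt (fun τ : ℝ => b * (‖z'‖ ^ 2 + 2 * τ * inner ℝ z' l + τ ^ 2 * ‖l‖ ^ 2)
            + b' * (2 * r * s' - s' ^ 2) + 2 * Γ * s') (b * (2 * inner ℝ z' l + 2 * τ * ‖l‖ ^ 2)) τ := by
          have q1 : HasDerivAt (fun τ : ℝ => 2 * τ * inner ℝ z' l) (2 * inner ℝ z' l) τ := by
            simpa using ((hasDerivAt_id τ).const_mul 2).mul_const (inner ℝ z' l)
          have q2 : HasDerivAt (fun τ : ℝ => τ ^ 2 * ‖l‖ ^ 2) (2 * τ * ‖l‖ ^ 2) τ := by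
            simpa using (hasDerivAt_pow 2 τ).mul_const (‖l‖ ^ 2)
          exact ((((q1.const_add (‖z'‖ ^ 2)).add q2).const_mul b).add_const _).add_const _
        refine ((a1.sub a2).sub a3).congr_of_eventuallyEq (Filter.Eventually.of_forall ?_)
        intro τ'
        simp only [hΨ]
        rw [hns τ']
        have e1 : x₀ + (z' + τ' • l) + s' • e = x₀ + z' + s' • e + τ' • l := by abel
        have e2 : x₀ + (z' + τ' • l) - s' • e = x₀ + z' - s' • e + τ' • l := by abel
        simp only [e1, e2, Pi.sub_apply]
      have hd2 : HasDerivAt (fun τ : ℝ => D1 t' (x₀ + z' + s' • e + τ • l) l - D1 t' (x₀ + z' - s' • e + τ • l) l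
            - (b * (2 * inner ℝ z' l + 2 * τ * ‖l‖ ^ 2))) (Q l l - 2 * b * ‖l‖ ^ 2) 0 := by
        have a1 := lb_line_deriv2 (φ := w t') (h2 t' ht') (x₀ + z' + s' • e) l 0
        have a2 := lb_line_deriv2 (φ := w t') (h2 t' ht') (x₀ + z' - s' • e) l 0
        have a3 : HasDerivAt (fun τ : ℝ => b * (2 * inner ℝ z' l + 2 * τ * ‖l‖ ^ 2)) (b * (2 * ‖l‖ ^ 2)) 0 := by
          have q1 : HasDerivAt (fun τ : ℝ => 2 * τ * ‖l‖ ^ 2) (2 * ‖l‖ ^ 2) 0 := by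
            simpa using ((hasDerivAt_id (0:ℝ)).const_mul 2).mul_const (‖l‖ ^ 2)
          exact (q1.const_add _).const_mul b
        refine ((a1.sub a2).sub a3).congr_deriv ?_
        simp [hQ]; ring
      have := lb_second_test hd1 hd2 hmx
      linarith
    -- second derivative in s
    have hQe : Q e e ≤ - (2 * b') := by
      have hnear : ∀ᶠ τ : ℝ in nhds 0, s' + τ ∈ Set.Icc 0 r := by
        have h := (continuousAt_const (y := s') (x := (0:ℝ))).add continuousAt_id
        have h3 := h.eventually (Icc_mem_nhds (a := 0) (b := r) (by simpa using hs1) (by simpa using hs2))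
        simpa using h3
      have hmx : IsLocalMax (fun τ : ℝ => Ψ (t', z', s' + τ)) 0 := by
        filter_upwards [hnear] with τ hτ
        simp only [add_zero]
        exact hpmax (show (t', z', s' + τ) ∈ K from ⟨ht', hz', hτ⟩)
      have hd1 : ∀ τ : ℝ, HasDerivAt (fun τ : ℝ => Ψ (t', z', s' + τ))
          (D1 t' (x₀ + z' + s' • e + τ • e) e - D1 t' (x₀ + z' - s' • e + τ • (-e)) (-e)
            - (b' * (2 * r - 2 * (s' + τ)) + 2 * Γ)) τ := by
        intro τ
        have a1 := lb_line_deriv (h1 t' ht') (x₀ + z' + s' • e) e τ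
        have a2 := lb_line_deriv (h1 t' ht') (x₀ + z' - s' • e) (-e) τ
        have a3 : HasDerivAt (fun τ : ℝ => b * ‖z'‖ ^ 2 + b' * (2 * r * (s' + τ) - (s' + τ) ^ 2)
            + 2 * Γ * (s' + τ)) (b' * (2 * r - 2 * (s' + τ)) + 2 * Γ) τ := by
          have q0 : HasDerivAt (fun τ : ℝ => s' + τ) 1 τ := (hasDerivAt_id τ).const_add s'
          have q1 : HasDerivAt (fun τ : ℝ => 2 * r * (s' + τ)) (2 * r) τ := by
            simpa using q0.const_mul (2 * r)
          have q2 : HasDerivAt (fun τ : ℝ => (s' + τ) ^ 2) (2 * (s' + τ)) τ := by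
            simpa using q0.fun_pow 2
          have q3 : HasDerivAt (fun τ : ℝ => 2 * Γ * (s' + τ)) (2 * Γ) τ := by
            simpa using q0.const_mul (2 * Γ)
          exact (((q1.sub q2).const_mul b').const_add _).add q3
        refine ((a1.sub a2).sub a3).congr_of_eventuallyEq (Filter.Eventually.of_forall ?_)
        intro τ'
        simp only [hΨ]
        have e1 : x₀ + z' + (s' + τ') • e = x₀ + z' + s' • e + τ' • e := by rw [add_smul]; abel
        have e2 : x₀ + z' - (s' + τ') • e = x₀ + z' - s' • e + τ' • (-e) := by
          rw [add_smul, smul_neg]; abel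
        simp only [e1, e2, Pi.sub_apply]
      have hd2 : HasDerivAt (fun τ : ℝ => D1 t' (x₀ + z' + s' • e + τ • e) e
            - D1 t' (x₀ + z' - s' • e + τ • (-e)) (-e)
            - (b' * (2 * r - 2 * (s' + τ)) + 2 * Γ)) (Q e e + 2 * b') 0 := by
        have a1 := lb_line_deriv2 (φ := w t') (h2 t' ht') (x₀ + z' + s' • e) e 0
        have a2 := lb_line_deriv2 (φ := w t') (h2 t' ht') (x₀ + z' - s' • e) (-e) 0
        have a3 : HasDerivAt (fun τ : ℝ => b' * (2 * r - 2 * (s' + τ)) + 2 * Γ) (b' * (-2)) 0 := by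
          have q0 : HasDerivAt (fun τ : ℝ => s' + τ) 1 0 := (hasDerivAt_id (0:ℝ)).const_add s'
          have q1 : HasDerivAt (fun τ : ℝ => 2 * (s' + τ)) 2 0 := by
            simpa using q0.const_mul 2
          exact ((q1.const_sub (2 * r)).const_mul b').add_const _
        refine ((a1.sub a2).sub a3).congr_deriv ?_
        simp [hQ, mul_comm]
      have := lb_second_test hd1 hd2 hmx
      linarith
    -- time derivative
    have htime : 0 ≤ θ * (A t' Q + F t' (x₀ + z' + s' • e) - F t' (x₀ + z' - s' • e)) := by
      have a1 := ht t' ht' _ hm.1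
      have a2 := ht t' ht' _ hm.2
      have a3 := ((a1.sub a2).sub_const (b * ‖z'‖ ^ 2 + b' * (2 * r * s' - s' ^ 2) + 2 * Γ * s')).mono
        (show Set.Icc 0 t' ⊆ Set.Icc 0 T from Set.Icc_subset_Icc_right ht'.2)
      have hmx : IsMaxOn (fun τ => Ψ (τ, z', s')) (Set.Icc 0 t') t' := by
        intro τ hτ
        exact hpmax (show (τ, z', s') ∈ K from ⟨⟨hτ.1, hτ.2.trans ht'.2⟩, hz', hs'⟩)
      have hne := a3.hasFDerivWithinAt
      have hmx' : IsLocalMaxOn (fun τ => Ψ (τ, z', s')) (Set.Icc 0 t') t' := hmx.localize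
      have hcone : (0 - t' : ℝ) ∈ posTangentConeAt (Set.Icc 0 t') t' := by
        apply sub_mem_posTangentConeAt_of_segment_subset
        rw [segment_symm, segment_eq_Icc ht1.le]
      have := hmx'.hasFDerivWithinAt_nonpos hne hcone
      simp only [zero_sub, ContinuousLinearMap.toSpanSingleton_apply, smul_eq_mul] at this
      have hAQ : A t' Q = A t' (D2 t' (x₀ + z' + s' • e)) - A t' (D2 t' (x₀ + z' - s' • e)) := by
        rw [hQ]; exact map_sub (A t') _ _
      rw [hAQ]
      have := nonneg_of_mul_nonneg_right (by linarith : 0 ≤ t' * (θ * (A t' (D2 t' (x₀ + z' + s' • e)) + F t' (x₀ + z' + s' • e)) -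
        θ * (A t' (D2 t' (x₀ + z' - s' • e)) + F t' (x₀ + z' - s' • e)))) ht1
      linarith
    have hAQ : A t' Q ≤ lam * (- (2 * b')) + 2 * b * Lam := by
      have := hell t' ht' e he Q (2 * b) (by positivity) hQl
      nlinarith
    have f1 := (abs_le.1 (hF t' ht' _ hm.1)).2
    have f2 := (abs_le.1 (hF t' ht' _ hm.2)).1
    have hlb : lam * b' = lam * b + b * Lam + 2 * Fb := by rw [hb']; field_simp; ring
    have : A t' Q + F t' (x₀ + z' + s' • e) - F t' (x₀ + z' - s' • e) < 0 := by
      have : 0 ≤ lam * b := by positivity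
      nlinarith
    nlinarith
  have hfin : Ψ (t, 0, s) ≤ 0 := le_trans (hpmax (show (t, (0:E), s) ∈ K from ⟨htI, by simp [hr.le], hs0, hsr⟩)) hkey
  simp only [hΨ, add_zero, norm_zero] at hfin
  have hrb : r * b' = Ω / r * (1 + Lam / lam) + 2 * Fb * r / lam := by
    rw [hb', hb]; field_simp; ring
  rw [← hrb]
  nlinarith [mul_nonneg hb'0.le (sq_nonneg s)]

end Generic

open MeasureTheory Real
open scoped ENNReal RealInnerProductSpace
set_option linter.unusedSectionVars false

section Generic2

variable {E : Type*} [NormedAddCommGroup E] [InnerProductSpace ℝ E] [FiniteDimensional ℝ E]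

theorem lb_interp {φ : E → ℝ} {D1 : E → E →L[ℝ] ℝ} {D2 : E → E →L[ℝ] E →L[ℝ] ℝ}
    (h1 : ∀ x, HasFDerivAt φ (D1 x) x) (h2 : ∀ x, HasFDerivAt D1 (D2 x) x)
    {x : E} {τ U H α : ℝ} (hτ : 0 < τ) (hα : 0 < α) (hU : 0 ≤ U) (hH : 0 ≤ H)
    (hb : ∀ y ∈ Metric.closedBall x τ, |φ y| ≤ U)
    (hh : ∀ y ∈ Metric.closedBall x τ, ‖D2 y - D2 x‖ ≤ H * ‖y - x‖ ^ α) :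
    ‖D2 x‖ ≤ 4 * U / τ ^ 2 + H * τ ^ α ∧ ‖D1 x‖ ≤ 5 * U / τ + 2 * H * τ ^ α * τ := by
  have hτα : 0 ≤ τ ^ α := by positivity
  have hmem : ∀ e : E, ‖e‖ = 1 → ∀ σ : ℝ, |σ| ≤ τ → x + σ • e ∈ Metric.closedBall x τ := by
    intro e he σ hσ
    rw [mem_closedBall_iff_norm, add_sub_cancel_left, norm_smul, he, mul_one]; exact hσ
  have hD : ∀ y ∈ Metric.closedBall x τ, ‖D2 y - D2 x‖ ≤ H * τ ^ α := by
    intro y hy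
    refine (hh y hy).trans ?_
    have := mem_closedBall_iff_norm.1 hy
    gcongr
  have hq : ∀ Q : E →L[ℝ] E →L[ℝ] ℝ, ∀ e : E, ‖e‖ = 1 → |Q e e| ≤ ‖Q‖ := by
    intro Q e he
    have := Q.le_opNorm₂ e e
    rwa [he, mul_one, mul_one] at this
  have A : ‖D2 x‖ ≤ 4 * U / τ ^ 2 + H * τ ^ α := by
    refine lb_polar _ (fun a b => second_derivative_symmetric h1 (h2 x) a b) (by positivity) ?_
    intro e he
    obtain ⟨σ, hσ, heq⟩ := lb_second_diff h1 h2 x e hτ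
    have b1 := hb _ (hmem e he τ (by rw [abs_of_pos hτ]))
    have b2 := hb _ (hmem e he (-τ) (by rw [abs_neg, abs_of_pos hτ]))
    have b3 := hb x (by simp [hτ.le])
    rw [neg_smul, ← sub_eq_add_neg] at b2
    have b4 : |D2 (x + σ • e) e e| ≤ 4 * U / τ ^ 2 := by
      have : D2 (x + σ • e) e e = (φ (x + τ • e) + φ (x - τ • e) - 2 * φ x) / τ ^ 2 := by
        rw [heq]; field_simp
      rw [this, abs_div, abs_of_pos (by positivity : (0:ℝ) < τ ^ 2)]
      gcongr
      rw [abs_le] at *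
      constructor <;> linarith
    have b5 := (hq _ e he).trans (hD _ (hmem e he σ hσ))
    simp only [ContinuousLinearMap.sub_apply] at b5
    rw [abs_le] at *
    constructor <;> linarith
  refine ⟨A, ?_⟩
  have hD1b : ∀ y ∈ Metric.closedBall x τ, ‖D1 y - D1 x‖ ≤ (4 * U / τ ^ 2 + 2 * (H * τ ^ α)) * τ := by
    intro y hy
    have := (convex_closedBall x τ).norm_image_sub_le_of_norm_hasFDerivWithin_le (f := D1) (f' := D2)
      (C := 4 * U / τ ^ 2 + 2 * (H * τ ^ α)) (fun z _ => (h2 z).hasFDerivWithinAt) ?_ (x := x) (y := y)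
      (by simp [hτ.le]) hy
    · refine this.trans ?_
      have := mem_closedBall_iff_norm.1 hy
      gcongr
    · intro z hz
      have := norm_le_norm_add_norm_sub' (D2 z) (D2 x)
      linarith [hD z hz]
  refine ContinuousLinearMap.opNorm_le_of_unit_norm (by positivity) ?_
  intro e he
  obtain ⟨σ, hσ, heq⟩ := exists_hasDerivAt_eq_slope (fun σ : ℝ => φ (x + σ • e)) _ (show -τ < τ by linarith)
    (fun σ _ => (lb_line_deriv h1 x e σ).continuousAt.continuousWithinAt)
    (fun σ _ => lb_line_deriv h1 x e σ)
  have b1 := hb _ (hmem e he τ (by rw [abs_of_pos hτ]))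
  have b2 := hb _ (hmem e he (-τ) (by rw [abs_neg, abs_of_pos hτ]))
  have b4 : |D1 (x + σ • e) e| ≤ U / τ := by
    rw [heq, abs_div, abs_of_pos (by linarith : (0:ℝ) < τ - -τ), div_le_div_iff₀ (by linarith) hτ]
    have : |φ (x + τ • e) - φ (x + -τ • e)| ≤ 2 * U := by
      rw [abs_le] at *
      constructor <;> linarith
    nlinarith
  have b5 := (D1 (x + σ • e) - D1 x).le_opNorm e
  rw [he, mul_one] at b5
  have b6 := b5.trans (hD1b _ (hmem e he σ (abs_le.2 ⟨hσ.1.le, hσ.2.le⟩)))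
  simp only [ContinuousLinearMap.sub_apply, Real.norm_eq_abs] at b6 ⊢
  have e1 : 5 * U / τ + 2 * H * τ ^ α * τ = U / τ + (4 * U / τ ^ 2 + 2 * (H * τ ^ α)) * τ := by
    field_simp; ring
  rw [e1]
  rw [abs_le] at *
  constructor <;> linarith

theorem lb_shift {F : Type*} [NormedAddCommGroup F] [NormedSpace ℝ F] {f : E → F} {f' : E →L[ℝ] F} {x a : E}
    (h : HasFDerivAt f f' (x + a)) : HasFDerivAt (fun y => f (y + a)) f' x := by
  have := h.comp x ((hasFDerivAt_id x).add_const a)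
  rw [ContinuousLinearMap.comp_id] at this
  exact this

/-- near-diagonal estimate with frozen coefficients -/
theorem lb_near {T θ lam Lam α H H0 Fα h r s τ : ℝ} (hθ : 0 < θ) (hlam : 0 < lam)
    (hLam : 0 ≤ Lam) (hα : 0 < α) (hα1 : α < 1) (hH : 0 ≤ H) (hH0 : 0 ≤ H0) (hFα : 0 < Fα)
    (hh : 0 < h) (hhr : h ≤ r) (hrτ : 3 * r ≤ τ) (hs : 0 ≤ s) (hsr : s ≤ r) (x₀ : E)
    (u : ℝ → E → ℝ) (D1 : ℝ → E → E →L[ℝ] ℝ) (D2 : ℝ → E → E →L[ℝ] E →L[ℝ] ℝ)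
    (A : ℝ → (E →L[ℝ] E →L[ℝ] ℝ) →L[ℝ] ℝ) (F : ℝ → E → ℝ)
    (h1 : ∀ t ∈ Set.Icc 0 T, ∀ x, HasFDerivAt (u t) (D1 t x) x)
    (h2 : ∀ t ∈ Set.Icc 0 T, ∀ x, HasFDerivAt (D1 t) (D2 t x) x)
    (ht : ∀ t ∈ Set.Icc 0 T, ∀ x ∈ Metric.closedBall x₀ τ,
      HasDerivWithinAt (fun s => u s x) (θ * (A t (D2 t x) + F t x)) (Set.Icc 0 T) t)
    (hcont : ContinuousOn (fun p : ℝ × E => u p.1 p.2) (Set.Icc 0 T ×ˢ Metric.closedBall x₀ τ))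
    (hF : ∀ t ∈ Set.Icc 0 T, ∀ x ∈ Metric.closedBall x₀ τ, ∀ y ∈ Metric.closedBall x₀ τ,
      |F t x - F t y| ≤ Fα * ‖x - y‖ ^ α)
    (hHol : ∀ t ∈ Set.Icc 0 T, ∀ x ∈ Metric.closedBall x₀ τ, ∀ y ∈ Metric.closedBall x₀ τ,
      ‖D2 t x - D2 t y‖ ≤ H * ‖x - y‖ ^ α)
    (hinit : ∀ x ∈ Metric.closedBall x₀ τ, ∀ y ∈ Metric.closedBall x₀ τ,
      ‖D2 0 x - D2 0 y‖ ≤ H0 * ‖x - y‖ ^ α)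
    (hell : ∀ t ∈ Set.Icc 0 T, ∀ e : E, ‖e‖ = 1 → ∀ Q : E →L[ℝ] E →L[ℝ] ℝ, ∀ c : ℝ, 0 ≤ c →
      (∀ l, Q l l ≤ c * ‖l‖ ^ 2) → A t Q ≤ lam * Q e e + c * Lam)
    {t : ℝ} (htI : t ∈ Set.Icc 0 T) {e e' : E} (he : ‖e‖ = 1) (he' : ‖e'‖ = 1) :
    h ^ 2 * (D2 t (x₀ + s • e) e' e' - D2 t (x₀ - s • e) e' e') ≤
      2 * (h ^ 2 * (H * h ^ α)) + 2 * s * (6 * h ^ 2 * H * r ^ α / r * (1 + Lam / lam)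
        + 2 * (2 * (Fα * h ^ α)) * r / lam + 2 * (H0 * h ^ α * h)) := by
  have hr : 0 < r := hh.trans_le hhr
  have h0T : (0:ℝ) ∈ Set.Icc 0 T := ⟨le_rfl, htI.1.trans htI.2⟩
  set w : ℝ → E → ℝ := fun t x => u t (x + h • e') + u t (x - h • e') - 2 * u t x with hw
  set W1 : ℝ → E → E →L[ℝ] ℝ := fun t x => D1 t (x + h • e') + D1 t (x - h • e') - (2:ℝ) • D1 t x with hW1
  set W2 : ℝ → E → E →L[ℝ] E →L[ℝ] ℝ := fun t x => D2 t (x + h • e') + D2 t (x - h • e') - (2:ℝ) • D2 t x with hW2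
  set G : ℝ → E → ℝ := fun t x => F t (x + h • e') + F t (x - h • e') - 2 * F t x with hG
  have hmem : ∀ x ∈ Metric.closedBall x₀ (2 * r), ∀ σ : ℝ, |σ| ≤ h → x + σ • e' ∈ Metric.closedBall x₀ τ := by
    intro x hx σ hσ
    rw [mem_closedBall_iff_norm] at *
    have e1 : x + σ • e' - x₀ = (x - x₀) + σ • e' := by abel
    have e2 : ‖σ • e'‖ ≤ h := by rw [norm_smul, he', mul_one]; exact hσ
    rw [e1]; linarith [norm_add_le (x - x₀) (σ • e')]
  have hmp : ∀ x ∈ Metric.closedBall x₀ (2 * r), x + h • e' ∈ Metric.closedBall x₀ τ := fun x hx =>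
    hmem x hx h (abs_of_pos hh).le
  have hmm : ∀ x ∈ Metric.closedBall x₀ (2 * r), x - h • e' ∈ Metric.closedBall x₀ τ := fun x hx => by
    have := hmem x hx (-h) (by rw [abs_neg]; exact (abs_of_pos hh).le)
    rwa [neg_smul, ← sub_eq_add_neg] at this
  have hm0 : ∀ x ∈ Metric.closedBall x₀ (2 * r), x ∈ Metric.closedBall x₀ τ := fun x hx => by
    have := hmem x hx 0 (by simpa using hh.le)
    simpa using this
  have w1 : ∀ t ∈ Set.Icc 0 T, ∀ x, HasFDerivAt (w t) (W1 t x) x := by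
    intro t ht x
    have a1 := lb_shift (h1 t ht (x + h • e'))
    have a2 := lb_shift (a := - (h • e')) (x := x) (by rw [← sub_eq_add_neg]; exact h1 t ht (x - h • e'))
    simp only [← sub_eq_add_neg] at a2
    exact (a1.add a2).sub ((h1 t ht x).const_mul 2)
  have w2 : ∀ t ∈ Set.Icc 0 T, ∀ x, HasFDerivAt (W1 t) (W2 t x) x := by
    intro t ht x
    have a1 := lb_shift (h2 t ht (x + h • e'))
    have a2 := lb_shift (a := - (h • e')) (x := x) (by rw [← sub_eq_add_neg]; exact h2 t ht (x - h • e'))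
    simp only [← sub_eq_add_neg] at a2
    exact (a1.add a2).sub ((h2 t ht x).const_smul (2:ℝ))
  have wt : ∀ t ∈ Set.Icc 0 T, ∀ x ∈ Metric.closedBall x₀ (2 * r),
      HasDerivWithinAt (fun s => w s x) (θ * (A t (W2 t x) + G t x)) (Set.Icc 0 T) t := by
    intro t htt x hx
    have a1 := ht t htt _ (hmp x hx)
    have a2 := ht t htt _ (hmm x hx)
    have a3 := ht t htt _ (hm0 x hx)
    refine ((a1.add a2).sub (a3.const_mul 2)).congr_deriv ?_
    have e1 : A t (W2 t x) = A t (D2 t (x + h • e')) + A t (D2 t (x - h • e')) - 2 * A t (D2 t x) := by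
      have q1 : A t (W2 t x) = A t (D2 t (x + h • e') + D2 t (x - h • e')) - A t ((2:ℝ) • D2 t x) := map_sub (A t) _ _
      have q2 : A t (D2 t (x + h • e') + D2 t (x - h • e')) = A t (D2 t (x + h • e')) + A t (D2 t (x - h • e')) :=
        map_add (A t) _ _
      have q3 : A t ((2:ℝ) • D2 t x) = 2 * A t (D2 t x) := map_smul (A t) _ _
      rw [q1, q2, q3]
    rw [e1]
    simp only [hG]
    ring
  have wc : ContinuousOn (fun p : ℝ × E => w p.1 p.2) (Set.Icc 0 T ×ˢ Metric.closedBall x₀ (2 * r)) := by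
    have c1 : ContinuousOn (fun p : ℝ × E => u p.1 (p.2 + h • e')) (Set.Icc 0 T ×ˢ Metric.closedBall x₀ (2 * r)) :=
      hcont.comp (f := fun p : ℝ × E => (p.1, p.2 + h • e')) (by fun_prop) (fun p hp => ⟨hp.1, hmp _ hp.2⟩)
    have c2 : ContinuousOn (fun p : ℝ × E => u p.1 (p.2 - h • e')) (Set.Icc 0 T ×ˢ Metric.closedBall x₀ (2 * r)) :=
      hcont.comp (f := fun p : ℝ × E => (p.1, p.2 - h • e')) (by fun_prop) (fun p hp => ⟨hp.1, hmm _ hp.2⟩)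
    have c3 : ContinuousOn (fun p : ℝ × E => u p.1 p.2) (Set.Icc 0 T ×ˢ Metric.closedBall x₀ (2 * r)) :=
      hcont.mono (Set.prod_mono_right (fun x hx => hm0 x hx))
    exact (c1.add c2).sub (c3.const_mul 2) 
  have ehn : ‖h • e'‖ = h := by rw [norm_smul, he', mul_one, Real.norm_eq_abs, abs_of_pos hh]
  have wF : ∀ t ∈ Set.Icc 0 T, ∀ x ∈ Metric.closedBall x₀ (2 * r), |G t x| ≤ 2 * (Fα * h ^ α) := by
    intro t ht x hx
    have a1 := hF t ht _ (hmp x hx) _ (hm0 x hx)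
    have a2 := hF t ht _ (hmm x hx) _ (hm0 x hx)
    have e1 : x + h • e' - x = h • e' := by abel
    have e2 : x - h • e' - x = - (h • e') := by abel
    rw [e1, ehn] at a1
    rw [e2, norm_neg, ehn] at a2
    have e3 : G t x = (F t (x + h • e') - F t x) + (F t (x - h • e') - F t x) := by simp only [hG]; ring
    rw [e3]
    exact (abs_add_le _ _).trans (by linarith)
  have hq : ∀ Q : E →L[ℝ] E →L[ℝ] ℝ, |Q e' e'| ≤ ‖Q‖ := by
    intro Q
    have := Q.le_opNorm₂ e' e'
    rwa [he', mul_one, mul_one] at this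
  have wosc : ∀ t ∈ Set.Icc 0 T, ∀ x ∈ Metric.closedBall x₀ (2 * r), ∀ y ∈ Metric.closedBall x₀ (2 * r),
      |w t x - w t y| ≤ 6 * h ^ 2 * H * r ^ α := by
    intro t ht x hx y hy
    obtain ⟨σ, hσ, q1⟩ := lb_second_diff (h1 t ht) (h2 t ht) x e' hh
    obtain ⟨σ', hσ', q2⟩ := lb_second_diff (h1 t ht) (h2 t ht) y e' hh
    have m1 := hmem x hx σ hσ
    have m2 := hmem y hy σ' hσ'
    have a := (hq _).trans (hHol t ht _ m1 _ m2)
    have hd : ‖x + σ • e' - (y + σ' • e')‖ ≤ 6 * r := by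
      rw [mem_closedBall_iff_norm] at *
      have e1 : x + σ • e' - (y + σ' • e') = (x - x₀) - (y - x₀) + (σ • e' - σ' • e') := by abel
      have e2 : ‖σ • e'‖ ≤ h := by rw [norm_smul, he', mul_one]; exact hσ
      have e3 : ‖σ' • e'‖ ≤ h := by rw [norm_smul, he', mul_one]; exact hσ'
      rw [e1]
      linarith [norm_add_le ((x - x₀) - (y - x₀)) (σ • e' - σ' • e'), norm_sub_le (x - x₀) (y - x₀),
        norm_sub_le (σ • e') (σ' • e')]
    have hp : ‖x + σ • e' - (y + σ' • e')‖ ^ α ≤ 6 * r ^ α := by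
      calc _ ≤ (6 * r) ^ α := by gcongr
        _ = 6 ^ α * r ^ α := by rw [Real.mul_rpow (by norm_num) hr.le]
        _ ≤ 6 ^ (1:ℝ) * r ^ α := by gcongr; norm_num
        _ = _ := by rw [Real.rpow_one]
    have e4 : w t x - w t y = h ^ 2 * (D2 t (x + σ • e') - D2 t (y + σ' • e')) e' e' := by
      simp only [hw, ContinuousLinearMap.sub_apply]; rw [q1, q2]; ring
    rw [e4, abs_mul, abs_of_pos (by positivity : (0:ℝ) < h ^ 2)]
    calc _ ≤ h ^ 2 * (H * (6 * r ^ α)) := by gcongr; exact a.trans (by gcongr)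
      _ = _ := by ring
  have winit : ∀ x ∈ Metric.closedBall x₀ (2 * r), ∀ y ∈ Metric.closedBall x₀ (2 * r),
      |w 0 x - w 0 y| ≤ 2 * (H0 * h ^ α * h) * ‖x - y‖ := by
    intro x hx y hy
    have hW : ∀ z ∈ Metric.closedBall x₀ (2 * r), ‖W1 0 z‖ ≤ 2 * (H0 * h ^ α * h) := by
      intro z hz
      have key : ∀ σ : ℝ, |σ| = h → ‖D1 0 (z + σ • e') - D1 0 z - D2 0 z (σ • e')‖ ≤ H0 * h ^ α * h := by
        intro σ hσ
        have hnσ : ‖σ • e'‖ = h := by rw [norm_smul, he', mul_one]; exact hσ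
        have := (convex_closedBall x₀ τ).inter (convex_closedBall z h) |>.norm_image_sub_le_of_norm_hasFDerivWithin_le'
          (f := D1 0) (f' := D2 0) (φ := D2 0 z) (C := H0 * h ^ α) (x := z) (y := z + σ • e')
          (fun p _ => (h2 0 h0T p).hasFDerivWithinAt) ?_ ⟨hm0 z hz, by simp [hh.le]⟩
          ⟨hmem z hz σ hσ.le, by rw [mem_closedBall_iff_norm, add_sub_cancel_left, hnσ]⟩
        · rwa [add_sub_cancel_left, hnσ] at this
        · intro p hp
          refine (hinit p hp.1 z (hm0 z hz)).trans ?_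
          have := mem_closedBall_iff_norm.1 hp.2
          gcongr
      have k1 := key h (abs_of_pos hh)
      have k2 := key (-h) (by rw [abs_neg, abs_of_pos hh])
      have e1 : W1 0 z = (D1 0 (z + h • e') - D1 0 z - D2 0 z (h • e')) +
          (D1 0 (z + -h • e') - D1 0 z - D2 0 z (-h • e')) := by
        simp only [hW1, neg_smul, map_neg, two_smul, ← sub_eq_add_neg]; abel
      rw [e1]
      exact (norm_add_le _ _).trans (by linarith)
    have := (convex_closedBall x₀ (2 * r)).norm_image_sub_le_of_norm_hasFDerivWithin_le
      (fun p _ => (w1 0 h0T p).hasFDerivWithinAt) hW hy hx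
    simpa using this
  have main := lb_grad hθ hlam hLam hr (by positivity) (by positivity) (by positivity) x₀ w W1 W2 A G
    w1 w2 wt wc wF wosc winit hell htI he hs hsr
  have hcmp : ∀ x ∈ Metric.closedBall x₀ (2 * r), |w t x - h ^ 2 * D2 t x e' e'| ≤ h ^ 2 * (H * h ^ α) := by
    intro x hx
    obtain ⟨σ, hσ, q1⟩ := lb_second_diff (h1 t htI) (h2 t htI) x e' hh
    have a := (hq _).trans (hHol t htI _ (hmem x hx σ hσ) _ (hm0 x hx))
    have e4 : w t x - h ^ 2 * D2 t x e' e' = h ^ 2 * (D2 t (x + σ • e') - D2 t x) e' e' := by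
      simp only [hw, ContinuousLinearMap.sub_apply]; rw [q1]; ring
    rw [e4, abs_mul, abs_of_pos (by positivity : (0:ℝ) < h ^ 2)]
    rw [add_sub_cancel_left, norm_smul, he', mul_one, Real.norm_eq_abs] at a
    gcongr
    exact a.trans (by gcongr)
  have m1 : x₀ + s • e ∈ Metric.closedBall x₀ (2 * r) := by
    rw [mem_closedBall_iff_norm, add_sub_cancel_left, norm_smul, he, mul_one, Real.norm_eq_abs, abs_of_nonneg hs]
    linarith
  have m2 : x₀ - s • e ∈ Metric.closedBall x₀ (2 * r) := by
    rw [mem_closedBall_iff_norm, sub_sub_cancel_left, norm_neg, norm_smul, he, mul_one, Real.norm_eq_abs, abs_of_nonneg hs]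
    linarith
  have c1 := (abs_le.1 (hcmp _ m1)).1
  have c2 := (abs_le.1 (hcmp _ m2)).2
  linarith
end Generic2

open MeasureTheory Real
open scoped ENNReal RealInnerProductSpace
set_option linter.unusedSectionVars false

section Generic3

variable {E : Type*} [NormedAddCommGroup E] [InnerProductSpace ℝ E] [FiniteDimensional ℝ E]

structure LBSol (α lam Lam ε U H0 T θ : ℝ) (u : ℝ → E → ℝ) (D1 : ℝ → E → E →L[ℝ] ℝ)
    (D2 : ℝ → E → E →L[ℝ] E →L[ℝ] ℝ) (A : ℝ → E → (E →L[ℝ] E →L[ℝ] ℝ) →L[ℝ] ℝ)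
    (f : ℝ → E → ℝ) : Prop where
  θpos : 0 < θ
  h1 : ∀ t ∈ Set.Icc 0 T, ∀ x, HasFDerivAt (u t) (D1 t x) x
  h2 : ∀ t ∈ Set.Icc 0 T, ∀ x, HasFDerivAt (D1 t) (D2 t x) x
  ht : ∀ t ∈ Set.Icc 0 T, ∀ x : E, ‖x‖ ≤ 1 →
      HasDerivWithinAt (fun s => u s x) (θ * (A t x (D2 t x) + f t x)) (Set.Icc 0 T) t
  hH : ∃ H : ℝ, ∀ t ∈ Set.Icc 0 T, ∀ x y : E, ‖x‖ ≤ 1 → ‖y‖ ≤ 1 → ‖D2 t x - D2 t y‖ ≤ H * ‖x - y‖ ^ α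
  hU : ∀ t ∈ Set.Icc 0 T, ∀ x : E, ‖x‖ ≤ 1 → |u t x| ≤ U
  hinit : ∀ x y : E, ‖x‖ ≤ 1 → ‖y‖ ≤ 1 → ‖D2 0 x - D2 0 y‖ ≤ H0 * ‖x - y‖ ^ α
  hell : ∀ t ∈ Set.Icc 0 T, ∀ x : E, ‖x‖ ≤ 1 → ∀ e : E, ‖e‖ = 1 → ∀ Q : E →L[ℝ] E →L[ℝ] ℝ,
      ∀ c : ℝ, 0 ≤ c → (∀ l, Q l l ≤ c * ‖l‖ ^ 2) → A t x Q ≤ lam * Q e e + c * Lam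
  hA : ∀ t ∈ Set.Icc 0 T, ∀ x y : E, ‖x‖ ≤ 1 → ‖y‖ ≤ 1 → ∀ Q : E →L[ℝ] E →L[ℝ] ℝ,
      |A t x Q - A t y Q| ≤ ε * ‖x - y‖ ^ α * ‖Q‖
  hf : ∀ t ∈ Set.Icc 0 T, ∀ x y : E, ‖x‖ ≤ 1 → ‖y‖ ≤ 1 →
      |f t x - f t y| ≤ ‖x - y‖ ^ α + ε * |u t x - u t y|

variable {α lam Lam ε U H0 T θ : ℝ} {u : ℝ → E → ℝ} {D1 : ℝ → E → E →L[ℝ] ℝ}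
    {D2 : ℝ → E → E →L[ℝ] E →L[ℝ] ℝ} {A : ℝ → E → (E →L[ℝ] E →L[ℝ] ℝ) →L[ℝ] ℝ}
    {f : ℝ → E → ℝ}

def LBP (α T S : ℝ) (D2 : ℝ → E → E →L[ℝ] E →L[ℝ] ℝ) : Prop :=
  ∀ t ∈ Set.Icc 0 T, ∀ (c : E) (ρ : ℝ), 0 < ρ → ‖c‖ + 2 * ρ ≤ 1 → ∀ x ∈ Metric.closedBall c ρ,
    ∀ y ∈ Metric.closedBall c ρ, ‖D2 t x - D2 t y‖ * ρ ^ (2 + α) ≤ S * ‖x - y‖ ^ α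

theorem LBSol.cont (hs : LBSol α lam Lam ε U H0 T θ u D1 D2 A f) (hα : 0 < α) (hU0 : 0 ≤ U) :
    ContinuousOn (fun p : ℝ × E => u p.1 p.2) (Set.Icc 0 T ×ˢ Metric.closedBall (0:E) 1) := by
  obtain ⟨H', hH'⟩ := hs.hH
  set H := max H' 0 with hHdef
  have hH0 : 0 ≤ H := le_max_right _ _
  have hH : ∀ t ∈ Set.Icc 0 T, ∀ x y : E, ‖x‖ ≤ 1 → ‖y‖ ≤ 1 → ‖D2 t x - D2 t y‖ ≤ H * ‖x - y‖ ^ α := by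
    intro t ht x y hx hy
    refine (hH' t ht x y hx hy).trans ?_
    gcongr
    exact le_max_left _ _
  have hL : ∀ t ∈ Set.Icc 0 T, ∀ x ∈ Metric.closedBall (0:E) 1, ‖D1 t x‖ ≤ 9 * U + 4 * H := by
    intro t ht x hx
    have ip := lb_interp (hs.h1 t ht) (hs.h2 t ht) (x := 0) (τ := 1) (U := U) (H := H) (α := α)
      one_pos hα hU0 hH0 (fun y hy => hs.hU t ht y (by simpa using hy))
      (fun y hy => hH t ht y 0 (by simpa using hy) (by simp))
    norm_num at ip
    have hD2 : ∀ z ∈ Metric.closedBall (0:E) 1, ‖D2 t z‖ ≤ 4 * U + 2 * H := by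
      intro z hz
      have hz' : ‖z‖ ≤ 1 := by simpa using hz
      have a := hH t ht z 0 hz' (by simp)
      rw [sub_zero] at a
      have a2 : ‖z‖ ^ α ≤ 1 := Real.rpow_le_one (norm_nonneg _) hz' hα.le
      have a3 : H * ‖z‖ ^ α ≤ H * 1 := by gcongr
      linarith [norm_le_norm_add_norm_sub' (D2 t z) (D2 t 0), ip.1]
    have := (convex_closedBall (0:E) 1).norm_image_sub_le_of_norm_hasFDerivWithin_le
      (fun z _ => (hs.h2 t ht z).hasFDerivWithinAt) hD2 (x := 0) (y := x) (by simp) hx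
    have hx' : ‖x - 0‖ ≤ 1 := by simpa using hx
    have a4 : (4 * U + 2 * H) * ‖x - 0‖ ≤ (4 * U + 2 * H) * 1 := by gcongr
    linarith [norm_le_norm_add_norm_sub' (D1 t x) (D1 t 0), ip.2]
  refine continuousOn_prod_of_continuousOn_lipschitzOnWith' _ (Real.toNNReal (9 * U + 4 * H)) ?_ ?_
  · intro t ht
    refine (convex_closedBall (0:E) 1).lipschitzOnWith_of_nnnorm_hasFDerivWithin_le
      (fun z _ => (hs.h1 t ht z).hasFDerivWithinAt) ?_
    intro z hz
    rw [← NNReal.coe_le_coe, coe_nnnorm, Real.coe_toNNReal _ (by positivity)]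
    exact hL t ht z hz
  · intro x hx t ht
    exact (hs.ht t ht x (by simpa using hx)).continuousWithinAt

set_option maxHeartbeats 1600000 in
theorem LBSol.near (hs : LBSol α lam Lam ε U H0 T θ u D1 D2 A f) (hα : 0 < α) (hα1 : α < 1)
    (hlam : 0 < lam) (hLam : 0 ≤ Lam) (hε : 0 ≤ ε) (hU0 : 0 ≤ U) (hH0 : 0 ≤ H0)
    {η N : ℝ} (hη : 0 < η) (hN : 1 ≤ N) (hNη : 1 ≤ N * η) {S : ℝ} (hS : 0 ≤ S) (hP : LBP α T S D2)
    {t : ℝ} (ht : t ∈ Set.Icc 0 T) {c : E} {ρ : ℝ} (hρ : 0 < ρ) (hcρ : ‖c‖ + 2 * ρ ≤ 1) {x y : E}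
    (hx : x ∈ Metric.closedBall c ρ) (hy : y ∈ Metric.closedBall c ρ) (hxy : 3 * (N * η) * ‖x - y‖ ≤ ρ) :
    ‖D2 t x - D2 t y‖ * ρ ^ (2 + α) ≤ (16 * η ^ α * S + 96 * (1 + Lam / lam) * (N * η) ^ (α - 1) * S
      + 8 * N * η ^ (α - 1) / lam * (1 + 136 * ε * (U + S)) + 4 * H0 * η ^ (α - 1)) * ‖x - y‖ ^ α := by
  by_cases hxy0 : x = y
  · subst hxy0
    have q : D2 t x - D2 t x = 0 := sub_self (D2 t x)
    have q' : ‖D2 t x - D2 t x‖ = 0 := by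
      rw [q]; exact norm_zero (E := E →L[ℝ] E →L[ℝ] ℝ)
    rw [q']
    simp [Real.zero_rpow hα.ne']
  have hd : 0 < ‖x - y‖ := norm_pos_iff.2 (sub_ne_zero.2 hxy0)
  have hρ1 : ρ ≤ 1 / 2 := by linarith [norm_nonneg c]
  set s : ℝ := ‖x - y‖ / 2 with hsdef
  have hs0 : 0 < s := by positivity
  set x₀ : E := (1/2 : ℝ) • (x + y) with hx₀
  set e : E := (1 / (2 * s)) • (x - y) with he_def
  have he : ‖e‖ = 1 := by
    rw [he_def, norm_smul, Real.norm_eq_abs, abs_of_pos (by positivity), hsdef]; field_simp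
  have hse : s • e = (1/2 : ℝ) • (x - y) := by
    rw [he_def, smul_smul]; congr 1; field_simp
  have hxp : x₀ + s • e = x := by rw [hse, hx₀]; module
  have hxm : x₀ - s • e = y := by rw [hse, hx₀]; module
  have hx₀c : ‖x₀ - c‖ ≤ ρ := by
    rw [mem_closedBall_iff_norm] at hx hy
    have : x₀ - c = (1/2 : ℝ) • ((x - c) + (y - c)) := by rw [hx₀]; module
    rw [this, norm_smul, Real.norm_eq_abs, abs_of_pos (by norm_num)]
    linarith [norm_add_le (x - c) (y - c)]
  have hx₀n : ‖x₀‖ ≤ ‖c‖ + ρ := by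
    have := norm_le_norm_add_norm_sub' x₀ c
    linarith
  set P : ℝ := ρ ^ (2 + α) with hPdef
  have hPp : 0 < P := by positivity
  have hP2 : P = ρ ^ 2 * ρ ^ α := by rw [hPdef, Real.rpow_add hρ]; norm_num
  have hρα1 : ρ ^ α ≤ 1 := Real.rpow_le_one hρ.le (by linarith) hα.le
  have hρα : 0 < ρ ^ α := by positivity
  have hP1 : P ≤ 1 := by rw [hP2]; nlinarith
  have h2α : (2:ℝ) ^ α ≤ 2 := by
    calc (2:ℝ) ^ α ≤ 2 ^ (1:ℝ) := Real.rpow_le_rpow_of_exponent_le (by norm_num) hα1.le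
      _ = 2 := Real.rpow_one _
  have h2α0 : (0:ℝ) < (2:ℝ) ^ α := by positivity
  have hhalf : (ρ / 2) ^ (2 + α) ≥ P / 8 := by
    rw [Real.div_rpow hρ.le (by norm_num)]
    have : (2:ℝ) ^ (2 + α) ≤ 8 := by
      rw [Real.rpow_add (by norm_num)]; norm_num; linarith
    gcongr
  have hquart : (ρ / 4) ^ (2 + α) ≥ P / 64 := by
    rw [Real.div_rpow hρ.le (by norm_num)]
    have : (4:ℝ) ^ (2 + α) ≤ 64 := by
      rw [show (4:ℝ) = 2 ^ (2:ℝ) by norm_num, ← Real.rpow_mul (by norm_num)]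
      rw [show (2:ℝ) * (2 + α) = 4 + (α + α) by ring, Real.rpow_add (by norm_num), Real.rpow_add (by norm_num)]
      norm_num
      nlinarith
    gcongr
  set H : ℝ := 8 * S / P with hHdef
  have hH0' : 0 ≤ H := by positivity
  -- Hölder on half ball
  have hin : ∀ z ∈ Metric.closedBall x₀ (ρ/2), ‖z‖ ≤ ‖c‖ + 3 / 2 * ρ := by
    intro z hz
    rw [mem_closedBall_iff_norm] at hz
    have := norm_le_norm_add_norm_sub' z x₀
    linarith
  have hin1 : ∀ z ∈ Metric.closedBall x₀ (ρ/2), ‖z‖ ≤ 1 := fun z hz => by linarith [hin z hz]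
  have hHol : ∀ t ∈ Set.Icc 0 T, ∀ z ∈ Metric.closedBall x₀ (ρ/2), ∀ w ∈ Metric.closedBall x₀ (ρ/2),
      ‖D2 t z - D2 t w‖ ≤ H * ‖z - w‖ ^ α := by
    intro t ht z hz w hw
    have := hP t ht x₀ (ρ/2) (by positivity) (by linarith) z hz w hw
    have h3 : ‖D2 t z - D2 t w‖ * (P / 8) ≤ S * ‖z - w‖ ^ α := le_trans (by gcongr) this
    rw [hHdef, div_mul_eq_mul_div, le_div_iff₀ hPp]
    linarith
  set M : ℝ := 64 * (U + S) / ρ ^ 2 with hM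
  have hM0 : 0 ≤ M := by positivity
  have hbd : ∀ t ∈ Set.Icc 0 T, ∀ z ∈ Metric.closedBall x₀ (ρ/2), ‖D2 t z‖ ≤ M ∧ ‖D1 t z‖ ≤ M := by
    intro t ht z hz
    have hz1 := hin z hz
    have ip := lb_interp (hs.h1 t ht) (hs.h2 t ht) (x := z) (τ := ρ/4) (U := U) (H := 64 * S / P) (α := α)
      (by positivity) hα hU0 (by positivity)
      (fun w hw => hs.hU t ht w (by
        rw [mem_closedBall_iff_norm] at hw
        have := norm_le_norm_add_norm_sub' w z
        linarith))
      (fun w hw => by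
        have := hP t ht z (ρ/4) (by positivity) (by linarith) w hw z (by simp; positivity)
        have h3 : ‖D2 t w - D2 t z‖ * (P / 64) ≤ S * ‖w - z‖ ^ α := le_trans (by gcongr) this
        rw [div_mul_eq_mul_div, le_div_iff₀ hPp]
        linarith)
    have hq : (ρ / 4) ^ α ≤ ρ ^ α := by gcongr; linarith
    have hSP : 64 * S / P * (ρ / 4) ^ α ≤ 64 * S / ρ ^ 2 := by
      calc 64 * S / P * (ρ / 4) ^ α ≤ 64 * S / P * ρ ^ α := by gcongr
        _ = _ := by rw [hP2]; field_simp
    have e1 : 4 * U / (ρ / 4) ^ 2 = 64 * U / ρ ^ 2 := by field_simp; ring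
    have e2 : M = 64 * U / ρ ^ 2 + 64 * S / ρ ^ 2 := by rw [hM]; ring
    refine ⟨by rw [e2, ← e1]; linarith [ip.1], ?_⟩
    have e3 : 5 * U / (ρ / 4) ≤ 64 * U / ρ ^ 2 := by
      rw [div_le_div_iff₀ (by positivity) (by positivity)]
      have : 0 ≤ U * ρ := by positivity
      nlinarith
    have hS3 : 0 ≤ 64 * S / ρ ^ 2 := by positivity
    have e4 : 2 * (64 * S / P) * (ρ / 4) ^ α * (ρ / 4) ≤ 64 * S / ρ ^ 2 := by
      calc 2 * (64 * S / P) * (ρ / 4) ^ α * (ρ / 4) = (64 * S / P * (ρ / 4) ^ α) * (ρ / 2) := by ring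
        _ ≤ 64 * S / ρ ^ 2 * 1 := by gcongr; linarith
        _ = _ := mul_one _
    rw [e2]; linarith [ip.2]
  set F : ℝ → E → ℝ := fun t z => (A t z (D2 t z) - A t x₀ (D2 t z)) + f t z with hF
  set Fα : ℝ := 1 + ε * (2 * M + H) with hFα
  have hx₀m : x₀ ∈ Metric.closedBall x₀ (ρ/2) := by simp; positivity
  have hFest : ∀ t ∈ Set.Icc 0 T, ∀ z ∈ Metric.closedBall x₀ (ρ/2), ∀ w ∈ Metric.closedBall x₀ (ρ/2),
      |F t z - F t w| ≤ Fα * ‖z - w‖ ^ α := by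
    intro t ht z hz w hw
    have hzw : ‖z - w‖ ≤ 1 := by
      rw [mem_closedBall_iff_norm] at hz hw
      have : z - w = (z - x₀) - (w - x₀) := by abel
      rw [this]; linarith [norm_sub_le (z - x₀) (w - x₀)]
    have hzw' : ‖z - w‖ ≤ ‖z - w‖ ^ α := by
      rcases (norm_nonneg (z - w)).eq_or_lt with h | h
      · rw [← h, Real.zero_rpow hα.ne']
      · calc ‖z - w‖ = ‖z - w‖ ^ (1:ℝ) := (Real.rpow_one _).symm
          _ ≤ _ := Real.rpow_le_rpow_of_exponent_ge h hzw hα1.le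
    have a1 : |A t z (D2 t z) - A t w (D2 t z)| ≤ ε * ‖z - w‖ ^ α * M := by
      refine (hs.hA t ht z w (hin1 z hz) (hin1 w hw) _).trans ?_
      have := (hbd t ht z hz).1
      gcongr
    have a2 : |A t w (D2 t z - D2 t w) - A t x₀ (D2 t z - D2 t w)| ≤ ε * 1 * (H * ‖z - w‖ ^ α) := by
      refine (hs.hA t ht w x₀ (hin1 w hw) (hin1 x₀ hx₀m) _).trans ?_
      have b2 := hHol t ht z hz w hw
      have b3 : ‖w - x₀‖ ^ α ≤ 1 := Real.rpow_le_one (norm_nonneg _) (by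
        rw [mem_closedBall_iff_norm] at hw; linarith) hα.le
      gcongr
    have a3 := hs.hf t ht z w (hin1 z hz) (hin1 w hw)
    have a4 : |u t z - u t w| ≤ M * ‖z - w‖ ^ α := by
      have := (convex_closedBall x₀ (ρ/2)).norm_image_sub_le_of_norm_hasFDerivWithin_le
        (fun p _ => (hs.h1 t ht p).hasFDerivWithinAt) (fun p hp => (hbd t ht p hp).2) hw hz
      exact this.trans (by gcongr)
    have a5 : ε * |u t z - u t w| ≤ ε * (M * ‖z - w‖ ^ α) := by gcongr
    have e1 : F t z - F t w = (A t z (D2 t z) - A t w (D2 t z))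
        + (A t w (D2 t z - D2 t w) - A t x₀ (D2 t z - D2 t w)) + (f t z - f t w) := by
      have q : ∀ B : (E →L[ℝ] E →L[ℝ] ℝ) →L[ℝ] ℝ, B (D2 t z - D2 t w) = B (D2 t z) - B (D2 t w) :=
        fun B => map_sub B _ _
      rw [q, q]
      simp only [hF]; ring
    rw [e1, hFα]
    refine (abs_add_le _ _).trans ((add_le_add_left (abs_add_le _ _) _).trans ?_)
    linarith
  have hsr : s ≤ N * η * s := by nlinarith
  have h3r : 3 * (N * (η * s)) ≤ ρ / 2 := by
    rw [hsdef]; linarith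
  have hNs : N * (η * s) = N * η * s := by ring
  have hcont : ContinuousOn (fun p : ℝ × E => u p.1 p.2) (Set.Icc 0 T ×ˢ Metric.closedBall x₀ (ρ/2)) :=
    (hs.cont hα hU0).mono (Set.prod_mono_right (fun z hz => by simpa using hin1 z hz))
  have hFα0 : 0 < Fα := by positivity
  have key : ∀ e'' : E, ‖e''‖ = 1 → ∀ ee : E, ‖ee‖ = 1 →
      (D2 t (x₀ + s • ee) e'' e'' - D2 t (x₀ - s • ee) e'' e'') ≤
      (2 * H * η ^ α + 12 * H * (1 + Lam / lam) * (N * η) ^ (α - 1) + 8 * Fα * N * η ^ (α - 1) / lam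
        + 4 * H0 * η ^ (α - 1)) * s ^ α := by
    intro e'' he'' ee hee
    have := lb_near (h := η * s) (r := N * (η * s)) (s := s) (τ := ρ/2) hs.θpos hlam hLam hα hα1 hH0' hH0 hFα0
      (by positivity) (by have : 0 < η * s := by positivity
                          nlinarith) h3r hs0.le (by rw [hNs]; exact hsr) x₀ u D1 D2
      (fun t => A t x₀) F hs.h1 hs.h2
      (fun t ht z hz => by
        refine (hs.ht t ht z (hin1 z hz)).congr_deriv ?_
        simp only [hF]; ring)
      hcont hFest hHol (fun z hz w hw => hs.hinit z w (hin1 z hz) (hin1 w hw))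
      (fun t ht => hs.hell t ht x₀ (hin1 x₀ hx₀m)) ht hee he''
    have hpos : 0 < (η * s) ^ 2 := by positivity
    rw [← mul_le_mul_iff_right₀ hpos]
    refine this.trans (le_of_eq ?_)
    have z1 : (η * s) ^ α = η ^ α * s ^ α := Real.mul_rpow hη.le hs0.le
    have z2 : (N * (η * s)) ^ α = (N * η) ^ α * s ^ α := by
      rw [← Real.mul_rpow (by positivity) hs0.le]; ring_nf
    have z3 : (N * η) ^ (α - 1) = (N * η) ^ α / (N * η) := by
      rw [Real.rpow_sub (by positivity), Real.rpow_one]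
    have z4 : η ^ (α - 1) = η ^ α / η := by rw [Real.rpow_sub hη, Real.rpow_one]
    rw [z1, z2, z3, z4]
    have hN0 : N ≠ 0 := by positivity
    field_simp
    ring
  set Kc : ℝ := (2 * H * η ^ α + 12 * H * (1 + Lam / lam) * (N * η) ^ (α - 1) + 8 * Fα * N * η ^ (α - 1) / lam
        + 4 * H0 * η ^ (α - 1)) * s ^ α with hKc
  have hKc0 : 0 ≤ Kc := by positivity
  have hfin : ‖D2 t x - D2 t y‖ ≤ Kc := by
    refine lb_polar _ ?_ hKc0 ?_
    · intro a b
      have q1 := second_derivative_symmetric (hs.h1 t ht) (hs.h2 t ht x) a b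
      have q2 := second_derivative_symmetric (hs.h1 t ht) (hs.h2 t ht y) a b
      simp only [ContinuousLinearMap.sub_apply]; rw [q1, q2]
    · intro e'' he''
      have k1 := key e'' he'' e he
      have k2 := key e'' he'' (-e) (by rw [norm_neg, he])
      simp only [smul_neg, sub_neg_eq_add, ← sub_eq_add_neg] at k2
      rw [hxp, hxm] at k1 k2
      simp only [ContinuousLinearMap.sub_apply]
      rw [abs_le]; constructor <;> linarith
  have hsα : s ^ α ≤ ‖x - y‖ ^ α := by
    have : s ≤ ‖x - y‖ := by rw [hsdef]; linarith
    gcongr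
  have hHP : H * P = 8 * S := by rw [hHdef]; field_simp
  have hMP : M * P ≤ 64 * (U + S) := by
    rw [hM, hP2]
    have : 64 * (U + S) / ρ ^ 2 * (ρ ^ 2 * ρ ^ α) = 64 * (U + S) * ρ ^ α := by field_simp
    rw [this]
    have : 0 ≤ 64 * (U + S) := by positivity
    nlinarith
  have hFP : Fα * P ≤ 1 + 136 * ε * (U + S) := by
    have e1 : Fα * P = P + ε * (2 * (M * P) + H * P) := by rw [hFα]; ring
    rw [e1, hHP]
    have : ε * (2 * (M * P) + 8 * S) ≤ ε * (136 * (U + S)) := by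
      gcongr; linarith
    linarith
  have hH0P : H0 * P ≤ H0 * 1 := by gcongr
  calc ‖D2 t x - D2 t y‖ * P ≤ Kc * P := by gcongr
    _ = (2 * (H * P) * η ^ α + 12 * (H * P) * (1 + Lam / lam) * (N * η) ^ (α - 1)
        + 8 * N * η ^ (α - 1) / lam * (Fα * P) + 4 * (H0 * P) * η ^ (α - 1)) * s ^ α := by rw [hKc]; ring
    _ ≤ (2 * (8 * S) * η ^ α + 12 * (8 * S) * (1 + Lam / lam) * (N * η) ^ (α - 1)
        + 8 * N * η ^ (α - 1) / lam * (1 + 136 * ε * (U + S)) + 4 * (H0 * 1) * η ^ (α - 1)) * ‖x - y‖ ^ α := by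
      rw [hHP]; gcongr
    _ = _ := by ring

theorem LBSol.far (hs : LBSol α lam Lam ε U H0 T θ u D1 D2 A f) (hα : 0 < α) (hα1 : α < 1)
    (hU0 : 0 ≤ U) {σ σ₁ : ℝ} (hσ : 0 < σ) (hσ2 : σ ≤ 1 / 2) (hσ₁ : 0 < σ₁)
    {S : ℝ} (hS : 0 ≤ S) (hP : LBP α T S D2)
    {t : ℝ} (ht : t ∈ Set.Icc 0 T) {c : E} {ρ : ℝ} (hρ : 0 < ρ) (hcρ : ‖c‖ + 2 * ρ ≤ 1) {x y : E}
    (hx : x ∈ Metric.closedBall c ρ) (hy : y ∈ Metric.closedBall c ρ) (hxy : σ₁ * ρ ≤ ‖x - y‖) :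
    ‖D2 t x - D2 t y‖ * ρ ^ (2 + α) ≤ ((8 * U / σ ^ 2 + 16 * σ ^ α * S) / σ₁ ^ α) * ‖x - y‖ ^ α := by
  set P : ℝ := ρ ^ (2 + α) with hPdef
  have hPp : 0 < P := by positivity
  have hP2 : P = ρ ^ 2 * ρ ^ α := by rw [hPdef, Real.rpow_add hρ]; norm_num
  have h2α : (2:ℝ) ^ α ≤ 2 := by
    calc (2:ℝ) ^ α ≤ 2 ^ (1:ℝ) := Real.rpow_le_rpow_of_exponent_le (by norm_num) hα1.le
      _ = 2 := Real.rpow_one _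
  have hhalf : (ρ / 2) ^ (2 + α) ≥ P / 8 := by
    rw [Real.div_rpow hρ.le (by norm_num)]
    have : (2:ℝ) ^ (2 + α) ≤ 8 := by
      rw [Real.rpow_add (by norm_num)]; norm_num; linarith
    gcongr
  have hb : ∀ z ∈ Metric.closedBall c ρ, ‖D2 t z‖ * P ≤ (4 * U / σ ^ 2 + 8 * σ ^ α * S) * ρ ^ α := by
    intro z hz
    have hzn : ‖z‖ ≤ ‖c‖ + ρ := by
      rw [mem_closedBall_iff_norm] at hz
      have := norm_le_norm_add_norm_sub' z c
      linarith
    have hσρ : σ * ρ ≤ ρ / 2 := by nlinarith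
    have ip := (lb_interp (hs.h1 t ht) (hs.h2 t ht) (x := z) (τ := σ * ρ) (U := U) (H := 8 * S / P) (α := α)
      (by positivity) hα hU0 (by positivity)
      (fun w hw => hs.hU t ht w (by
        rw [mem_closedBall_iff_norm] at hw
        have := norm_le_norm_add_norm_sub' w z
        linarith))
      (fun w hw => by
        have := hP t ht z (ρ/2) (by positivity) (by linarith) w (Metric.closedBall_subset_closedBall hσρ hw) z
          (by simp; positivity)
        have h3 : ‖D2 t w - D2 t z‖ * (P / 8) ≤ S * ‖w - z‖ ^ α := le_trans (by gcongr) this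
        rw [div_mul_eq_mul_div, le_div_iff₀ hPp]
        linarith)).1
    calc ‖D2 t z‖ * P ≤ (4 * U / (σ * ρ) ^ 2 + 8 * S / P * (σ * ρ) ^ α) * P := by gcongr
      _ = _ := by
        rw [Real.mul_rpow hσ.le hρ.le, hP2]; field_simp
  have hρα : ρ ^ α ≤ ‖x - y‖ ^ α / σ₁ ^ α := by
    rw [le_div_iff₀ (by positivity), mul_comm, ← Real.mul_rpow hσ₁.le hρ.le]
    gcongr
  calc ‖D2 t x - D2 t y‖ * P ≤ (‖D2 t x‖ + ‖D2 t y‖) * P := by gcongr; exact norm_sub_le (D2 t x) (D2 t y)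
    _ ≤ (8 * U / σ ^ 2 + 16 * σ ^ α * S) * ρ ^ α := by
      have := hb x hx
      have := hb y hy
      have e : (8 * U / σ ^ 2 + 16 * σ ^ α * S) * ρ ^ α = 2 * ((4 * U / σ ^ 2 + 8 * σ ^ α * S) * ρ ^ α) := by ring
      rw [e]; linarith
    _ ≤ (8 * U / σ ^ 2 + 16 * σ ^ α * S) * (‖x - y‖ ^ α / σ₁ ^ α) := by gcongr
    _ = _ := by ring

theorem lb_exists_small {p C : ℝ} (hp : 0 < p) (hC : 0 < C) {b : ℝ} (hb : 0 < b) :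
    ∃ η : ℝ, 0 < η ∧ η ≤ b ∧ C * η ^ p ≤ 1 / 4 := by
  refine ⟨min b ((1 / (4 * C)) ^ (1 / p)), by positivity, min_le_left _ _, ?_⟩
  have : (min b ((1 / (4 * C)) ^ (1 / p))) ^ p ≤ ((1 / (4 * C)) ^ (1 / p)) ^ p := by
    gcongr; exact min_le_right _ _
  rw [← Real.rpow_mul (by positivity), one_div_mul_cancel hp.ne', Real.rpow_one] at this
  calc _ ≤ C * (1 / (4 * C)) := by gcongr
    _ = 1 / 4 := by field_simp

theorem lb_schauder {α lam Lam : ℝ} (hα : 0 < α) (hα1 : α < 1) (hlam : 0 < lam) (hLam : 0 ≤ Lam) :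
    ∃ ε : ℝ, 0 < ε ∧ ∀ U H0 : ℝ, 0 ≤ U → 0 ≤ H0 → ∃ C : ℝ, 0 ≤ C ∧
      ∀ (T θ : ℝ) (u : ℝ → E → ℝ) (D1 : ℝ → E → E →L[ℝ] ℝ)
        (D2 : ℝ → E → E →L[ℝ] E →L[ℝ] ℝ) (A : ℝ → E → (E →L[ℝ] E →L[ℝ] ℝ) →L[ℝ] ℝ)
        (f : ℝ → E → ℝ), LBSol α lam Lam ε U H0 T θ u D1 D2 A f →
        ∀ t ∈ Set.Icc 0 T, ‖D1 t 0‖ ≤ C ∧ ‖D2 t 0‖ ≤ C := by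
  obtain ⟨η, hη, hη1, hηα⟩ := lb_exists_small (C := 16) hα (by norm_num) one_pos
  have hC1 : 0 < 96 * (1 + Lam / lam) := by positivity
  obtain ⟨ζ, hζ, hζ1, hζα⟩ := lb_exists_small (p := 1 - α) (by linarith) hC1 one_pos
  -- N η = 1/ζ
  set N : ℝ := 1 / (ζ * η) with hN
  have hNη : N * η = ζ⁻¹ := by rw [hN]; field_simp
  have hN1 : 1 ≤ N := by
    rw [hN, le_div_iff₀ (by positivity)]; nlinarith
  have hNη1 : 1 ≤ N * η := by rw [hNη]; exact (one_le_inv₀ hζ).2 hζ1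
  have hNηα : 96 * (1 + Lam / lam) * (N * η) ^ (α - 1) ≤ 1 / 4 := by
    rw [hNη, Real.inv_rpow hζ.le, ← Real.rpow_neg hζ.le, neg_sub]; exact hζα
  have hNη0 : 0 < N * η := by linarith
  set σ₁ : ℝ := 1 / (3 * (N * η)) with hσ₁
  have hσ₁0 : 0 < σ₁ := by positivity
  obtain ⟨σ, hσ, hσ2, hσα⟩ := lb_exists_small (C := 16 / σ₁ ^ α) hα (by positivity) (b := 1/2) (by norm_num)
  set L : ℝ := 8 * N * η ^ (α - 1) / lam with hL
  have hL0 : 0 < L := by positivity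
  set ε : ℝ := 1 / (4 * 136 * L) with hε
  have hε0 : 0 < ε := by positivity
  have hLε : L * (136 * ε) = 1 / 4 := by rw [hε]; field_simp
  refine ⟨ε, hε0, ?_⟩
  intro U H0 hU hH0
  set K : ℝ := max (L * (1 + 136 * ε * U) + 4 * H0 * η ^ (α - 1)) (8 * U / σ ^ 2 / σ₁ ^ α) with hK
  have hK0 : 0 ≤ K := le_max_of_le_right (by positivity)
  refine ⟨16 * U + 64 * K, by positivity, ?_⟩
  intro T θ u D1 D2 A f hs t ht
  have step : ∀ S, 0 ≤ S → LBP α T S D2 → LBP α T (3 / 4 * S + K) D2 := by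
    intro S hS hP t ht c ρ hρ hcρ x hx y hy
    by_cases hcase : σ₁ * ρ ≤ ‖x - y‖
    · refine (hs.far hα hα1 hU hσ hσ2 hσ₁0 hS hP ht hρ hcρ hx hy hcase).trans ?_
      refine mul_le_mul_of_nonneg_right ?_ (by positivity)
      have e1 : (8 * U / σ ^ 2 + 16 * σ ^ α * S) / σ₁ ^ α = 8 * U / σ ^ 2 / σ₁ ^ α + 16 / σ₁ ^ α * σ ^ α * S := by ring
      rw [e1]
      have := le_max_right (L * (1 + 136 * ε * U) + 4 * H0 * η ^ (α - 1)) (8 * U / σ ^ 2 / σ₁ ^ α)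
      nlinarith
    · push Not at hcase
      have hle : 3 * (N * η) * ‖x - y‖ ≤ ρ := by
        rw [hσ₁, div_mul_eq_mul_div, one_mul, lt_div_iff₀ (by positivity)] at hcase
        linarith
      refine (hs.near hα hα1 hlam hLam hε0.le hU hH0 hη hN1 hNη1 hS hP ht hρ hcρ hx hy hle).trans ?_
      refine mul_le_mul_of_nonneg_right ?_ (by positivity)
      rw [← hL]
      have := le_max_left (L * (1 + 136 * ε * U) + 4 * H0 * η ^ (α - 1)) (8 * U / σ ^ 2 / σ₁ ^ α)
      have e1 : L * (1 + 136 * ε * (U + S)) = L * (1 + 136 * ε * U) + L * (136 * ε) * S := by ring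
      rw [e1, hLε]
      nlinarith
  obtain ⟨H', hH'⟩ := hs.hH
  set S0 : ℝ := max H' 0 with hS0
  have hS00 : 0 ≤ S0 := le_max_right _ _
  have hP0 : ∀ n : ℕ, LBP α T ((3/4) ^ n * S0 + 4 * K) D2 := by
    intro n
    induction n with
    | zero =>
      intro t ht c ρ hρ hcρ x hx y hy
      have hn : ∀ z ∈ Metric.closedBall c ρ, ‖z‖ ≤ 1 := by
        intro z hz
        rw [mem_closedBall_iff_norm] at hz
        have := norm_le_norm_add_norm_sub' z c
        linarith
      have a := hH' t ht x y (hn x hx) (hn y hy)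
      have b : ρ ^ (2 + α) ≤ 1 := Real.rpow_le_one hρ.le (by linarith [norm_nonneg c]) (by linarith)
      calc ‖D2 t x - D2 t y‖ * ρ ^ (2 + α) ≤ ‖D2 t x - D2 t y‖ * 1 := by gcongr
        _ ≤ H' * ‖x - y‖ ^ α := by linarith
        _ ≤ _ := by
          gcongr
          have := le_max_left H' 0
          simp only [pow_zero]; linarith
    | succ n ih =>
      have := step _ (by positivity) ih
      have e : (3/4:ℝ) ^ (n+1) * S0 + 4 * K = 3 / 4 * ((3/4) ^ n * S0 + 4 * K) + K := by ring
      rw [e]; exact this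
  have hPlim : LBP α T (4 * K) D2 := by
    intro t ht c ρ hρ hcρ x hx y hy
    have hlim : Filter.Tendsto (fun n : ℕ => ((3/4:ℝ) ^ n * S0 + 4 * K) * ‖x - y‖ ^ α) Filter.atTop
        (nhds ((0 * S0 + 4 * K) * ‖x - y‖ ^ α)) := by
      have := tendsto_pow_atTop_nhds_zero_of_lt_one (r := (3/4:ℝ)) (by norm_num) (by norm_num)
      exact ((this.mul_const S0).add_const _).mul_const _
    rw [zero_mul, zero_add] at hlim
    exact ge_of_tendsto' hlim (fun n => hP0 n t ht c ρ hρ hcρ x hx y hy)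
  have ip := lb_interp (hs.h1 t ht) (hs.h2 t ht) (x := 0) (τ := 1/2) (U := U) (H := 32 * K) (α := α)
      (by norm_num) hα hU (by positivity)
      (fun y hy => hs.hU t ht y (by have : ‖y‖ ≤ 1/2 := by simpa using hy
                                    linarith))
      (fun y hy => by
        have h1 := hPlim t ht 0 (1/2) (by norm_num) (by simp) y hy 0 (by simp)
        have h2 : (1/2:ℝ) ^ (2 + α) ≥ 1 / 8 := by
          calc (1/2:ℝ) ^ (2 + α) ≥ (1/2:ℝ) ^ (3:ℝ) := 
                Real.rpow_le_rpow_of_exponent_ge (by norm_num) (by norm_num) (by linarith)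
            _ = 1 / 8 := by norm_num
        have h3 : ‖D2 t y - D2 t 0‖ * (1/8) ≤ 4 * K * ‖y - 0‖ ^ α := le_trans (by gcongr) h1
        linarith)
  have h5 : (1/2:ℝ) ^ α ≤ 1 := Real.rpow_le_one (by norm_num) (by norm_num) hα.le
  have h6 : 32 * K * (1/2:ℝ) ^ α ≤ 32 * K * 1 := by gcongr
  constructor
  · refine ip.2.trans ?_
    have : 5 * U / (1/2) = 10 * U := by ring
    rw [this]; linarith
  · refine ip.1.trans ?_
    have : 4 * U / (1/2) ^ 2 = 16 * U := by ring
    rw [this]; linarith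
end Generic3

open MeasureTheory Real
open scoped ENNReal RealInnerProductSpace
set_option linter.unusedSectionVars false

open scoped MatrixOrder in
lemma lb_factor (M : Mat3) (hs : ∀ i j, M i j = M j i) (hM : ∀ ξ : V3, 0 ≤ quadForm M ξ) :
    ∃ B : Mat3, ∀ i j, M i j = ∑ m, B m i * B m j := by
  have hp : M.PosSemidef := by
    refine Matrix.PosSemidef.of_dotProduct_mulVec_nonneg ?_ ?_
    · ext i j; simp [hs j i]
    · intro x
      have := hM (WithLp.toLp 2 x)
      simp only [quadForm, bilin] at this
      simp only [Matrix.mulVec, dotProduct, Pi.star_apply, star_trivial, Finset.mul_sum]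
      refine this.trans_eq ?_
      refine Finset.sum_congr rfl fun i _ => Finset.sum_congr rfl fun j _ => ?_
      ring
  obtain ⟨B, hB⟩ := CStarAlgebra.nonneg_iff_eq_star_mul_self.mp hp.nonneg
  refine ⟨B, fun i j => ?_⟩
  rw [hB, Matrix.mul_apply]
  simp [Matrix.star_apply]

lemma lb_bil_sum (C : Fin 3 → ℝ) (n : Fin 3 → V3) (Q : V3 →L[ℝ] V3 →L[ℝ] ℝ) :
    Q (∑ k, C k • n k) (∑ l, C l • n l) = ∑ k, ∑ l, C k * C l * Q (n k) (n l) := by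
  rw [map_sum Q, ContinuousLinearMap.sum_apply]
  refine Finset.sum_congr rfl fun k _ => ?_
  rw [map_smul Q, ContinuousLinearMap.smul_apply, map_sum (Q (n k)), smul_eq_mul, Finset.mul_sum]
  refine Finset.sum_congr rfl fun l _ => ?_
  rw [map_smul, smul_eq_mul]; ring

lemma lb_psd_trace (M : Mat3) (hs : ∀ i j, M i j = M j i) (hM : ∀ ξ : V3, 0 ≤ quadForm M ξ)
    (n : Fin 3 → V3) (Q : V3 →L[ℝ] V3 →L[ℝ] ℝ) (hQ : ∀ l, Q l l ≤ 0) :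
    ∑ k, ∑ l, M k l * Q (n k) (n l) ≤ 0 := by
  obtain ⟨B, hB⟩ := lb_factor M hs hM
  have : ∑ k, ∑ l, M k l * Q (n k) (n l) =
      ∑ m, Q (∑ k, B m k • n k) (∑ l, B m l • n l) := by
    simp_rw [lb_bil_sum, hB, Finset.sum_mul]
    rw [Finset.sum_comm' (t' := Finset.univ) (s' := fun _ => Finset.univ) (by simp)]
    rw [Finset.sum_comm]
    simp only [Fin.sum_univ_three]
    ring
  rw [this]
  exact Finset.sum_nonpos fun m _ => hQ _

noncomputable def lbI : V3 →L[ℝ] V3 →L[ℝ] ℝ := innerSL ℝ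

lemma lbI_apply (a b : V3) : lbI a b = ⟪a, b⟫ := rfl

lemma lb_inner_sum (C : Fin 3 → ℝ) (n : Fin 3 → V3) :
    ‖∑ k, C k • n k‖ ^ 2 = ∑ k, ∑ l, C k * C l * ⟪n k, n l⟫ := by
  have := lb_bil_sum C n lbI
  simp only [lbI_apply] at this
  rw [← this, real_inner_self_eq_norm_sq]

lemma lb_v3_norm_sq (x : V3) : ‖x‖ ^ 2 = x 0 ^ 2 + x 1 ^ 2 + x 2 ^ 2 := by
  rw [EuclideanSpace.norm_sq_eq]; simp [Fin.sum_univ_three]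

lemma lb_v3_inner (x y : V3) : ⟪x, y⟫ = x 0 * y 0 + x 1 * y 1 + x 2 * y 2 := by
  rw [PiLp.inner_apply]; simp [Fin.sum_univ_three]; ring

/-- linear change of variables -/
lemma lb_cov (M : Mat3) (hs : ∀ i j, M i j = M j i) (c b : ℝ) (hc : 0 < c)
    (hM : ∀ ξ : V3, c * ‖ξ‖ ^ 2 ≤ quadForm M ξ) (hb : ∀ i j, |M i j| ≤ b) :
    ∃ (L : V3 →L[ℝ] V3) (n : Fin 3 → V3), (∀ i, L (n i) = esingle i) ∧
      (∀ x, ‖L x‖ ^ 2 ≤ 3 * b * ‖x‖ ^ 2) ∧ (∀ i, ‖n i‖ ^ 2 ≤ 1 / c) ∧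
      (∀ (lam Lam : ℝ) (M' : Mat3), 0 ≤ lam → (∀ i j, M' i j = M' j i) →
        (∀ ξ, lam * quadForm M ξ ≤ quadForm M' ξ) →
        (∀ ξ, quadForm M' ξ ≤ Lam * quadForm M ξ) →
        ∀ e : V3, ‖e‖ = 1 → ∀ (Q : V3 →L[ℝ] V3 →L[ℝ] ℝ) (c : ℝ), 0 ≤ c →
        (∀ l, Q l l ≤ c * ‖l‖ ^ 2) →
        ∑ k, ∑ l, M' k l * Q (n k) (n l) ≤ lam * Q e e + c * (3 * Lam)) := by
  obtain ⟨B, hB⟩ := lb_factor M hs fun ξ => le_trans (by positivity) (hM ξ)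
  have hBt : M = B.transpose * B := by
    ext i j; rw [hB, Matrix.mul_apply]; simp [Matrix.transpose_apply]
  have hqB : ∀ ξ : V3, quadForm M ξ = ∑ m, (∑ k, B m k * ξ k) ^ 2 := by
    intro ξ
    simp only [quadForm, bilin, hB, Fin.sum_univ_three]; ring
  have hdet : IsUnit B.det := by
    rw [isUnit_iff_ne_zero]
    intro h0
    obtain ⟨v, hv, hv0⟩ := Matrix.exists_mulVec_eq_zero_iff.mpr h0
    have h1 := hM (WithLp.toLp 2 v)
    have h2 : quadForm M (WithLp.toLp 2 v) = 0 := by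
      rw [hqB]
      refine Finset.sum_eq_zero fun m _ => ?_
      have := congrFun hv0 m
      simp only [Matrix.mulVec, dotProduct] at this
      simp [this]
    rw [h2] at h1
    have h3 : ‖(WithLp.toLp 2 v : V3)‖ ^ 2 ≤ 0 := by
      by_contra hh; push Not at hh; nlinarith [mul_pos hc hh]
    have h4 : (WithLp.toLp 2 v : V3) = 0 := by
      rw [← norm_eq_zero]; nlinarith [norm_nonneg (WithLp.toLp 2 v : V3)]
    apply hv
    funext i
    exact congrArg (fun z : V3 => z i) h4
  set Ci : Mat3 := B⁻¹ with hCi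
  have hinv1 : B * Ci = 1 := Matrix.mul_nonsing_inv B hdet
  have hinv2 : Ci * B = 1 := Matrix.nonsing_inv_mul B hdet
  have e1 : ∀ i j, ∑ m, B i m * Ci m j = if i = j then 1 else 0 := by
    intro i j; rw [← Matrix.mul_apply, hinv1, Matrix.one_apply]
  have e2 : ∀ i j, ∑ m, Ci i m * B m j = if i = j then 1 else 0 := by
    intro i j; rw [← Matrix.mul_apply, hinv2, Matrix.one_apply]
  let L0 : V3 →ₗ[ℝ] V3 :=
    { toFun := fun x => WithLp.toLp 2 (fun i => ∑ k, B k i * x k)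
      map_add' := by
        intro x y; ext i; simp [mul_add, Finset.sum_add_distrib]
      map_smul' := by
        intro a x; ext i; simp only [PiLp.smul_apply, smul_eq_mul, RingHom.id_apply, Finset.mul_sum]
        exact Finset.sum_congr rfl fun k _ => by ring }
  let n : Fin 3 → V3 := fun i => WithLp.toLp 2 (fun k => Ci i k)
  have hLi : ∀ x i, (LinearMap.toContinuousLinearMap L0 x) i = ∑ k, B k i * x k := fun x i => rfl
  have hni : ∀ i k, n i k = Ci i k := fun i k => rfl
  have hLn : ∀ y : V3, ∑ k, (LinearMap.toContinuousLinearMap L0 y) k • n k = y := by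
    intro y; ext i
    have h0 := e1 0 i
    have h1 := e1 1 i
    have h2 := e1 2 i
    simp only [Fin.sum_univ_three] at h0 h1 h2
    simp only [Fin.sum_univ_three, PiLp.add_apply, PiLp.smul_apply, smul_eq_mul, hLi, hni]
    have : (B 0 0 * y 0 + B 1 0 * y 1 + B 2 0 * y 2) * Ci 0 i + (B 0 1 * y 0 + B 1 1 * y 1 + B 2 1 * y 2) * Ci 1 i +
      (B 0 2 * y 0 + B 1 2 * y 1 + B 2 2 * y 2) * Ci 2 i =
      y 0 * (if (0 : Fin 3) = i then 1 else 0) + y 1 * (if (1 : Fin 3) = i then 1 else 0)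
        + y 2 * (if (2 : Fin 3) = i then 1 else 0) := by
      rw [← h0, ← h1, ← h2]; ring
    rw [this]
    fin_cases i <;> simp
  have hinnL : ∀ x ξ : V3, ⟪LinearMap.toContinuousLinearMap L0 x, ξ⟫ = ∑ m, x m * ∑ k, B m k * ξ k := by
    intro x ξ
    rw [lb_v3_inner]; simp only [hLi, Fin.sum_univ_three]; ring
  have hcs : ∀ x ξ : V3, ⟪LinearMap.toContinuousLinearMap L0 x, ξ⟫ ^ 2 ≤ ‖x‖ ^ 2 * quadForm M ξ := by
    intro x ξ
    rw [hinnL, hqB, EuclideanSpace.norm_sq_eq]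
    simp only [Real.norm_eq_abs, sq_abs]
    exact Finset.sum_mul_sq_le_sq_mul_sq _ _ _
  refine ⟨LinearMap.toContinuousLinearMap L0, n, ?_, ?_, ?_, ?_⟩
  · intro i; ext j
    rw [hLi]
    have := e2 i j
    simp only [hni, esingle]
    rw [EuclideanSpace.single_apply]
    rw [show (∑ k, B k j * Ci i k) = ∑ k, Ci i k * B k j from Finset.sum_congr rfl fun k _ => mul_comm _ _, this]
    exact if_congr eq_comm rfl rfl
  · intro x
    have hcol : ∀ i, (∑ k, B k i * x k) ^ 2 ≤ b * ‖x‖ ^ 2 := by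
      intro i
      have := Finset.sum_mul_sq_le_sq_mul_sq Finset.univ (fun k => B k i) (fun k => x k)
      have h2 : ∑ k, B k i ^ 2 ≤ b := by
        have h3 := le_trans (le_abs_self _) (hb i i)
        rw [hB] at h3
        refine le_trans (le_of_eq ?_) h3
        exact Finset.sum_congr rfl fun k _ => by ring
      have h4 : ∑ k, x k ^ 2 = ‖x‖ ^ 2 := by rw [EuclideanSpace.norm_sq_eq]; simp
      rw [h4] at this
      exact this.trans (mul_le_mul_of_nonneg_right h2 (by positivity))
    rw [lb_v3_norm_sq (LinearMap.toContinuousLinearMap L0 x), hLi, hLi, hLi]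
    linarith [hcol 0, hcol 1, hcol 2]
  · intro i
    -- ξ with B ξ = n i
    let ξ : V3 := WithLp.toLp 2 (fun k => ∑ m, Ci k m * Ci i m)
    have hξ : ∀ m, ∑ k, B m k * ξ k = n i m := by
      intro m
      have : ∀ k, ξ k = ∑ m, Ci k m * Ci i m := fun k => rfl
      have h0 := e1 m 0
      have h1 := e1 m 1
      have h2 := e1 m 2
      simp only [Fin.sum_univ_three] at h0 h1 h2
      simp only [this, hni, Fin.sum_univ_three]
      have : B m 0 * (Ci 0 0 * Ci i 0 + Ci 0 1 * Ci i 1 + Ci 0 2 * Ci i 2) +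
        B m 1 * (Ci 1 0 * Ci i 0 + Ci 1 1 * Ci i 1 + Ci 1 2 * Ci i 2) +
        B m 2 * (Ci 2 0 * Ci i 0 + Ci 2 1 * Ci i 1 + Ci 2 2 * Ci i 2) =
        Ci i 0 * (if m = 0 then 1 else 0) + Ci i 1 * (if m = 1 then 1 else 0) + Ci i 2 * (if m = 2 then 1 else 0) := by
        rw [← h0, ← h1, ← h2]; ring
      rw [this]
      fin_cases m <;> simp
    have hq : quadForm M ξ = ‖n i‖ ^ 2 := by
      rw [hqB, EuclideanSpace.norm_sq_eq]
      simp only [hξ, Real.norm_eq_abs, sq_abs]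
    have hk := hM ξ
    rw [hq] at hk
    have hi : ⟪LinearMap.toContinuousLinearMap L0 (n i), ξ⟫ = ‖n i‖ ^ 2 := by
      rw [hinnL, EuclideanSpace.norm_sq_eq]
      simp only [hξ, Real.norm_eq_abs, sq_abs]
      exact Finset.sum_congr rfl fun k _ => by ring
    have hLn1 : ‖LinearMap.toContinuousLinearMap L0 (n i)‖ = 1 := by
      have : LinearMap.toContinuousLinearMap L0 (n i) = esingle i := by
        ext j
        rw [hLi]
        have := e2 i j
        simp only [hni, esingle]
        rw [EuclideanSpace.single_apply]
        rw [show (∑ k, B k j * Ci i k) = ∑ k, Ci i k * B k j from Finset.sum_congr rfl fun k _ => mul_comm _ _, this]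
        exact if_congr eq_comm rfl rfl
      rw [this]; simp [esingle]
    have h5 := real_inner_le_norm (LinearMap.toContinuousLinearMap L0 (n i)) ξ
    rw [hi, hLn1, one_mul] at h5
    have h6 : c * ‖ξ‖ ≤ 1 := by
      by_contra hh; push Not at hh
      have : 0 < ‖ξ‖ := by
        by_contra h0
        have : ‖ξ‖ = 0 := le_antisymm (not_lt.mp h0) (norm_nonneg _)
        rw [this] at hh; simp at hh; linarith
      nlinarith
    rw [le_div_iff₀ hc]
    nlinarith
  · intro lam Lam M' hlam hs' h1 h2 e he Q c' hc' hQ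
    set y := LinearMap.toContinuousLinearMap L0 e with hy
    have hyn : ∑ k, y k • n k = e := hLn e
    -- first
    let Q' : V3 →L[ℝ] V3 →L[ℝ] ℝ := Q - c' • lbI
    have hQ' : ∀ a d, Q' a d = Q a d - c' * ⟪a, d⟫ := fun a d => rfl
    have s1 := lb_psd_trace (fun i j => M' i j - lam * (y i * y j))
      (by intro i j; simp only [hs' i j]; ring)
      (by
        intro ξ
        have : quadForm (fun i j => M' i j - lam * (y i * y j)) ξ =
            quadForm M' ξ - lam * ⟪y, ξ⟫ ^ 2 := by
          rw [lb_v3_inner]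
          simp only [quadForm, bilin, Fin.sum_univ_three]; ring
        rw [this]
        have := hcs e ξ
        rw [he] at this
        have := mul_le_mul_of_nonneg_left this hlam
        linarith [h1 ξ]) n Q' (by
        intro l; rw [hQ', real_inner_self_eq_norm_sq]; linarith [hQ l])
    have s2 := lb_psd_trace (fun i j => Lam * M i j - M' i j)
      (by intro i j; simp only [hs' i j, hs i j])
      (by
        intro ξ
        have : quadForm (fun i j => Lam * M i j - M' i j) ξ =
            Lam * quadForm M ξ - quadForm M' ξ := by
          simp only [quadForm, bilin, Fin.sum_univ_three]; ring
        rw [this]; linarith [h2 ξ]) n (-lbI) (by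
        intro l
        have : (-lbI) l l = -⟪l, l⟫ := rfl
        rw [this, real_inner_self_eq_norm_sq]
        nlinarith [norm_nonneg l])
    have hneg : ∀ a d : V3, (-lbI) a d = -⟪a, d⟫ := fun a d => rfl
    have hb1 := lb_bil_sum (fun k => y k) n Q'
    rw [hyn] at hb1
    -- trace identity
    have tr : ∑ k, ∑ l, M k l * ⟪n k, n l⟫ = 3 := by
      have hm : ∀ m : Fin 3, ∑ k, ∑ l, B m k * B m l * ⟪n k, n l⟫ = 1 := by
        intro m
        rw [← lb_inner_sum]
        have h := hLn (esingle m)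
        have h' : ∀ k, (LinearMap.toContinuousLinearMap L0 (esingle m)) k = B m k := by
          intro k; rw [hLi]; simp [esingle]
        simp only [h'] at h
        rw [h]; simp [esingle]
      have : ∑ k, ∑ l, M k l * ⟪n k, n l⟫ = ∑ m, ∑ k, ∑ l, B m k * B m l * ⟪n k, n l⟫ := by
        simp only [hB, Fin.sum_univ_three]; ring
      rw [this]; simp [hm]
    have f1 : ∑ k, ∑ l, (M' k l - lam * (y k * y l)) * Q' (n k) (n l) =
        ∑ k, ∑ l, M' k l * Q (n k) (n l) - c' * ∑ k, ∑ l, M' k l * ⟪n k, n l⟫ - lam * Q' e e := by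
      rw [hb1]
      simp only [hQ', Fin.sum_univ_three]; ring
    have f2 : ∑ k, ∑ l, (Lam * M k l - M' k l) * (-lbI) (n k) (n l) =
        ∑ k, ∑ l, M' k l * ⟪n k, n l⟫ - Lam * 3 := by
      rw [← tr]
      simp only [hneg, Fin.sum_univ_three]; ring
    rw [f1] at s1
    rw [f2] at s2
    have h7 : Q' e e = Q e e - c' := by rw [hQ', real_inner_self_eq_norm_sq, he]; ring
    rw [h7] at s1
    have := mul_le_mul_of_nonneg_left s2 hc'
    nlinarith [mul_nonneg hlam hc']

open MeasureTheory Real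
open scoped ENNReal RealInnerProductSpace
set_option linter.unusedSectionVars false

lemma lb_pow_diff (p α a b : ℝ) (hp : 0 ≤ p) (hp3 : p ≤ 3) (hα : 0 ≤ α) (hα1 : α ≤ 1)
    (ha : 0 < a) (hab : a ≤ b) :
    a ^ (-p) - b ^ (-p) ≤ 3 * a ^ (-(p + α)) * (b - a) ^ α := by
  have hb : 0 < b := ha.trans_le hab
  set x := a / b with hx
  have hx0 : 0 < x := by positivity
  have hx1 : x ≤ 1 := by rw [hx, div_le_one hb]; exact hab
  have h1 : x ^ (3 : ℝ) ≤ x ^ p := Real.rpow_le_rpow_of_exponent_ge hx0 hx1 hp3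
  have h2 : 1 - x ^ (3 : ℝ) ≤ 3 * (1 - x) := by
    rw [show (3 : ℝ) = ((3 : ℕ) : ℝ) by norm_num, Real.rpow_natCast]
    push_cast
    nlinarith [sq_nonneg x, sq_nonneg (1 - x), mul_nonneg hx0.le (sub_nonneg.2 hx1)]
  have h3 : 1 - x ≤ (1 - x) ^ α := by
    rcases eq_or_lt_of_le (sub_nonneg.2 hx1) with h | h
    · rw [← h]; positivity
    · calc 1 - x = (1 - x) ^ (1 : ℝ) := by rw [Real.rpow_one]
        _ ≤ _ := Real.rpow_le_rpow_of_exponent_ge h (by linarith) hα1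
  have h4 : (1 - x) ^ α ≤ ((b - a) / a) ^ α := by
    refine Real.rpow_le_rpow (sub_nonneg.2 hx1) ?_ hα
    rw [hx, one_sub_div hb.ne']
    exact div_le_div_of_nonneg_left (sub_nonneg.2 hab) ha hab
  have h5 : b ^ (-p) = a ^ (-p) * x ^ p := by
    rw [hx, Real.div_rpow ha.le hb.le, Real.rpow_neg ha.le, Real.rpow_neg hb.le]
    have := (Real.rpow_pos_of_pos ha p).ne'
    field_simp
  have h6 : a ^ (-(p + α)) * (b - a) ^ α = a ^ (-p) * ((b - a) / a) ^ α := by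
    rw [Real.div_rpow (sub_nonneg.2 hab) ha.le, show -(p + α) = -p + -α by ring, Real.rpow_add ha,
      Real.rpow_neg ha.le α]
    ring
  rw [h5, mul_assoc, h6]
  have := Real.rpow_nonneg ha.le (-p)
  have h7 : 1 - x ^ p ≤ 3 * ((b - a) / a) ^ α := by linarith
  nlinarith [mul_le_mul_of_nonneg_left h7 this]

lemma lb_pow_diff' (p α : ℝ) (hp : 0 ≤ p) (hp3 : p ≤ 3) (hα : 0 ≤ α) (hα1 : α ≤ 1)
    (z z' : V3) (hz : z ≠ 0) (hz' : z' ≠ 0) :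
    |‖z‖ ^ (-p) - ‖z'‖ ^ (-p)| ≤
      3 * (‖z‖ ^ (-(p + α)) + ‖z'‖ ^ (-(p + α))) * ‖z - z'‖ ^ α := by
  have key : ∀ z z' : V3, z ≠ 0 → z' ≠ 0 → ‖z‖ ≤ ‖z'‖ → |‖z‖ ^ (-p) - ‖z'‖ ^ (-p)| ≤
      3 * (‖z‖ ^ (-(p + α)) + ‖z'‖ ^ (-(p + α))) * ‖z - z'‖ ^ α := by
    intro z z' hz hz' h
    have hz0 := norm_pos_iff.2 hz
    have hz0' := norm_pos_iff.2 hz'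
    have h1 := lb_pow_diff p α _ _ hp hp3 hα hα1 hz0 h
    have h2 : ‖z'‖ ^ (-p) ≤ ‖z‖ ^ (-p) := Real.rpow_le_rpow_of_nonpos hz0 h (by linarith)
    rw [abs_of_nonneg (by linarith)]
    refine h1.trans ?_
    have h3 : (‖z'‖ - ‖z‖) ^ α ≤ ‖z - z'‖ ^ α := by
      refine Real.rpow_le_rpow (by linarith) ?_ hα
      rw [norm_sub_rev]; exact norm_sub_norm_le _ _
    have h4 := Real.rpow_nonneg hz0.le (-(p + α))
    have h5 := Real.rpow_nonneg hz0'.le (-(p + α))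
    refine mul_le_mul (by linarith) h3 (Real.rpow_nonneg (by linarith) _) (by positivity)
  rcases le_total ‖z‖ ‖z'‖ with h | h
  · exact key z z' hz hz' h
  · have := key z' z hz' hz h
    rw [abs_sub_comm, norm_sub_rev, add_comm]; exact this

structure LBDens (K' : ℝ) (f : V3 → ℝ) : Prop where
  nn : ∀ w, 0 ≤ f w
  ub : ∀ w, f w ≤ K'
  int : Integrable f
  mass : ∫ w, f w = 1

lemma lb_K1 (K' q : ℝ) (hq : 0 ≤ q) (hq3 : q < 3) :
    ∃ C, 0 ≤ C ∧ ∀ f, LBDens K' f → ∀ v : V3,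
      Integrable (fun w => ‖v - w‖ ^ (-q) * f w) ∧ ∫ w, ‖v - w‖ ^ (-q) * f w ≤ C := by
  set ψ : V3 → ℝ := (Metric.ball (0 : V3) 1).indicator (fun z => ‖z‖ ^ (-q)) with hψ
  have hψm : Measurable (fun z : V3 => ‖z‖ ^ (-q)) := by fun_prop
  have hfr : Module.finrank ℝ V3 = 3 := by simp
  have hψi : Integrable ψ := by
    rw [hψ, integrable_indicator_iff measurableSet_ball]
    refine integrableOn_ball_of_norm_le_rpow (C := 1) (α := q) (by rw [hfr]; norm_num) (by rw [hfr]; exact_mod_cast hq3) ?_ hψm.aestronglyMeasurable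
    refine Filter.Eventually.of_forall fun x => ?_
    rw [Real.norm_of_nonneg (by positivity), one_mul]
  have hψ0 : ∀ z, 0 ≤ ψ z := fun z => Set.indicator_nonneg (fun _ _ => by positivity) z
  have hle : ∀ z, ‖z‖ ^ (-q) ≤ 1 + ψ z := by
    intro z
    by_cases h : z ∈ Metric.ball (0 : V3) 1
    · rw [hψ, Set.indicator_of_mem h]; linarith
    · have : 1 ≤ ‖z‖ := by simpa using h
      have := Real.rpow_le_one_of_one_le_of_nonpos this (show -q ≤ 0 by linarith)
      linarith [hψ0 z]
  refine ⟨1 + |K'| * ∫ z, ψ z, by have := integral_nonneg (μ := volume) (show 0 ≤ ψ from hψ0); positivity, ?_⟩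
  intro f hf v
  have hdom : Integrable (fun w => f w + |K'| * ψ (v - w)) :=
    hf.int.add ((hψi.comp_sub_left v).const_mul _)
  have hb : ∀ w, ‖v - w‖ ^ (-q) * f w ≤ f w + |K'| * ψ (v - w) := by
    intro w
    have h1 := mul_le_mul_of_nonneg_right (hle (v - w)) (hf.nn w)
    have h2 := mul_le_mul_of_nonneg_right ((hf.ub w).trans (le_abs_self K')) (hψ0 (v - w))
    nlinarith
  have hm : AEStronglyMeasurable (fun w => ‖v - w‖ ^ (-q) * f w) := by
    refine AEStronglyMeasurable.mul ?_ hf.int.aestronglyMeasurable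
    exact (by fun_prop : Measurable (fun w : V3 => ‖v - w‖ ^ (-q))).aestronglyMeasurable
  have hi : Integrable (fun w => ‖v - w‖ ^ (-q) * f w) := by
    refine hdom.mono' hm (Filter.Eventually.of_forall fun w => ?_)
    rw [Real.norm_of_nonneg (mul_nonneg (by positivity) (hf.nn w))]
    exact hb w
  refine ⟨hi, (integral_mono hi hdom hb).trans_eq ?_⟩
  rw [integral_add hf.int ((hψi.comp_sub_left v).const_mul _), hf.mass, integral_const_mul,
    integral_sub_left_eq_self ψ volume v]

lemma lb_ae_ne (v : V3) : ∀ᵐ w : V3, v - w ≠ 0 := by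
  have : ∀ᵐ w : V3, w ∈ ({v} : Set V3)ᶜ := compl_mem_ae_iff.2 (measure_singleton v)
  filter_upwards [this] with w hw h
  exact hw (sub_eq_zero.1 h).symm

lemma lb_int_diff (K' p α : ℝ) (hp : 0 ≤ p) (hα : 0 ≤ α) (hα1 : α ≤ 1) (hpα : p + α < 3) :
    ∃ C, 0 ≤ C ∧ ∀ f, LBDens K' f → ∀ v v' : V3,
      |(∫ w, ‖v - w‖ ^ (-p) * f w) - ∫ w, ‖v' - w‖ ^ (-p) * f w| ≤ C * ‖v - v'‖ ^ α := by
  obtain ⟨C, hC, h⟩ := lb_K1 K' (p + α) (by linarith) hpα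
  obtain ⟨C1, hC1, h1⟩ := lb_K1 K' p hp (by linarith)
  refine ⟨6 * C, by positivity, fun f hf v v' => ?_⟩
  rw [← integral_sub (h1 f hf v).1 (h1 f hf v').1]
  have hd := (((h f hf v).1.add (h f hf v').1)).const_mul (3 * ‖v - v'‖ ^ α)
  have := norm_integral_le_of_norm_le hd (f := fun w => ‖v - w‖ ^ (-p) * f w - ‖v' - w‖ ^ (-p) * f w) (by
    filter_upwards [lb_ae_ne v, lb_ae_ne v'] with w hw hw'
    have h2 := lb_pow_diff' p α hp (by linarith) hα hα1 _ _ hw hw'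
    rw [sub_sub_sub_cancel_right] at h2
    rw [← sub_mul, norm_mul, Real.norm_eq_abs, Real.norm_of_nonneg (hf.nn w)]
    refine (mul_le_mul_of_nonneg_right h2 (hf.nn w)).trans_eq ?_
    simp only [Pi.add_apply]
    ring)
  rw [Real.norm_eq_abs] at this
  refine this.trans ?_
  rw [integral_const_mul]
  have e : ∫ a, ((fun w => ‖v - w‖ ^ (-(p + α)) * f w) + fun w => ‖v' - w‖ ^ (-(p + α)) * f w) a
      = (∫ w, ‖v - w‖ ^ (-(p + α)) * f w) + ∫ w, ‖v' - w‖ ^ (-(p + α)) * f w :=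
    integral_add (h f hf v).1 (h f hf v').1
  rw [e]
  have h3 := (h f hf v).2
  have h4 := (h f hf v').2
  have h5 : 0 ≤ ‖v - v'‖ ^ α := by positivity
  nlinarith

lemma lb_unit_coord (z : V3) (i : Fin 3) : |z i / ‖z‖| ≤ 1 := by
  rw [abs_div, abs_norm]
  exact div_le_one_of_le₀ (by simpa using PiLp.norm_apply_le z i) (norm_nonneg _)

lemma lb_proj_le (z : V3) (i j : Fin 3) : |proj z i j| ≤ 2 := by
  unfold proj
  refine (abs_sub _ _).trans ?_
  have h1 : |if i = j then (1 : ℝ) else 0| ≤ 1 := by split_ifs <;> simp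
  have h2 : |z i / ‖z‖ * (z j / ‖z‖)| ≤ 1 := by
    rw [abs_mul]; exact mul_le_one₀ (lb_unit_coord z i) (abs_nonneg _) (lb_unit_coord z j)
  linarith

lemma lb_unit_diff (z z' : V3) (hz : z ≠ 0) (hz' : z' ≠ 0) (i : Fin 3) :
    |z i / ‖z‖ - z' i / ‖z'‖| ≤ 2 * ‖z - z'‖ / ‖z'‖ := by
  have hz0 := norm_pos_iff.2 hz
  have hz0' := norm_pos_iff.2 hz'
  have e : z i / ‖z‖ - z' i / ‖z'‖ = (z i - z' i) / ‖z'‖ + (z i / ‖z‖) * ((‖z'‖ - ‖z‖) / ‖z'‖) := by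
    field_simp; ring
  rw [e]
  refine (abs_add_le _ _).trans ?_
  rw [abs_mul, abs_div, abs_div (‖z'‖ - ‖z‖), abs_norm]
  have h1 : |z i - z' i| ≤ ‖z - z'‖ := by simpa using PiLp.norm_apply_le (z - z') i
  have h2 : |‖z'‖ - ‖z‖| ≤ ‖z - z'‖ := by rw [norm_sub_rev]; exact abs_norm_sub_norm_le _ _
  have h3 := lb_unit_coord z i
  have h4 : |z i - z' i| / ‖z'‖ ≤ ‖z - z'‖ / ‖z'‖ := by gcongr
  have h5 : |‖z'‖ - ‖z‖| / ‖z'‖ ≤ ‖z - z'‖ / ‖z'‖ := by gcongr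
  have h6 : |z i / ‖z‖| * (|‖z'‖ - ‖z‖| / ‖z'‖) ≤ 1 * (‖z - z'‖ / ‖z'‖) :=
    mul_le_mul h3 h5 (by positivity) (by norm_num)
  rw [mul_div_assoc]; linarith

lemma lb_kernel_diff (γ : ℝ) (hγ : γ ∈ Set.Icc (-3 : ℝ) (-2)) (z z' : V3) (hz : z ≠ 0)
    (hz' : z' ≠ 0) (i j : Fin 3) :
    |landauKernel γ z i j - landauKernel γ z' i j| ≤
      10 * ‖z - z'‖ * (‖z‖ ^ (γ + 1) + ‖z'‖ ^ (γ + 1)) := by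
  have hz0 := norm_pos_iff.2 hz
  have hz0' := norm_pos_iff.2 hz'
  have h1 := lb_pow_diff' (-γ - 2) 1 (by linarith [hγ.2]) (by linarith [hγ.1]) (by norm_num) le_rfl z z' hz hz'
  rw [Real.rpow_one, show -(-γ - 2) = γ + 2 by ring, show -(-γ - 2 + 1) = γ + 1 by ring] at h1
  have e : landauKernel γ z i j - landauKernel γ z' i j =
      (‖z‖ ^ (γ + 2) - ‖z'‖ ^ (γ + 2)) * proj z i j + ‖z'‖ ^ (γ + 2) * (proj z i j - proj z' i j) := by
    unfold landauKernel; ring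
  have h2 : |proj z i j - proj z' i j| ≤ 4 * (‖z - z'‖ / ‖z'‖) := by
    have : proj z i j - proj z' i j = -((z i / ‖z‖ - z' i / ‖z'‖) * (z j / ‖z‖)
        + (z' i / ‖z'‖) * (z j / ‖z‖ - z' j / ‖z'‖)) := by unfold proj; ring
    rw [this, abs_neg]
    refine (abs_add_le _ _).trans ?_
    rw [abs_mul, abs_mul]
    have a1 := lb_unit_diff z z' hz hz' i
    have a2 := lb_unit_diff z z' hz hz' j
    have a3 := lb_unit_coord z j
    have a4 := lb_unit_coord z' i
    rw [mul_div_assoc] at a1 a2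
    have := mul_le_mul a1 a3 (abs_nonneg _) (by positivity)
    have := mul_le_mul a4 a2 (abs_nonneg _) (by norm_num)
    linarith
  have h3 : ‖z'‖ ^ (γ + 2) = ‖z'‖ ^ (γ + 1) * ‖z'‖ := by
    rw [show γ + 2 = γ + 1 + 1 by ring, Real.rpow_add_one hz0'.ne']
  rw [e]
  refine (abs_add_le _ _).trans ?_
  rw [abs_mul, abs_mul, abs_of_nonneg (Real.rpow_nonneg hz0'.le _)]
  have h4 := mul_le_mul h1 (lb_proj_le z i j) (abs_nonneg _) (by positivity)
  have h5 := mul_le_mul_of_nonneg_left h2 (Real.rpow_nonneg hz0'.le (γ + 2))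
  have h6 : ‖z'‖ ^ (γ + 2) * (4 * (‖z - z'‖ / ‖z'‖)) = 4 * ‖z'‖ ^ (γ + 1) * ‖z - z'‖ := by
    rw [h3]; field_simp
  rw [h6] at h5
  have h7 : 0 ≤ ‖z‖ ^ (γ + 1) := by positivity
  have h8 : 0 ≤ ‖z - z'‖ := norm_nonneg _
  nlinarith [mul_nonneg h7 h8]

lemma lb_abar_int (K' γ : ℝ) (hγ : γ ∈ Set.Icc (-3 : ℝ) (-2)) :
    ∃ C, 0 ≤ C ∧ ∀ f, LBDens K' f → ∀ v : V3, ∀ i j,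
      Integrable (fun w => landauKernel γ (v - w) i j * f w) ∧ |abar γ f v i j| ≤ C := by
  obtain ⟨C, hC, h⟩ := lb_K1 K' (-γ - 2) (by linarith [hγ.2]) (by linarith [hγ.1])
  refine ⟨2 * C, by positivity, fun f hf v i j => ?_⟩
  have hd := (h f hf v).1.const_mul 2
  have hm : AEStronglyMeasurable (fun w => landauKernel γ (v - w) i j * f w) := by
    refine AEStronglyMeasurable.mul ?_ hf.int.aestronglyMeasurable
    unfold landauKernel proj
    refine Measurable.aestronglyMeasurable ?_
    have hc : ∀ i, Measurable (fun w : V3 => (v - w) i) := fun i => by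
      simp only [PiLp.sub_apply]; fun_prop
    have hn : Measurable (fun w : V3 => ‖v - w‖) := by fun_prop
    exact (hn.pow_const _).mul (measurable_const.sub (((hc i).div hn).mul ((hc j).div hn)))
  have hb : ∀ w, ‖landauKernel γ (v - w) i j * f w‖ ≤ 2 * (‖v - w‖ ^ (-(-γ - 2)) * f w) := by
    intro w
    rw [norm_mul, Real.norm_of_nonneg (hf.nn w), Real.norm_eq_abs]
    unfold landauKernel
    rw [abs_mul, abs_of_nonneg (by positivity : 0 ≤ ‖v - w‖ ^ (γ + 2)), show -(-γ - 2) = γ + 2 by ring]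
    have := mul_le_mul_of_nonneg_left (lb_proj_le (v - w) i j) (by positivity : 0 ≤ ‖v - w‖ ^ (γ + 2))
    have := mul_le_mul_of_nonneg_right this (hf.nn w)
    linarith
  refine ⟨hd.mono' hm (Filter.Eventually.of_forall hb), ?_⟩
  have := norm_integral_le_of_norm_le hd (Filter.Eventually.of_forall hb)
  rw [integral_const_mul] at this
  unfold abar
  rw [Real.norm_eq_abs] at this
  linarith [(h f hf v).2]

lemma lb_abar_lip (K' γ : ℝ) (hγ : γ ∈ Set.Icc (-3 : ℝ) (-2)) :
    ∃ C, 0 ≤ C ∧ ∀ f, LBDens K' f → ∀ v v' : V3, ∀ i j,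
      |abar γ f v i j - abar γ f v' i j| ≤ C * ‖v - v'‖ := by
  obtain ⟨C, hC, h⟩ := lb_K1 K' (-γ - 1) (by linarith [hγ.2]) (by linarith [hγ.1])
  obtain ⟨C1, hC1, h1⟩ := lb_abar_int K' γ hγ
  refine ⟨20 * C, by positivity, fun f hf v v' i j => ?_⟩
  unfold abar
  rw [← integral_sub (h1 f hf v i j).1 (h1 f hf v' i j).1]
  have hd := (((h f hf v).1.add (h f hf v').1)).const_mul (10 * ‖v - v'‖)
  have := norm_integral_le_of_norm_le hd (f := fun w => landauKernel γ (v - w) i j * f w - landauKernel γ (v' - w) i j * f w) (by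
    filter_upwards [lb_ae_ne v, lb_ae_ne v'] with w hw hw'
    have h2 := lb_kernel_diff γ hγ _ _ hw hw' i j
    rw [sub_sub_sub_cancel_right] at h2
    rw [← sub_mul, norm_mul, Real.norm_eq_abs, Real.norm_of_nonneg (hf.nn w)]
    refine (mul_le_mul_of_nonneg_right h2 (hf.nn w)).trans_eq ?_
    simp only [Pi.add_apply]
    rw [show -(-γ - 1) = γ + 1 by ring]
    ring)
  rw [Real.norm_eq_abs] at this
  refine this.trans ?_
  rw [integral_const_mul]
  have e : ∫ a, ((fun w => ‖v - w‖ ^ (-(-γ - 1)) * f w) + fun w => ‖v' - w‖ ^ (-(-γ - 1)) * f w) a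
      = (∫ w, ‖v - w‖ ^ (-(-γ - 1)) * f w) + ∫ w, ‖v' - w‖ ^ (-(-γ - 1)) * f w :=
    integral_add (h f hf v).1 (h f hf v').1
  rw [e]
  have h3 := (h f hf v).2
  have h4 := (h f hf v').2
  have h5 : 0 ≤ ‖v - v'‖ := by positivity
  nlinarith

lemma lb_kernel_symm (γ : ℝ) (z : V3) (i j : Fin 3) : landauKernel γ z i j = landauKernel γ z j i := by
  unfold landauKernel proj
  rw [mul_comm (z i / ‖z‖)]
  simp only [eq_comm]

lemma lb_abar_symm (γ : ℝ) (f : V3 → ℝ) (v : V3) (i j : Fin 3) : abar γ f v i j = abar γ f v j i := by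
  unfold abar; simp only [lb_kernel_symm γ _ i j]

lemma lb_quad_kernel (γ : ℝ) (z ξ : V3) :
    quadForm (landauKernel γ z) ξ = ‖z‖ ^ (γ + 2) * (‖ξ‖ ^ 2 - (⟪ξ, z⟫ / ‖z‖) ^ 2) := by
  rw [lb_v3_norm_sq ξ, lb_v3_inner]
  simp only [quadForm, bilin, landauKernel, proj, Fin.sum_univ_three]
  simp
  ring

lemma lb_quad_nonneg (γ : ℝ) (z ξ : V3) : 0 ≤ quadForm (landauKernel γ z) ξ := by
  rw [lb_quad_kernel]
  refine mul_nonneg (by positivity) (sub_nonneg.2 ?_)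
  rw [sq_le_sq, abs_norm, abs_div, abs_norm]
  refine div_le_of_le_mul₀ (norm_nonneg _) (norm_nonneg _) (abs_real_inner_le_norm _ _)

lemma lb_quad_abar (K' γ : ℝ) (hγ : γ ∈ Set.Icc (-3 : ℝ) (-2)) (f : V3 → ℝ) (hf : LBDens K' f)
    (v ξ : V3) : Integrable (fun w => quadForm (landauKernel γ (v - w)) ξ * f w) ∧
      quadForm (abar γ f v) ξ = ∫ w, quadForm (landauKernel γ (v - w)) ξ * f w := by
  obtain ⟨C1, hC1, h1⟩ := lb_abar_int K' γ hγ
  have e : (fun w => quadForm (landauKernel γ (v - w)) ξ * f w) =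
      fun w => ∑ i, ∑ j, (ξ i * ξ j) * (landauKernel γ (v - w) i j * f w) := by
    funext w
    simp only [quadForm, bilin, Finset.sum_mul]
    exact Finset.sum_congr rfl fun i _ => Finset.sum_congr rfl fun j _ => by ring
  have hi : ∀ i j, Integrable (fun w => (ξ i * ξ j) * (landauKernel γ (v - w) i j * f w)) :=
    fun i j => (h1 f hf v i j).1.const_mul _
  rw [e]
  refine ⟨integrable_finsetSum _ fun i _ => integrable_finsetSum _ fun j _ => hi i j, ?_⟩
  rw [integral_finsetSum _ fun i _ => integrable_finsetSum _ fun j _ => hi i j]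
  simp only [quadForm, bilin]
  refine Finset.sum_congr rfl fun i _ => ?_
  rw [integral_finsetSum _ fun j _ => hi i j]
  refine Finset.sum_congr rfl fun j _ => ?_
  rw [integral_const_mul]; unfold abar; ring

lemma lb_quad_mono (K' γ : ℝ) (hγ : γ ∈ Set.Icc (-3 : ℝ) (-2)) (f h : V3 → ℝ) (hf : LBDens K' f)
    (hh : LBDens K' h) (c : ℝ) (hc : ∀ w, f w ≤ c * h w) (v ξ : V3) :
    quadForm (abar γ f v) ξ ≤ c * quadForm (abar γ h v) ξ := by
  rw [(lb_quad_abar K' γ hγ f hf v ξ).2, (lb_quad_abar K' γ hγ h hh v ξ).2, ← integral_const_mul]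
  refine integral_mono (lb_quad_abar K' γ hγ f hf v ξ).1 ((lb_quad_abar K' γ hγ h hh v ξ).1.const_mul c) fun w => ?_
  have := mul_le_mul_of_nonneg_left (hc w) (lb_quad_nonneg γ (v - w) ξ)
  simp only
  linarith

lemma lb_perp (ξ v : V3) : ∃ η : V3, ‖η‖ = 1 ∧ ⟪ξ, η⟫ = 0 ∧ ⟪η, v⟫ ≤ 0 := by
  have h : LinearMap.ker (innerₛₗ ℝ ξ : V3 →ₗ[ℝ] ℝ) ≠ ⊥ := by
    apply LinearMap.ker_ne_bot_of_finrank_lt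
    simp
  obtain ⟨y, hy, hy0⟩ := Submodule.exists_mem_ne_zero_of_ne_bot h
  have hy' : ⟪ξ, y⟫ = 0 := by simpa using hy
  have hn : ‖y‖ ≠ 0 := norm_ne_zero_iff.2 hy0
  have h1 : ‖(‖y‖⁻¹ : ℝ) • y‖ = 1 := by rw [norm_smul, norm_inv, norm_norm, inv_mul_cancel₀ hn]
  have h2 : ⟪ξ, (‖y‖⁻¹ : ℝ) • y⟫ = 0 := by rw [real_inner_smul_right, hy', mul_zero]
  rcases le_total ⟪(‖y‖⁻¹ : ℝ) • y, v⟫ 0 with h3 | h3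
  · exact ⟨_, h1, h2, h3⟩
  · refine ⟨-((‖y‖⁻¹ : ℝ) • y), by rw [norm_neg, h1], by rw [inner_neg_right, h2, neg_zero], ?_⟩
    rw [inner_neg_left]; linarith

lemma lb_bessel (ξ η z : V3) (hη : ‖η‖ = 1) (hξ : ⟪ξ, η⟫ = 0) :
    ⟪ξ, z⟫ ^ 2 + ‖ξ‖ ^ 2 * ⟪η, z⟫ ^ 2 ≤ ‖ξ‖ ^ 2 * ‖z‖ ^ 2 := by
  have h1 : ⟪ξ, z - ⟪η, z⟫ • η⟫ = ⟪ξ, z⟫ := by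
    rw [inner_sub_right, real_inner_smul_right, hξ]; ring
  have h2 : ‖z - ⟪η, z⟫ • η‖ ^ 2 = ‖z‖ ^ 2 - ⟪η, z⟫ ^ 2 := by
    rw [norm_sub_sq_real, real_inner_smul_right, norm_smul, hη, real_inner_comm, Real.norm_eq_abs, mul_one, sq_abs]
    ring
  have h3 := abs_real_inner_le_norm ξ (z - ⟪η, z⟫ • η)
  rw [h1] at h3
  have h4 : ⟪ξ, z⟫ ^ 2 ≤ (‖ξ‖ * ‖z - ⟪η, z⟫ • η‖) ^ 2 := by
    rw [← sq_abs]; gcongr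
  rw [mul_pow, h2] at h4
  linarith

lemma lb_jap_ge (v : V3) : 1 ≤ jap v ∧ ‖v‖ ≤ jap v := by
  unfold jap
  constructor
  · rw [Real.one_le_sqrt]; nlinarith [sq_nonneg ‖v‖]
  · exact Real.le_sqrt_of_sq_le (by linarith)

lemma lb_abar_lower (K' k' μ γ : ℝ) (hk' : 0 < k') (hμ : 0 < μ) (hγ : γ ∈ Set.Icc (-3 : ℝ) (-2)) :
    ∃ c, 0 < c ∧ ∀ f, LBDens K' f → (∀ w : V3, k' * Real.exp (-μ * ‖w‖ ^ 2) ≤ f w) →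
      ∀ v ξ : V3, c * jap v ^ γ * ‖ξ‖ ^ 2 ≤ quadForm (abar γ f v) ξ := by
  set vol : ℝ := (volume (Metric.ball (0 : V3) (1/4))).toReal with hvol
  have hvolpos : 0 < vol := by
    refine ENNReal.toReal_pos ?_ measure_ball_lt_top.ne
    exact (Metric.measure_ball_pos volume (0 : V3) (by norm_num)).ne'
  refine ⟨vol * (2 ^ γ * (1/16) * (k' * Real.exp (-μ))), by positivity, fun f hf hlow v ξ => ?_⟩
  obtain ⟨η, hη, hξη, hηv⟩ := lb_perp ξ v
  obtain ⟨hR1, hRv⟩ := lb_jap_ge v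
  set R := jap v with hR
  rw [(lb_quad_abar K' γ hγ f hf v ξ).2]
  have hint := (lb_quad_abar K' γ hγ f hf v ξ).1
  have hnn : ∀ w, 0 ≤ quadForm (landauKernel γ (v - w)) ξ * f w := fun w =>
    mul_nonneg (lb_quad_nonneg _ _ _) (hf.nn w)
  set S := Metric.ball ((1/2 : ℝ) • η) (1/4) with hS
  have h1 : ∫ w in S, quadForm (landauKernel γ (v - w)) ξ * f w ≤
      ∫ w, quadForm (landauKernel γ (v - w)) ξ * f w :=
    setIntegral_le_integral hint (Filter.Eventually.of_forall hnn)
  refine le_trans ?_ h1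
  have hvS : (volume S).toReal = vol := by
    rw [hS, Measure.addHaar_ball_center]
  have hpt : ∀ w ∈ S, (2 * R) ^ γ * (‖ξ‖ ^ 2 * (1/16)) * (k' * Real.exp (-μ)) ≤
      quadForm (landauKernel γ (v - w)) ξ * f w := by
    intro w hw
    rw [hS, mem_ball_iff_norm] at hw
    have hη2 : ‖(1/2 : ℝ) • η‖ = 1/2 := by rw [norm_smul, hη]; norm_num
    have hwn : ‖w‖ ≤ 3/4 := by
      have := norm_add_le (w - (1/2 : ℝ) • η) ((1/2 : ℝ) • η)
      rw [sub_add_cancel, hη2] at this; linarith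
    have hηw : 1/4 ≤ ⟪η, w⟫ := by
      have h2 : ⟪η, w⟫ = ⟪η, w - (1/2 : ℝ) • η⟫ + 1/2 := by
        rw [inner_sub_right, real_inner_smul_right, real_inner_self_eq_norm_sq, hη]; ring
      have h3 := abs_real_inner_le_norm η (w - (1/2 : ℝ) • η)
      rw [hη, one_mul] at h3
      have := (abs_le.1 h3).1
      linarith
    have hηz : ⟪η, v - w⟫ ≤ -(1/4) := by rw [inner_sub_right]; linarith
    have hsq : 1/16 ≤ ⟪η, v - w⟫ ^ 2 := by nlinarith
    have hz0 : 0 < ‖v - w‖ := by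
      rw [norm_pos_iff]; intro h0; rw [h0, inner_zero_right] at hηz; linarith
    have hz : ‖v - w‖ ≤ 2 * R := by
      have := norm_sub_le v w; linarith
    have hb := lb_bessel ξ η (v - w) hη hξη
    have hq : quadForm (landauKernel γ (v - w)) ξ = ‖v - w‖ ^ γ * (‖ξ‖ ^ 2 * ‖v - w‖ ^ 2 - ⟪ξ, v - w⟫ ^ 2) := by
      rw [lb_quad_kernel, Real.rpow_add hz0, Real.rpow_two]
      field_simp
    rw [hq]
    have hp : (2 * R) ^ γ ≤ ‖v - w‖ ^ γ := Real.rpow_le_rpow_of_nonpos hz0 hz (by linarith [hγ.2])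
    have hξs : ‖ξ‖ ^ 2 * (1/16) ≤ ‖ξ‖ ^ 2 * ‖v - w‖ ^ 2 - ⟪ξ, v - w⟫ ^ 2 := by
      have := mul_le_mul_of_nonneg_left hsq (sq_nonneg ‖ξ‖); linarith
    have hfw : k' * Real.exp (-μ) ≤ f w := by
      refine le_trans ?_ (hlow w)
      gcongr
      have : ‖w‖ ^ 2 ≤ 1 := by nlinarith [norm_nonneg w]
      nlinarith
    have hR0 : 0 ≤ (2 * R) ^ γ := by positivity
    exact mul_le_mul (mul_le_mul hp hξs (by positivity) (by positivity)) hfw (by positivity)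
      (mul_nonneg (by positivity) (le_trans (by positivity) hξs))
  have h2 := setIntegral_mono_on (μ := volume) (s := S) (f := fun _ => (2 * R) ^ γ * (‖ξ‖ ^ 2 * (1/16)) * (k' * Real.exp (-μ)))
    (integrableOn_const (by rw [hS]; exact measure_ball_lt_top.ne)) hint.integrableOn measurableSet_ball hpt
  refine le_trans (le_of_eq ?_) h2
  rw [setIntegral_const, smul_eq_mul, measureReal_def, hvS, Real.mul_rpow (by norm_num) (by linarith)]
  ring

open MeasureTheory Real
open scoped ENNReal RealInnerProductSpace
set_option linter.unusedSectionVars false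

section Generic6

variable {E : Type*} [NormedAddCommGroup E] [InnerProductSpace ℝ E] [FiniteDimensional ℝ E]

noncomputable def lbT (Λ : E →L[ℝ] E) (κ : ℝ) : (E →L[ℝ] ℝ) →L[ℝ] (E →L[ℝ] ℝ) :=
  κ • (ContinuousLinearMap.compL ℝ E E ℝ).flip Λ

noncomputable def lbD1 (φ : E → ℝ) (v0 : E) (Λ : E →L[ℝ] E) (κ : ℝ) (x : E) : E →L[ℝ] ℝ :=
  lbT Λ κ (fderiv ℝ φ (v0 + Λ x))

noncomputable def lbD2 (φ : E → ℝ) (v0 : E) (Λ : E →L[ℝ] E) (κ : ℝ) (x : E) : E →L[ℝ] E →L[ℝ] ℝ :=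
  (lbT Λ κ).comp ((fderiv ℝ (fderiv ℝ φ) (v0 + Λ x)).comp Λ)

lemma lbD1_apply (φ : E → ℝ) (v0 : E) (Λ : E →L[ℝ] E) (κ : ℝ) (x a : E) :
    lbD1 φ v0 Λ κ x a = κ * fderiv ℝ φ (v0 + Λ x) (Λ a) := rfl

lemma lbD2_apply (φ : E → ℝ) (v0 : E) (Λ : E →L[ℝ] E) (κ : ℝ) (x a b : E) :
    lbD2 φ v0 Λ κ x a b = κ * fderiv ℝ (fderiv ℝ φ) (v0 + Λ x) (Λ a) (Λ b) := rfl

lemma lb_comp_deriv (φ : E → ℝ) (hφ : ContDiff ℝ 2 φ) (v0 : E) (Λ : E →L[ℝ] E) (κ : ℝ) :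
      (∀ x, HasFDerivAt (fun x => κ * φ (v0 + Λ x)) (lbD1 φ v0 Λ κ x) x) ∧
      (∀ x, HasFDerivAt (lbD1 φ v0 Λ κ) (lbD2 φ v0 Λ κ x) x) := by
  have hd : ∀ v, HasFDerivAt φ (fderiv ℝ φ v) v := fun v =>
    (hφ.differentiable (by norm_num) v).hasFDerivAt
  have hφ1 : ContDiff ℝ 1 (fderiv ℝ φ) := hφ.fderiv_right (by norm_num)
  have hd2 : ∀ v, HasFDerivAt (fderiv ℝ φ) (fderiv ℝ (fderiv ℝ φ) v) v := fun v =>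
    (hφ1.differentiable (by norm_num) v).hasFDerivAt
  have ha : ∀ x, HasFDerivAt (fun x => v0 + Λ x) Λ x := fun x => (Λ.hasFDerivAt).const_add v0
  refine ⟨?_, ?_⟩
  · intro x
    exact ((hd (v0 + Λ x)).comp x (ha x)).const_mul κ
  · intro x
    exact (lbT Λ κ).hasFDerivAt.comp x ((hd2 (v0 + Λ x)).comp x (ha x))

lemma lb_exp_deriv2 (p u : E → ℝ) (P1 D1 : E → E →L[ℝ] ℝ) (P2 D2 : E → E →L[ℝ] E →L[ℝ] ℝ)
    (hp1 : ∀ x, HasFDerivAt p (P1 x) x) (hp2 : ∀ x, HasFDerivAt P1 (P2 x) x)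
    (hu1 : ∀ x, HasFDerivAt u (D1 x) x) (hu2 : ∀ x, HasFDerivAt D1 (D2 x) x)
    (hup : ∀ x, u x = Real.exp (p x)) :
    (∀ x a, D1 x a = Real.exp (p x) * P1 x a) ∧
    ∀ x a b, D2 x a b = Real.exp (p x) * (P2 x a b + P1 x a * P1 x b) := by
  have hue : u = fun x => Real.exp (p x) := funext hup
  have he : ∀ x, HasFDerivAt (fun x => Real.exp (p x)) (Real.exp (p x) • P1 x) x := fun x => (hp1 x).exp
  have h1 : ∀ x a, D1 x a = Real.exp (p x) * P1 x a := by
    intro x a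
    have := (hu1 x).unique (by rw [hue]; exact he x)
    rw [this]; rfl
  refine ⟨h1, fun x a b => ?_⟩
  have e1 : HasFDerivAt (fun y => D1 y b) ((ContinuousLinearMap.apply ℝ ℝ b).comp (D2 x)) x :=
    (ContinuousLinearMap.apply ℝ ℝ b).hasFDerivAt.comp x (hu2 x)
  have e2 : HasFDerivAt (fun y => P1 y b) ((ContinuousLinearMap.apply ℝ ℝ b).comp (P2 x)) x :=
    (ContinuousLinearMap.apply ℝ ℝ b).hasFDerivAt.comp x (hp2 x)
  have e3 := (he x).mul e2
  have e4 : (fun y => D1 y b) = (fun x => Real.exp (p x)) * (fun y => P1 y b) := by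
    funext y; exact h1 y b
  rw [e4] at e1
  have := DFunLike.congr_fun (e1.unique e3) a
  have l : ((ContinuousLinearMap.apply ℝ ℝ b).comp (D2 x)) a = D2 x a b := rfl
  rw [l] at this
  rw [this]
  have r : (Real.exp (p x) • (ContinuousLinearMap.apply ℝ ℝ b).comp (P2 x) + P1 x b • Real.exp (p x) • P1 x) a
    = Real.exp (p x) * P2 x a b + P1 x b * (Real.exp (p x) * P1 x a) := rfl
  rw [r]; ring

lemma lb_le_two_rpow (t α : ℝ) (ht : 0 ≤ t) (ht2 : t ≤ 2) (hα : 0 < α) (hα1 : α ≤ 1) : t ≤ 2 * t ^ α := by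
  rcases eq_or_lt_of_le ht with h | h
  · rw [← h]; positivity
  have h1 : t / 2 ≤ (t / 2) ^ α := by
    calc t / 2 = (t / 2) ^ (1 : ℝ) := (Real.rpow_one _).symm
      _ ≤ _ := Real.rpow_le_rpow_of_exponent_ge (by positivity) (by linarith) hα1
  have h2 : (t / 2) ^ α ≤ t ^ α := Real.rpow_le_rpow (by positivity) (by linarith) hα.le
  linarith

lemma lb_exp_hoelder (α U H : ℝ) (hα : 0 < α) (hα1 : α ≤ 1) (hU : 0 ≤ U) (hH : 0 ≤ H) :
    ∃ H0, 0 ≤ H0 ∧ ∀ (p u : E → ℝ) (P1 D1 : E → E →L[ℝ] ℝ) (P2 D2 : E → E →L[ℝ] E →L[ℝ] ℝ),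
    (∀ x, HasFDerivAt p (P1 x) x) → (∀ x, HasFDerivAt P1 (P2 x) x) →
    (∀ x, HasFDerivAt u (D1 x) x) → (∀ x, HasFDerivAt D1 (D2 x) x) →
    (∀ x, u x = Real.exp (p x)) → (∀ x, ‖x‖ ≤ 1 → |p x| ≤ U) →
    (∀ x y, ‖x‖ ≤ 1 → ‖y‖ ≤ 1 → ‖P2 x - P2 y‖ ≤ H * ‖x - y‖ ^ α) →
    ∀ x y, ‖x‖ ≤ 1 → ‖y‖ ≤ 1 → ‖D2 x - D2 y‖ ≤ H0 * ‖x - y‖ ^ α := by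
  set B2 := 4 * U + 2 * H with hB2
  set B1 := 5 * U + 2 * H + B2 with hB1
  have hB20 : 0 ≤ B2 := by positivity
  have hB10 : 0 ≤ B1 := by positivity
  set X := Real.exp U with hX
  have hX0 : 0 < X := Real.exp_pos _
  refine ⟨X * (2 * B1 * (B2 + B1 * B1) + H + 4 * B2 * B1), by positivity, ?_⟩
  intro p u P1 D1 P2 D2 hp1 hp2 hu1 hu2 hup hpU hpH x y hx hy
  have hI := lb_interp (φ := p) (D1 := P1) (D2 := P2) hp1 hp2 (x := 0) (τ := 1) (α := α) (U := U) (H := H) (by norm_num) (by linarith) hU hH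
    (fun y hy => hpU y (by simpa using hy))
    (fun y hy => hpH y 0 (by simpa using hy) (by simp))
  simp only [one_pow, div_one, Real.one_rpow, mul_one] at hI
  have hP2 : ∀ x, ‖x‖ ≤ 1 → ‖P2 x‖ ≤ B2 := by
    intro x hx
    have h1 := hpH x 0 hx (by simp)
    have h2 : ‖x - 0‖ ^ α ≤ 1 := Real.rpow_le_one (norm_nonneg _) (by simpa using hx) hα.le
    have h3 := norm_le_norm_add_norm_sub' (P2 x) (P2 0)
    have h4 := mul_le_mul_of_nonneg_left h2 hH
    linarith [hI.1]
  have hconv : Convex ℝ (Metric.closedBall (0 : E) 1) := convex_closedBall _ _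
  have hP1L : ∀ x y, ‖x‖ ≤ 1 → ‖y‖ ≤ 1 → ‖P1 x - P1 y‖ ≤ B2 * ‖x - y‖ := by
    intro x y hx hy
    exact hconv.norm_image_sub_le_of_norm_hasFDerivWithin_le (f := P1) (f' := P2)
      (fun z _ => (hp2 z).hasFDerivWithinAt) (fun z hz => hP2 z (by simpa using hz))
      (by simpa using hy) (by simpa using hx)
  have hP1 : ∀ x, ‖x‖ ≤ 1 → ‖P1 x‖ ≤ B1 := by
    intro x hx
    have h1 := hP1L x 0 hx (by simp)
    rw [sub_zero] at h1
    have h3 := norm_le_norm_add_norm_sub' (P1 x) (P1 0)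
    nlinarith [hI.2]
  have heB : ∀ x, ‖x‖ ≤ 1 → Real.exp (p x) ≤ X := fun x hx =>
    Real.exp_le_exp.2 (le_trans (le_abs_self _) (hpU x hx))
  have heL : |Real.exp (p x) - Real.exp (p y)| ≤ X * B1 * ‖x - y‖ := by
    refine hconv.norm_image_sub_le_of_norm_hasFDerivWithin_le (f := fun x => Real.exp (p x))
      (f' := fun x => Real.exp (p x) • P1 x)
      (fun z _ => (hp1 z).exp.hasFDerivWithinAt) (fun z hz => ?_)
      (by simpa using hy) (by simpa using hx)
    rw [norm_smul, Real.norm_of_nonneg (Real.exp_pos _).le]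
    have hz' : ‖z‖ ≤ 1 := by simpa using hz
    exact mul_le_mul (heB z hz') (hP1 z hz') (norm_nonneg _) hX0.le
  have hxy2 : ‖x - y‖ ≤ 2 := (norm_sub_le x y).trans (by linarith)
  have hd := lb_le_two_rpow ‖x - y‖ α (norm_nonneg _) hxy2 hα hα1
  set d := ‖x - y‖ ^ α with hdd
  have hd0 : 0 ≤ d := by positivity
  have hD := (lb_exp_deriv2 p u P1 D1 P2 D2 hp1 hp2 hu1 hu2 hup).2
  refine ContinuousLinearMap.opNorm_le_bound₂ _ (by positivity) fun a b => ?_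
  have hs : (D2 x - D2 y) a b = D2 x a b - D2 y a b := rfl
  have hs2 : (P2 x - P2 y) a b = P2 x a b - P2 y a b := rfl
  have hs1 : ∀ a, (P1 x - P1 y) a = P1 x a - P1 y a := fun a => rfl
  rw [hs, hD, hD]
  set na := ‖a‖
  set nb := ‖b‖
  have hna : 0 ≤ na := norm_nonneg _
  have hnb : 0 ≤ nb := norm_nonneg _
  have q1 : |P2 x a b| ≤ B2 * na * nb := by
    refine ((P2 x).le_opNorm₂ a b).trans ?_
    have := hP2 x hx; gcongr
  have q2 : |P2 x a b - P2 y a b| ≤ H * d * na * nb := by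
    rw [← hs2]
    refine ((P2 x - P2 y).le_opNorm₂ a b).trans ?_
    have := hpH x y hx hy; gcongr
  have q3 : ∀ z, ‖z‖ ≤ 1 → ∀ a, |P1 z a| ≤ B1 * ‖a‖ := by
    intro z hz a
    refine ((P1 z).le_opNorm a).trans ?_
    have := hP1 z hz; gcongr
  have q4 : ∀ a, |P1 x a - P1 y a| ≤ B2 * (2 * d) * ‖a‖ := by
    intro a
    rw [← hs1]
    refine ((P1 x - P1 y).le_opNorm a).trans ?_
    have := (hP1L x y hx hy).trans (mul_le_mul_of_nonneg_left hd hB20); gcongr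
  have q5 : |Real.exp (p x) - Real.exp (p y)| ≤ X * B1 * (2 * d) :=
    heL.trans (by gcongr)
  have id : Real.exp (p x) * (P2 x a b + P1 x a * P1 x b) - Real.exp (p y) * (P2 y a b + P1 y a * P1 y b)
    = (Real.exp (p x) - Real.exp (p y)) * (P2 x a b + P1 x a * P1 x b)
      + Real.exp (p y) * ((P2 x a b - P2 y a b) + ((P1 x a - P1 y a) * P1 x b + P1 y a * (P1 x b - P1 y b))) := by ring
  rw [id, Real.norm_eq_abs]
  have r1 : |P2 x a b + P1 x a * P1 x b| ≤ (B2 + B1 * B1) * na * nb := by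
    refine (abs_add_le _ _).trans ?_
    rw [abs_mul]
    have := mul_le_mul (q3 x hx a) (q3 x hx b) (abs_nonneg _) (by positivity)
    linarith
  have r2 : |(P2 x a b - P2 y a b) + ((P1 x a - P1 y a) * P1 x b + P1 y a * (P1 x b - P1 y b))|
      ≤ (H + 4 * B2 * B1) * d * na * nb := by
    refine (abs_add_le _ _).trans ?_
    have h1 := abs_add_le ((P1 x a - P1 y a) * P1 x b) (P1 y a * (P1 x b - P1 y b))
    rw [abs_mul, abs_mul] at h1
    have := mul_le_mul (q4 a) (q3 x hx b) (abs_nonneg _) (by positivity)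
    have := mul_le_mul (q3 y hy a) (q4 b) (abs_nonneg _) (by positivity)
    linarith
  refine (abs_add_le _ _).trans ?_
  rw [abs_mul, abs_mul, abs_of_pos (Real.exp_pos (p y))]
  have s1 := mul_le_mul q5 r1 (abs_nonneg _) (by positivity)
  have s2 := mul_le_mul (heB y hy) r2 (abs_nonneg _) hX0.le
  linarith

end Generic6

open MeasureTheory Real
open scoped ENNReal RealInnerProductSpace
set_option linter.unusedSectionVars false

lemma lb_hess_eq (φ : V3 → ℝ) (v : V3) (i j : Fin 3) :
    hess φ v i j = fderiv ℝ (fderiv ℝ φ) v (esingle i) (esingle j) := by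
  unfold hess
  rw [iteratedFDeriv_two_apply]; rfl

lemma lb_v3_expand (x : V3) : x = ∑ k, x k • esingle k := by
  ext i
  fin_cases i <;> simp [esingle, Fin.sum_univ_three]

lemma lb_coord_le (x : V3) (i : Fin 3) : |x i| ≤ ‖x‖ := by
  simpa using PiLp.norm_apply_le x i

lemma lb_Q_bound (Q : V3 →L[ℝ] V3 →L[ℝ] ℝ) (h : ℝ)
    (hQ : ∀ i j, |Q (esingle i) (esingle j)| ≤ h) (a b : V3) : |Q a b| ≤ 9 * h * ‖a‖ * ‖b‖ := by
  have hh : 0 ≤ h := (abs_nonneg _).trans (hQ 0 0)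
  have e : Q a b = ∑ k, ∑ l, a k * b l * Q (esingle k) (esingle l) := by
    conv_lhs => rw [lb_v3_expand a, lb_v3_expand b]
    rw [map_sum Q, ContinuousLinearMap.sum_apply]
    refine Finset.sum_congr rfl fun k _ => ?_
    rw [map_smul Q, ContinuousLinearMap.smul_apply, map_sum (Q (esingle k)), smul_eq_mul, Finset.mul_sum]
    refine Finset.sum_congr rfl fun l _ => ?_
    rw [map_smul, smul_eq_mul]; ring
  rw [e]
  have h1 : ∀ k l, |a k * b l * Q (esingle k) (esingle l)| ≤ ‖a‖ * ‖b‖ * h := by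
    intro k l
    rw [abs_mul, abs_mul]
    exact mul_le_mul (mul_le_mul (lb_coord_le a k) (lb_coord_le b l) (abs_nonneg _) (norm_nonneg _))
      (hQ k l) (abs_nonneg _) (by positivity)
  refine (Finset.abs_sum_le_sum_abs _ _).trans ?_
  have h2 : ∀ k, |∑ l, a k * b l * Q (esingle k) (esingle l)| ≤ 3 * (‖a‖ * ‖b‖ * h) := by
    intro k
    refine (Finset.abs_sum_le_sum_abs _ _).trans ?_
    refine (Finset.sum_le_sum fun l _ => h1 k l).trans ?_
    simp
  refine (Finset.sum_le_sum fun k _ => h2 k).trans ?_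
  simp; linarith

lemma lb_D2_diff (φ : V3 → ℝ) (v0 : V3) (Λ : V3 →L[ℝ] V3) (κ s h : ℝ) (hs : 0 ≤ s)
    (hΛ : ∀ a, ‖Λ a‖ ≤ s * ‖a‖) (x y : V3)
    (hφ : ∀ i j, |hess φ (v0 + Λ x) i j - hess φ (v0 + Λ y) i j| ≤ h) :
    ‖lbD2 φ v0 Λ κ x - lbD2 φ v0 Λ κ y‖ ≤ |κ| * (9 * h * s ^ 2) := by
  have hh : 0 ≤ h := (abs_nonneg _).trans (hφ 0 0)
  refine ContinuousLinearMap.opNorm_le_bound₂ _ (by positivity) fun a b => ?_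
  have e : (lbD2 φ v0 Λ κ x - lbD2 φ v0 Λ κ y) a b =
      κ * (fderiv ℝ (fderiv ℝ φ) (v0 + Λ x) - fderiv ℝ (fderiv ℝ φ) (v0 + Λ y)) (Λ a) (Λ b) := by
    have : (lbD2 φ v0 Λ κ x - lbD2 φ v0 Λ κ y) a b = lbD2 φ v0 Λ κ x a b - lbD2 φ v0 Λ κ y a b := rfl
    rw [this, lbD2_apply, lbD2_apply, ← mul_sub]; rfl
  rw [e, norm_mul, Real.norm_eq_abs, Real.norm_eq_abs]
  have h1 := lb_Q_bound (fderiv ℝ (fderiv ℝ φ) (v0 + Λ x) - fderiv ℝ (fderiv ℝ φ) (v0 + Λ y)) h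
    (by intro i j
        have := hφ i j
        rw [lb_hess_eq, lb_hess_eq] at this
        exact this) (Λ a) (Λ b)
  have h2 : 9 * h * ‖Λ a‖ * ‖Λ b‖ ≤ 9 * h * (s * ‖a‖) * (s * ‖b‖) := by
    have := hΛ a
    have := hΛ b
    gcongr
  have h3 := mul_le_mul_of_nonneg_left (h1.trans h2) (abs_nonneg κ)
  refine h3.trans (le_of_eq (by ring))

noncomputable def lbA0 (M : Mat3) (n : Fin 3 → V3) : (V3 →L[ℝ] V3 →L[ℝ] ℝ) →ₗ[ℝ] ℝ where
  toFun Q := ∑ k, ∑ l, M k l * Q (n k) (n l)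
  map_add' Q Q' := by
    simp only [ContinuousLinearMap.add_apply, mul_add, Finset.sum_add_distrib]
  map_smul' a Q := by
    simp only [ContinuousLinearMap.smul_apply, smul_eq_mul, RingHom.id_apply, Finset.mul_sum]
    exact Finset.sum_congr rfl fun k _ => Finset.sum_congr rfl fun l _ => by ring

noncomputable def lbA (M : Mat3) (n : Fin 3 → V3) : (V3 →L[ℝ] V3 →L[ℝ] ℝ) →L[ℝ] ℝ :=
  ⟨lbA0 M n, by
    show Continuous fun Q : V3 →L[ℝ] V3 →L[ℝ] ℝ => ∑ k, ∑ l, M k l * Q (n k) (n l)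
    fun_prop⟩

lemma lbA_apply (M : Mat3) (n : Fin 3 → V3) (Q : V3 →L[ℝ] V3 →L[ℝ] ℝ) :
    lbA M n Q = ∑ k, ∑ l, M k l * Q (n k) (n l) := rfl

lemma lb_sum9 (F : Fin 3 → Fin 3 → ℝ) (h : ℝ) (hF : ∀ k l, |F k l| ≤ h) :
    |∑ k, ∑ l, F k l| ≤ 9 * h := by
  refine (Finset.abs_sum_le_sum_abs _ _).trans ?_
  have h2 : ∀ k, |∑ l, F k l| ≤ 3 * h := by
    intro k
    refine (Finset.abs_sum_le_sum_abs _ _).trans ?_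
    refine (Finset.sum_le_sum fun l _ => hF k l).trans ?_
    simp
  refine (Finset.sum_le_sum fun k _ => h2 k).trans ?_
  simp; linarith

lemma lb_quad_diff (M M' : Mat3) (h : ℝ) (hM : ∀ i j, |M i j - M' i j| ≤ h) (ξ : V3) :
    |quadForm M ξ - quadForm M' ξ| ≤ 9 * h * ‖ξ‖ ^ 2 := by
  have e : quadForm M ξ - quadForm M' ξ = ∑ i, ∑ j, (M i j - M' i j) * ξ i * ξ j := by
    simp only [quadForm, bilin, Fin.sum_univ_three]; ring
  have hh : 0 ≤ h := (abs_nonneg _).trans (hM 0 0)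
  rw [e]
  refine (lb_sum9 _ (h * ‖ξ‖ * ‖ξ‖) fun k l => ?_).trans (le_of_eq (by ring))
  rw [abs_mul, abs_mul]
  exact mul_le_mul (mul_le_mul (hM k l) (lb_coord_le ξ k) (abs_nonneg _) hh)
      (lb_coord_le ξ l) (abs_nonneg _) (by positivity)

lemma lb_norm_sq_near (v0 z : V3) (hz : ‖z‖ * jap v0 ≤ 1) :
    |‖v0 + z‖ ^ 2 - ‖v0‖ ^ 2| ≤ 3 := by
  obtain ⟨h1, h2⟩ := lb_jap_ge v0
  rw [norm_add_sq_real]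
  have h3 := abs_real_inner_le_norm v0 z
  have h4 : ‖v0‖ * ‖z‖ ≤ 1 := by nlinarith [norm_nonneg z, norm_nonneg v0]
  have h5 : ‖z‖ ≤ 1 := by nlinarith [norm_nonneg z]
  have h6 : ‖z‖ ^ 2 ≤ 1 := by nlinarith [norm_nonneg z]
  have := abs_le.1 h3
  rw [abs_le]
  constructor <;> nlinarith [sq_nonneg ‖z‖]

lemma lb_cbar (K' γ δ : ℝ) (hK' : 0 < K') (hγ : γ ∈ Set.Icc (-3 : ℝ) (-2)) (hδ : δ ∈ Set.Ioo (0 : ℝ) 1) :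
    ∃ α, 0 < α ∧ α < 1 ∧ α ≤ δ ∧ ∃ C, 0 ≤ C ∧ ∀ f, LBDens K' f →
      (∀ v, |cbar γ f v| ≤ C) ∧
      ∀ v v', |cbar γ f v * f v - cbar γ f v' * f v'| ≤ C * (‖v - v'‖ ^ α * f v' + |f v - f v'|) := by
  by_cases h3 : γ = -3
  · refine ⟨δ, hδ.1, hδ.2, le_rfl, 16 * Real.pi * K', by positivity, fun f hf => ?_⟩
    have hc : ∀ v, cbar γ f v = 8 * Real.pi * f v := fun v => by unfold cbar; rw [if_pos h3]
    refine ⟨fun v => ?_, fun v v' => ?_⟩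
    · rw [hc, abs_of_nonneg (mul_nonneg (by positivity) (hf.nn v))]
      have := mul_le_mul_of_nonneg_left (hf.ub v) (by positivity : 0 ≤ 8 * Real.pi)
      have : 0 ≤ 8 * Real.pi * K' := by positivity
      linarith
    · rw [hc, hc]
      have e : 8 * Real.pi * f v * f v - 8 * Real.pi * f v' * f v' = 8 * Real.pi * (f v + f v') * (f v - f v') := by ring
      have h0 : 0 ≤ 8 * Real.pi * (f v + f v') := mul_nonneg (by positivity) (by linarith [hf.nn v, hf.nn v'])
      rw [e, abs_mul, abs_of_nonneg h0]
      have h1 : 8 * Real.pi * (f v + f v') ≤ 16 * Real.pi * K' := by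
        have := mul_le_mul_of_nonneg_left (add_le_add (hf.ub v) (hf.ub v')) (by positivity : 0 ≤ 8 * Real.pi)
        linarith
      refine mul_le_mul h1 ?_ (abs_nonneg _) (by positivity)
      have : 0 ≤ ‖v - v'‖ ^ δ * f v' := mul_nonneg (by positivity) (hf.nn v')
      linarith
  · have hg3 : -3 < γ := lt_of_le_of_ne hγ.1 (Ne.symm h3)
    set α := min δ ((γ + 3) / 2) with hα
    have hα0 : 0 < α := lt_min hδ.1 (by linarith)
    have hαδ : α ≤ δ := min_le_left _ _
    have hα2 : α ≤ (γ + 3) / 2 := min_le_right _ _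
    have hα1 : α < 1 := hαδ.trans_lt hδ.2
    obtain ⟨C1, hC1, h1⟩ := lb_K1 K' (-γ) (by linarith [hγ.2]) (by linarith)
    obtain ⟨C2, hC2, h2⟩ := lb_int_diff K' (-γ) α (by linarith [hγ.2]) hα0.le hα1.le (by linarith)
    rw [neg_neg] at h1 h2
    refine ⟨α, hα0, hα1, hαδ, 2 * (C1 + C2), by positivity, fun f hf => ?_⟩
    have hc : ∀ v, cbar γ f v = 2 * (γ + 3) * ∫ w, ‖v - w‖ ^ γ * f w := fun v => by
      unfold cbar; rw [if_neg h3]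
    have hI0 : ∀ v, 0 ≤ ∫ w, ‖v - w‖ ^ γ * f w := fun v =>
      integral_nonneg fun w => mul_nonneg (by positivity) (hf.nn w)
    have hb : ∀ v, |cbar γ f v| ≤ 2 * C1 := by
      intro v
      rw [hc, abs_of_nonneg (mul_nonneg (by linarith) (hI0 v))]
      exact mul_le_mul (by linarith [hγ.2]) (h1 f hf v).2 (hI0 v) (by norm_num)
    have hd : ∀ v v', |cbar γ f v - cbar γ f v'| ≤ 2 * C2 * ‖v - v'‖ ^ α := by
      intro v v'
      rw [hc, hc, ← mul_sub, abs_mul, abs_of_nonneg (by linarith : 0 ≤ 2 * (γ + 3)), mul_assoc 2 C2]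
      exact mul_le_mul (by linarith [hγ.2]) (h2 f hf v v') (abs_nonneg _) (by norm_num)
    refine ⟨fun v => (hb v).trans (by linarith), fun v v' => ?_⟩
    have e : cbar γ f v * f v - cbar γ f v' * f v' =
      cbar γ f v * (f v - f v') + (cbar γ f v - cbar γ f v') * f v' := by ring
    rw [e]
    refine (abs_add_le _ _).trans ?_
    rw [abs_mul, abs_mul, abs_of_nonneg (hf.nn v')]
    have s1 := mul_le_mul_of_nonneg_right (hb v) (abs_nonneg (f v - f v'))
    have s2 := mul_le_mul_of_nonneg_right (hd v v') (hf.nn v')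
    have s3 : 0 ≤ ‖v - v'‖ ^ α * f v' := mul_nonneg (by positivity) (hf.nn v')
    nlinarith [mul_nonneg hC1 s3, mul_nonneg hC2 (abs_nonneg (f v - f v'))]

lemma lb_rpow_two (t α δ : ℝ) (ht : 0 ≤ t) (ht2 : t ≤ 2) (hα : 0 < α) (hαδ : α ≤ δ) (hδ : δ ≤ 1) :
    t ^ δ ≤ 2 * t ^ α := by
  rcases eq_or_lt_of_le ht with h | h
  · rw [← h, Real.zero_rpow (by linarith)]; positivity
  have e : t ^ δ = t ^ α * t ^ (δ - α) := by rw [← Real.rpow_add h]; congr 1; ring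
  have h1 : t ^ (δ - α) ≤ 2 := by
    calc t ^ (δ - α) ≤ 2 ^ (δ - α) := Real.rpow_le_rpow ht ht2 (by linarith)
      _ ≤ 2 ^ (1 : ℝ) := Real.rpow_le_rpow_of_exponent_le (by norm_num) (by linarith)
      _ = 2 := Real.rpow_one 2
  have : 0 ≤ t ^ α := by positivity
  rw [e]; nlinarith

open MeasureTheory Real
open scoped ENNReal RealInnerProductSpace
set_option linter.unusedSectionVars false

lemma lb_three_rpow (R ℓ : ℝ) (hR : 1 ≤ R) : (R + 2) ^ ℓ ≤ 3 ^ |ℓ| * R ^ ℓ := by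
  have hR0 : 0 < R := by linarith
  rcases le_total 0 ℓ with h | h
  · rw [abs_of_nonneg h, ← Real.mul_rpow (by norm_num) hR0.le]
    exact Real.rpow_le_rpow (by linarith) (by linarith) h
  · have h1 : (R + 2) ^ ℓ ≤ R ^ ℓ := Real.rpow_le_rpow_of_nonpos hR0 (by linarith) h
    have h2 : (1 : ℝ) ≤ 3 ^ |ℓ| := Real.one_le_rpow (by norm_num) (abs_nonneg _)
    have h3 : 0 ≤ R ^ ℓ := by positivity
    nlinarith

set_option maxHeartbeats 2000000 in
lemma lb_build
    (γ : ℝ) (hγ : γ ∈ Set.Icc (-3 : ℝ) (-2)) (T : ℝ) (hT : 0 < T)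
    (μ k' K' : ℝ) (hμ : 0 < μ) (hk' : 0 < k') (hK' : 0 < K')
    (δ : ℝ) (hδ : δ ∈ Set.Ioo (0 : ℝ) 1) (ℓ Cg : ℝ) (hCg : 0 < Cg)
    (g : ℝ → V3 → ℝ)
    (hg : IsClassicalSolution γ (Set.Icc 0 T) g)
    (hC2δ : ∀ R : ℝ, 0 < R → ∃ Cb : ℝ, ∀ t ∈ Set.Icc (0 : ℝ) T,
      ∀ v ∈ Metric.ball (0 : V3) R, ∀ w ∈ Metric.ball (0 : V3) R, ∀ i j : Fin 3,
        |hess (g t) v i j - hess (g t) w i j| ≤ Cb * ‖v - w‖ ^ δ)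
    (hdens : ∀ t ∈ Set.Icc (0 : ℝ) T, LBDens K' (g t))
    (hmax : ∀ t ∈ Set.Icc (0 : ℝ) T, ∀ v : V3,
      k' * Real.exp (-μ * ‖v‖ ^ 2) ≤ g t v ∧ g t v ≤ K' * Real.exp (-μ * ‖v‖ ^ 2))
    (hlogC2 : ContDiff ℝ 2 (fun v => Real.log (g 0 v)))
    (hholder : ∀ R : ℝ, 1 ≤ R → ∀ i j : Fin 3,
      ∀ v ∈ Metric.ball (0 : V3) R, ∀ w ∈ Metric.ball (0 : V3) R,
        |logHess (g 0) v i j - logHess (g 0) w i j| ≤ Cg * R ^ ℓ * ‖v - w‖ ^ δ)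
    (α : ℝ) (hα0 : 0 < α) (hα1 : α < 1) (hαδ : α ≤ δ)
    (v0 : V3) (L : V3 →L[ℝ] V3) (n : Fin 3 → V3) (r b : ℝ) (hr0 : 0 < r) (hb : 1 ≤ b)
    (hL : ∀ x, ‖L x‖ ≤ b * ‖x‖) (hLn : ∀ i, L (n i) = esingle i) (hrb : r * b * jap v0 ≤ 1)
    (N : ℝ) (hN : ∀ i, ‖n i‖ ^ 2 ≤ N)
    (hcov : ∀ (lam Lam : ℝ) (M' : Mat3), 0 ≤ lam → (∀ i j, M' i j = M' j i) →
        (∀ ξ, lam * quadForm (abar γ (g 0) v0) ξ ≤ quadForm M' ξ) →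
        (∀ ξ, quadForm M' ξ ≤ Lam * quadForm (abar γ (g 0) v0) ξ) →
        ∀ e : V3, ‖e‖ = 1 → ∀ (Q : V3 →L[ℝ] V3 →L[ℝ] ℝ) (c : ℝ), 0 ≤ c →
        (∀ l, Q l l ≤ c * ‖l‖ ^ 2) →
        ∑ k, ∑ l, M' k l * Q (n k) (n l) ≤ lam * Q e e + c * (3 * Lam))
    (CL : ℝ) (hCL : 0 ≤ CL) (hlip : ∀ t ∈ Set.Icc (0 : ℝ) T, ∀ v v' : V3, ∀ i j,
      |abar γ (g t) v i j - abar γ (g t) v' i j| ≤ CL * ‖v - v'‖)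
    (c0 : ℝ) (hlow : ∀ ξ, c0 * ‖ξ‖ ^ 2 ≤ quadForm (abar γ (g 0) v0) ξ)
    (hsm : 9 * (CL * (r * b)) ≤ c0 / 2) (ε : ℝ)
    (hAε : 18 * (CL * (r * b)) * N ≤ ε)
    (Cc : ℝ) (hCc : 0 ≤ Cc) (hcb : ∀ t ∈ Set.Icc (0 : ℝ) T, ∀ v v', |cbar γ (g t) v * g t v - cbar γ (g t) v' * g t v'|
      ≤ Cc * (‖v - v'‖ ^ α * g t v' + |g t v - g t v'|))
    (hf1 : r ^ 2 * Cc * (K' * Real.exp (3 * μ)) ≤ 1) (hf2 : r ^ 2 * Cc ≤ ε)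
    (hrl : r ^ (2 + δ) * jap v0 ^ ℓ ≤ 1) (H0 : ℝ)
    (hexp : ∀ (p u : V3 → ℝ) (P1 D1 : V3 → V3 →L[ℝ] ℝ) (P2 D2 : V3 → V3 →L[ℝ] V3 →L[ℝ] ℝ),
      (∀ x, HasFDerivAt p (P1 x) x) → (∀ x, HasFDerivAt P1 (P2 x) x) →
      (∀ x, HasFDerivAt u (D1 x) x) → (∀ x, HasFDerivAt D1 (D2 x) x) →
      (∀ x, u x = Real.exp (p x)) → (∀ x, ‖x‖ ≤ 1 → |p x| ≤ |Real.log k'| + |Real.log K'| + 3 * μ) →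
      (∀ x y, ‖x‖ ≤ 1 → ‖y‖ ≤ 1 → ‖P2 x - P2 y‖ ≤ (18 * Cg * 3 ^ |ℓ| * b ^ (2 + δ)) * ‖x - y‖ ^ α) →
      ∀ x y, ‖x‖ ≤ 1 → ‖y‖ ≤ 1 → ‖D2 x - D2 y‖ ≤ H0 * ‖x - y‖ ^ α) :
    LBSol α (k' / (2 * K')) (3 * (3 * K' / (2 * k'))) ε (K' * Real.exp (3 * μ)) H0 T (r ^ 2)⁻¹
      (fun t x => (Real.exp (-μ * ‖v0‖ ^ 2))⁻¹ * g t (v0 + (r • L) x))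
      (fun t => lbD1 (g t) v0 (r • L) (Real.exp (-μ * ‖v0‖ ^ 2))⁻¹)
      (fun t => lbD2 (g t) v0 (r • L) (Real.exp (-μ * ‖v0‖ ^ 2))⁻¹)
      (fun t x => lbA (abar γ (g t) (v0 + (r • L) x)) n)
      (fun t x => r ^ 2 * (cbar γ (g t) (v0 + (r • L) x) *
        ((Real.exp (-μ * ‖v0‖ ^ 2))⁻¹ * g t (v0 + (r • L) x)))) := by
  obtain ⟨hR1, hRv⟩ := lb_jap_ge v0
  set R := jap v0 with hR
  set G := Real.exp (-μ * ‖v0‖ ^ 2) with hG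
  have hG0 : 0 < G := Real.exp_pos _
  set Λ := r • L with hΛdef
  have hb0 : 0 < b := by linarith
  have hrb0 : 0 < r * b := by positivity
  have hrb1 : r * b ≤ 1 := by nlinarith
  have hΛa : ∀ x, Λ x = r • L x := fun x => rfl
  have hΛ : ∀ x, ‖Λ x‖ ≤ (r * b) * ‖x‖ := by
    intro x
    rw [hΛa, norm_smul, Real.norm_of_nonneg hr0.le, mul_assoc]
    exact mul_le_mul_of_nonneg_left (hL x) hr0.le
  have hΛ1 : ∀ x, ‖Λ x‖ ≤ ‖x‖ := fun x =>
    (hΛ x).trans (mul_le_of_le_one_left (norm_nonneg _) hrb1)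
  have hsub : ∀ x y, (v0 + Λ x) - (v0 + Λ y) = Λ (x - y) := by
    intro x y; rw [map_sub]; abel
  have hballx : ∀ x, ‖x‖ ≤ 1 → v0 + Λ x ∈ Metric.ball (0 : V3) (R + 2) := by
    intro x hx
    rw [mem_ball_zero_iff]
    have := norm_add_le v0 (Λ x)
    have := hΛ1 x
    linarith
  have hnear : ∀ x, ‖x‖ ≤ 1 → |‖v0 + Λ x‖ ^ 2 - ‖v0‖ ^ 2| ≤ 3 := by
    intro x hx
    refine lb_norm_sq_near v0 _ ?_
    have h1 : ‖Λ x‖ ≤ r * b := (hΛ x).trans (mul_le_of_le_one_right hrb0.le hx)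
    exact (mul_le_mul_of_nonneg_right h1 (by linarith)).trans hrb
  have h0T : (0 : ℝ) ∈ Set.Icc 0 T := ⟨le_rfl, hT.le⟩
  have hupos : ∀ t ∈ Set.Icc 0 T, ∀ x, 0 < G⁻¹ * g t (v0 + Λ x) := fun t ht x =>
    mul_pos (inv_pos.2 hG0) (hg.pos t ht _)
  have hGe : G⁻¹ = Real.exp (μ * ‖v0‖ ^ 2) := by
    rw [hG, ← Real.exp_neg]; congr 1; ring
  have hub : ∀ t ∈ Set.Icc 0 T, ∀ x, ‖x‖ ≤ 1 → G⁻¹ * g t (v0 + Λ x) ≤ K' * Real.exp (3 * μ) := by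
    intro t ht x hx
    have h1 := (hmax t ht (v0 + Λ x)).2
    have h2 := mul_le_mul_of_nonneg_left h1 (inv_pos.2 hG0).le
    refine h2.trans ?_
    rw [hGe, mul_left_comm, ← Real.exp_add]
    gcongr
    have := abs_le.1 (hnear x hx)
    nlinarith
  have hxy2 : ∀ x y : V3, ‖x‖ ≤ 1 → ‖y‖ ≤ 1 → ‖x - y‖ ≤ 2 := fun x y hx hy =>
    (norm_sub_le x y).trans (by linarith)
  have hN0 : 0 ≤ N := (sq_nonneg _).trans (hN 0)
  refine ⟨by positivity, ?_, ?_, ?_, ?_, ?_, ?_, ?_, ?_, ?_⟩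
  · intro t ht x
    exact (lb_comp_deriv (g t) (hg.velC2 t ht) v0 Λ G⁻¹).1 x
  · intro t ht x
    exact (lb_comp_deriv (g t) (hg.velC2 t ht) v0 Λ G⁻¹).2 x
  · intro t ht x hx
    have hd : DifferentiableWithinAt ℝ (fun s => g s (v0 + Λ x)) (Set.Icc 0 T) t :=
      ((hg.timeC1 (v0 + Λ x)).differentiableOn (by norm_num)) t ht
    have h1 := hd.hasDerivWithinAt.const_mul G⁻¹
    refine h1.congr_deriv ?_
    rw [hg.eqn t ht (v0 + Λ x), lbA_apply]
    have h2 : ∀ k l, lbD2 (g t) v0 Λ G⁻¹ x (n k) (n l) = G⁻¹ * (r ^ 2 * hess (g t) (v0 + Λ x) k l) := by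
      intro k l
      rw [lbD2_apply, lb_hess_eq, hΛa (n k), hΛa (n l), hLn, hLn]
      rw [map_smul (fderiv ℝ (fderiv ℝ (g t)) (v0 + Λ x)), ContinuousLinearMap.smul_apply, map_smul, smul_eq_mul, smul_eq_mul]
      ring
    simp only [h2, matDot]
    have h3 : ∑ k, ∑ l, abar γ (g t) (v0 + Λ x) k l * (G⁻¹ * (r ^ 2 * hess (g t) (v0 + Λ x) k l)) =
        G⁻¹ * r ^ 2 * ∑ k, ∑ l, abar γ (g t) (v0 + Λ x) k l * hess (g t) (v0 + Λ x) k l := by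
      simp only [Finset.mul_sum]
      exact Finset.sum_congr rfl fun k _ => Finset.sum_congr rfl fun l _ => by ring
    rw [h3]
    field_simp
  · obtain ⟨Cb, hCb⟩ := hC2δ (R + 2) (by linarith)
    refine ⟨G⁻¹ * (9 * (|Cb| * 2)), fun t ht x y hx hy => ?_⟩
    have h1 := lb_D2_diff (g t) v0 Λ G⁻¹ 1 (|Cb| * (2 * ‖x - y‖ ^ α)) zero_le_one
      (fun a => by rw [one_mul]; exact hΛ1 a) x y (by
        intro i j
        refine (hCb t ht _ (hballx x hx) _ (hballx y hy) i j).trans ?_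
        refine mul_le_mul (le_abs_self _) ?_ (by positivity) (abs_nonneg _)
        rw [hsub]
        exact (Real.rpow_le_rpow (norm_nonneg _) (hΛ1 _) hδ.1.le).trans
          (lb_rpow_two _ α δ (norm_nonneg _) (hxy2 x y hx hy) hα0 hαδ hδ.2.le))
    refine h1.trans (le_of_eq ?_)
    rw [abs_of_pos (inv_pos.2 hG0)]; ring
  · intro t ht x hx
    show |G⁻¹ * g t (v0 + Λ x)| ≤ _
    rw [abs_of_pos (hupos t ht x)]
    exact hub t ht x hx
  · have hp := lb_comp_deriv (fun v => Real.log (g 0 v)) hlogC2 v0 Λ 1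
    have hu := lb_comp_deriv (g 0) (hg.velC2 0 h0T) v0 Λ G⁻¹
    refine hexp (fun x => μ * ‖v0‖ ^ 2 + 1 * Real.log (g 0 (v0 + Λ x))) _ _ _ _ _ (fun x => (hp.1 x).const_add _) hp.2 hu.1 hu.2 ?_ ?_ ?_
    · intro x
      rw [one_mul, Real.exp_add, Real.exp_log (hg.pos 0 h0T _), hGe]
    · intro x hx
      obtain ⟨h1, h2⟩ := hmax 0 h0T (v0 + Λ x)
      have h3 := Real.log_le_log (by positivity) h1
      have h4 := Real.log_le_log (hg.pos 0 h0T _) h2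
      rw [Real.log_mul hk'.ne' (Real.exp_pos _).ne', Real.log_exp] at h3
      rw [Real.log_mul hK'.ne' (Real.exp_pos _).ne', Real.log_exp] at h4
      have := abs_le.1 (hnear x hx)
      have a1 := neg_abs_le (Real.log k')
      have a2 := le_abs_self (Real.log K')
      have a3 := abs_nonneg (Real.log k')
      have a4 := abs_nonneg (Real.log K')
      rw [one_mul, abs_le]
      constructor <;> nlinarith
    · intro x y hx hy
      have h1 := lb_D2_diff (fun v => Real.log (g 0 v)) v0 Λ 1 (r * b)
        (Cg * (3 ^ |ℓ| * R ^ ℓ) * ((r * b) ^ δ * (2 * ‖x - y‖ ^ α))) hrb0.le hΛ x y (by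
          intro i j
          refine (hholder (R + 2) (by linarith) i j _ (hballx x hx) _ (hballx y hy)).trans ?_
          rw [hsub]
          refine mul_le_mul (mul_le_mul_of_nonneg_left (lb_three_rpow R ℓ hR1) hCg.le) ?_ (by positivity) (by positivity)
          refine (Real.rpow_le_rpow (norm_nonneg _) (hΛ _) hδ.1.le).trans ?_
          rw [Real.mul_rpow hrb0.le (norm_nonneg _)]
          exact mul_le_mul_of_nonneg_left (lb_rpow_two _ α δ (norm_nonneg _) (hxy2 x y hx hy) hα0 hαδ hδ.2.le) (by positivity))
      refine h1.trans ?_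
      have h2 : (r * b) ^ δ * (r * b) ^ 2 = r ^ (2 + δ) * b ^ (2 + δ) := by
        rw [← Real.rpow_two, ← Real.rpow_add hrb0, Real.mul_rpow hr0.le hb0.le, add_comm]
      have h3 : |(1 : ℝ)| * (9 * (Cg * (3 ^ |ℓ| * R ^ ℓ) * ((r * b) ^ δ * (2 * ‖x - y‖ ^ α))) * (r * b) ^ 2)
        = (18 * Cg * 3 ^ |ℓ| * ‖x - y‖ ^ α) * R ^ ℓ * ((r * b) ^ δ * (r * b) ^ 2) := by
        rw [abs_one]; ring
      rw [h3, h2]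
      have h4 : 0 ≤ (18 * Cg * 3 ^ |ℓ| * ‖x - y‖ ^ α) * b ^ (2 + δ) := by positivity
      have := mul_le_mul_of_nonneg_left hrl h4
      linarith
  · intro t ht x hx e he Q c hc hQ
    rw [lbA_apply]
    have hx' : ‖(v0 + Λ x) - v0‖ ≤ r * b := by
      rw [add_sub_cancel_left]; exact (hΛ x).trans (mul_le_of_le_one_right hrb0.le hx)
    have hq : ∀ ξ, |quadForm (abar γ (g 0) (v0 + Λ x)) ξ - quadForm (abar γ (g 0) v0) ξ| ≤
        quadForm (abar γ (g 0) v0) ξ / 2 := by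
      intro ξ
      have h1 := lb_quad_diff (abar γ (g 0) (v0 + Λ x)) (abar γ (g 0) v0) (CL * (r * b))
        (fun i j => (hlip 0 h0T _ _ i j).trans (mul_le_mul_of_nonneg_left hx' hCL)) ξ
      have h2 := mul_le_mul_of_nonneg_right hsm (sq_nonneg ‖ξ‖)
      have h3 := hlow ξ
      linarith
    have hgt : ∀ s ∈ Set.Icc 0 T, ∀ s' ∈ Set.Icc 0 T, ∀ w, g s w ≤ K' / k' * g s' w := by
      intro s hs s' hs' w
      have h1 := (hmax s hs w).2
      have h2 := (hmax s' hs' w).1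
      rw [div_mul_eq_mul_div, le_div_iff₀ hk']
      have h3 := mul_le_mul_of_nonneg_right h1 hk'.le
      have h4 := mul_le_mul_of_nonneg_left h2 hK'.le
      have h5 : K' * Real.exp (-μ * ‖w‖ ^ 2) * k' = K' * (k' * Real.exp (-μ * ‖w‖ ^ 2)) := by ring
      exact h3.trans (h5.le.trans h4)
    have q1 : ∀ ξ, quadForm (abar γ (g t) (v0 + Λ x)) ξ ≤ K' / k' * quadForm (abar γ (g 0) (v0 + Λ x)) ξ :=
      fun ξ => lb_quad_mono K' γ hγ _ _ (hdens t ht) (hdens 0 h0T) _ (hgt t ht 0 h0T) _ ξ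
    have q2 : ∀ ξ, quadForm (abar γ (g 0) (v0 + Λ x)) ξ ≤ K' / k' * quadForm (abar γ (g t) (v0 + Λ x)) ξ :=
      fun ξ => lb_quad_mono K' γ hγ _ _ (hdens 0 h0T) (hdens t ht) _ (hgt 0 h0T t ht) _ ξ
    refine hcov (k' / (2 * K')) (3 * K' / (2 * k')) _ (by positivity) (lb_abar_symm γ _ _) ?_ ?_ e he Q c hc hQ
    · intro ξ
      have h1 := q2 ξ
      have h2 := (abs_le.1 (hq ξ)).1
      have h3 : quadForm (abar γ (g 0) v0) ξ / 2 ≤ K' / k' * quadForm (abar γ (g t) (v0 + Λ x)) ξ := by linarith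
      have h4 := mul_le_mul_of_nonneg_left h3 (by positivity : 0 ≤ k' / K')
      have h5 : k' / K' * (K' / k' * quadForm (abar γ (g t) (v0 + Λ x)) ξ) = quadForm (abar γ (g t) (v0 + Λ x)) ξ := by
        field_simp
      have h6 : k' / (2 * K') * quadForm (abar γ (g 0) v0) ξ = k' / K' * (quadForm (abar γ (g 0) v0) ξ / 2) := by
        field_simp
      linarith
    · intro ξ
      have h1 := q1 ξ
      have h2 := (abs_le.1 (hq ξ)).2
      have h3 : quadForm (abar γ (g 0) (v0 + Λ x)) ξ ≤ 3 / 2 * quadForm (abar γ (g 0) v0) ξ := by linarith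
      have h4 := mul_le_mul_of_nonneg_left h3 (by positivity : 0 ≤ K' / k')
      have h6 : 3 * K' / (2 * k') * quadForm (abar γ (g 0) v0) ξ = K' / k' * (3 / 2 * quadForm (abar γ (g 0) v0) ξ) := by
        field_simp
      linarith
  · intro t ht x y hx hy Q
    rw [lbA_apply, lbA_apply]
    have hnn : ∀ k l, ‖n k‖ * ‖n l‖ ≤ N := by
      intro k l
      nlinarith [hN k, hN l, sq_nonneg (‖n k‖ - ‖n l‖)]
    have e : ∑ k, ∑ l, abar γ (g t) (v0 + Λ x) k l * Q (n k) (n l) - ∑ k, ∑ l, abar γ (g t) (v0 + Λ y) k l * Q (n k) (n l)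
      = ∑ k, ∑ l, (abar γ (g t) (v0 + Λ x) k l - abar γ (g t) (v0 + Λ y) k l) * Q (n k) (n l) := by
      simp only [sub_mul, Finset.sum_sub_distrib]
    rw [e]
    have hd := lb_le_two_rpow ‖x - y‖ α (norm_nonneg _) (hxy2 x y hx hy) hα0 hα1.le
    have h1 := lb_sum9 (fun k l => (abar γ (g t) (v0 + Λ x) k l - abar γ (g t) (v0 + Λ y) k l) * Q (n k) (n l))
      (CL * ((r * b) * (2 * ‖x - y‖ ^ α)) * (‖Q‖ * N)) (by
        intro k l
        rw [abs_mul]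
        refine mul_le_mul ?_ ?_ (abs_nonneg _) (by positivity)
        · refine (hlip t ht _ _ k l).trans (mul_le_mul_of_nonneg_left ?_ hCL)
          rw [hsub]
          exact (hΛ _).trans (mul_le_mul_of_nonneg_left hd hrb0.le)
        · refine (Q.le_opNorm₂ (n k) (n l)).trans ?_
          rw [mul_assoc]
          exact mul_le_mul_of_nonneg_left (hnn k l) (norm_nonneg Q))
    refine h1.trans ?_
    have h2 : 0 ≤ ‖x - y‖ ^ α * ‖Q‖ := mul_nonneg (by positivity) (norm_nonneg Q)
    have := mul_le_mul_of_nonneg_right hAε h2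
    linarith
  · intro t ht x y hx hy
    show |r ^ 2 * (cbar γ (g t) (v0 + Λ x) * (G⁻¹ * g t (v0 + Λ x))) - r ^ 2 * (cbar γ (g t) (v0 + Λ y) * (G⁻¹ * g t (v0 + Λ y)))|
      ≤ ‖x - y‖ ^ α + ε * |G⁻¹ * g t (v0 + Λ x) - G⁻¹ * g t (v0 + Λ y)|
    have e : r ^ 2 * (cbar γ (g t) (v0 + Λ x) * (G⁻¹ * g t (v0 + Λ x))) - r ^ 2 * (cbar γ (g t) (v0 + Λ y) * (G⁻¹ * g t (v0 + Λ y)))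
      = (r ^ 2 * G⁻¹) * (cbar γ (g t) (v0 + Λ x) * g t (v0 + Λ x) - cbar γ (g t) (v0 + Λ y) * g t (v0 + Λ y)) := by ring
    have hGi : 0 < G⁻¹ := inv_pos.2 hG0
    rw [e, abs_mul, abs_of_pos (by positivity), ← mul_sub, abs_mul, abs_of_pos hGi]
    have h1 := hcb t ht (v0 + Λ x) (v0 + Λ y)
    rw [hsub] at h1
    have h2 : ‖Λ (x - y)‖ ^ α ≤ ‖x - y‖ ^ α := Real.rpow_le_rpow (norm_nonneg _) (hΛ1 _) hα0.le
    have hgy := (hg.pos t ht (v0 + Λ y)).le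
    have h3 := mul_le_mul_of_nonneg_left h1 (by positivity : 0 ≤ r ^ 2 * G⁻¹)
    refine h3.trans ?_
    have h4 := mul_le_mul_of_nonneg_right h2 (hupos t ht y).le
    have h5 := mul_le_mul_of_nonneg_left (hub t ht y hy) (by positivity : 0 ≤ ‖x - y‖ ^ α)
    have h6 := mul_le_mul_of_nonneg_left (h4.trans h5) (by positivity : 0 ≤ r ^ 2 * Cc)
    have h7 := mul_le_mul_of_nonneg_left hf1 (by positivity : 0 ≤ ‖x - y‖ ^ α)
    have h8 := mul_le_mul_of_nonneg_right hf2 (by positivity : 0 ≤ G⁻¹ * |g t (v0 + Λ x) - g t (v0 + Λ y)|)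
    linarith

open MeasureTheory Real
open scoped ENNReal RealInnerProductSpace
set_option linter.unusedSectionVars false

lemma lb_params (γ δ ℓ m b Cc U ε CL c : ℝ) (hγ : γ ∈ Set.Icc (-3 : ℝ) (-2))
    (hδ : 0 < δ) (hb : 1 ≤ b) (hCc : 0 ≤ Cc) (hU : 0 ≤ U) (hε : 0 < ε) (hCL : 0 ≤ CL) (hc : 0 < c)
    (hm : 3 ≤ m) (hml : ℓ ≤ m * (2 + δ)) :
    ∃ ε' : ℝ, 0 < ε' ∧ ∀ R : ℝ, 1 ≤ R → ∀ r, r = ε' * R ^ (-m) →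
      r * b * R ≤ 1 ∧ 9 * (CL * (r * b)) ≤ (c * R ^ γ) / 2 ∧
      18 * (CL * (r * b)) * (1 / (c * R ^ γ)) ≤ ε ∧
      r ^ 2 * Cc * U ≤ 1 ∧ r ^ 2 * Cc ≤ ε ∧ r ^ (2 + δ) * R ^ ℓ ≤ 1 := by
  set S := b + Cc * U + Cc / ε + 18 * CL * b / (c * ε) + 18 * CL * b / c with hS
  have s1 : 0 ≤ Cc * U := by positivity
  have s2 : 0 ≤ Cc / ε := by positivity
  have s3 : 0 ≤ 18 * CL * b / (c * ε) := by positivity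
  have s4 : 0 ≤ 18 * CL * b / c := by positivity
  have hS1 : 1 ≤ S := by linarith
  have hS0 : 0 < S := by linarith
  have key : ∀ x, x ≤ S → S⁻¹ * x ≤ 1 := by
    intro x hx
    rw [inv_mul_le_iff₀ hS0]; linarith
  refine ⟨S⁻¹, by positivity, fun R hR r hr => ?_⟩
  have hR0 : 0 < R := by linarith
  have hRm : R ^ (-m) ≤ 1 := Real.rpow_le_one_of_one_le_of_nonpos hR (by linarith)
  have hRm0 : 0 < R ^ (-m) := by positivity
  have hRγ0 : 0 < R ^ γ := by positivity
  have hRγ : R ^ (-m) ≤ R ^ γ := Real.rpow_le_rpow_of_exponent_le hR (by linarith [hγ.1])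
  have hRR : R ^ (-m) * R ≤ 1 := by
    nth_rewrite 2 [← Real.rpow_one R]
    rw [← Real.rpow_add hR0]
    exact Real.rpow_le_one_of_one_le_of_nonpos hR (by linarith)
  have hSi : 0 < S⁻¹ := by positivity
  have hSi1 : S⁻¹ ≤ 1 := by simpa using key 1 hS1
  have hr0 : 0 < r := by rw [hr]; positivity
  have hrS : r ≤ S⁻¹ := by rw [hr]; exact mul_le_of_le_one_right hSi.le hRm
  have hrR : r ≤ R ^ (-m) := by rw [hr]; exact mul_le_of_le_one_left hRm0.le hSi1
  have hr2 : r ^ 2 ≤ S⁻¹ := by nlinarith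
  have k1 := key b (by linarith)
  have k2 := key (Cc * U) (by linarith)
  have k3 := key (Cc / ε) (by linarith)
  have k4 := key (18 * CL * b / (c * ε)) (by linarith)
  have k5 := key (18 * CL * b / c) (by linarith)
  have k3' : S⁻¹ * Cc ≤ ε := by
    rw [← mul_div_assoc, div_le_one hε] at k3; exact k3
  have k4' : S⁻¹ * (18 * CL * b) ≤ c * ε := by
    rw [← mul_div_assoc, div_le_one (by positivity)] at k4; exact k4
  have k5' : S⁻¹ * (18 * CL * b) ≤ c := by
    rw [← mul_div_assoc, div_le_one hc] at k5; exact k5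
  refine ⟨?_, ?_, ?_, ?_, ?_, ?_⟩
  · calc r * b * R = (S⁻¹ * b) * (R ^ (-m) * R) := by rw [hr]; ring
      _ ≤ 1 * 1 := mul_le_mul k1 hRR (by positivity) zero_le_one
      _ = 1 := one_mul 1
  · calc 9 * (CL * (r * b)) = (S⁻¹ * (18 * CL * b)) * R ^ (-m) / 2 := by rw [hr]; ring
      _ ≤ c * R ^ γ / 2 := by
        have := mul_le_mul k5' hRγ hRm0.le hc.le
        linarith
  · rw [mul_one_div, div_le_iff₀ (by positivity)]
    calc 18 * (CL * (r * b)) = (S⁻¹ * (18 * CL * b)) * R ^ (-m) := by rw [hr]; ring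
      _ ≤ (c * ε) * R ^ γ := mul_le_mul k4' hRγ hRm0.le (by positivity)
      _ = _ := by ring
  · calc r ^ 2 * Cc * U = r ^ 2 * (Cc * U) := by ring
      _ ≤ S⁻¹ * (Cc * U) := mul_le_mul_of_nonneg_right hr2 s1
      _ ≤ 1 := k2
  · exact (mul_le_mul_of_nonneg_right hr2 hCc).trans k3'
  · have h1 : r ^ (2 + δ) ≤ (R ^ (-m)) ^ (2 + δ) := Real.rpow_le_rpow hr0.le hrR (by linarith)
    refine (mul_le_mul_of_nonneg_right h1 (by positivity)).trans ?_
    rw [← Real.rpow_mul hR0.le, ← Real.rpow_add hR0]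
    exact Real.rpow_le_one_of_one_le_of_nonpos hR (by linarith)

set_option maxHeartbeats 1000000 in
lemma lb_main
    (γ : ℝ) (hγ : γ ∈ Set.Icc (-3 : ℝ) (-2)) (T : ℝ) (hT : 0 < T)
    (μ k' K' : ℝ) (hμ : 0 < μ) (hk' : 0 < k') (hK' : 0 < K')
    (δ : ℝ) (hδ : δ ∈ Set.Ioo (0 : ℝ) 1) (ℓ Cg : ℝ) (hCg : 0 < Cg)
    (g : ℝ → V3 → ℝ)
    (hg : IsClassicalSolution γ (Set.Icc 0 T) g)
    (hC2δ : ∀ R : ℝ, 0 < R → ∃ Cb : ℝ, ∀ t ∈ Set.Icc (0 : ℝ) T,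
      ∀ v ∈ Metric.ball (0 : V3) R, ∀ w ∈ Metric.ball (0 : V3) R, ∀ i j : Fin 3,
        |hess (g t) v i j - hess (g t) w i j| ≤ Cb * ‖v - w‖ ^ δ)
    (hdens : ∀ t ∈ Set.Icc (0 : ℝ) T, LBDens K' (g t))
    (hmax : ∀ t ∈ Set.Icc (0 : ℝ) T, ∀ v : V3,
      k' * Real.exp (-μ * ‖v‖ ^ 2) ≤ g t v ∧ g t v ≤ K' * Real.exp (-μ * ‖v‖ ^ 2))
    (hlogC2 : ContDiff ℝ 2 (fun v => Real.log (g 0 v)))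
    (hholder : ∀ R : ℝ, 1 ≤ R → ∀ i j : Fin 3,
      ∀ v ∈ Metric.ball (0 : V3) R, ∀ w ∈ Metric.ball (0 : V3) R,
        |logHess (g 0) v i j - logHess (g 0) w i j| ≤ Cg * R ^ ℓ * ‖v - w‖ ^ δ)
    (m : ℝ) (hm : 3 ≤ m) (hml : ℓ ≤ m * (2 + δ)) :
    ∃ C : ℝ, 0 ≤ C ∧ ∀ t ∈ Set.Icc (0 : ℝ) T, ∀ v : V3, ∀ i j,
      (fderiv ℝ (g t) v (esingle i)) ^ 2 ≤ C * jap v ^ (2 * m - γ) * (g t v) ^ 2 ∧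
      |hess (g t) v i j| ≤ C * jap v ^ (2 * m - γ) * g t v := by
  obtain ⟨Ca, hCa, habar⟩ := lb_abar_int K' γ hγ
  obtain ⟨CL, hCL, hlip⟩ := lb_abar_lip K' γ hγ
  obtain ⟨c, hc, hlow⟩ := lb_abar_lower K' k' μ γ hk' hμ hγ
  obtain ⟨α, hα0, hα1, hαδ, Cc, hCc, hcb⟩ := lb_cbar K' γ δ hK' hγ hδ
  set b := 3 * Ca + 1 with hbdef
  have hb : 1 ≤ b := by linarith
  obtain ⟨ε, hε, hsch⟩ := lb_schauder (E := V3) (α := α) (lam := k' / (2 * K'))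
    (Lam := 3 * (3 * K' / (2 * k'))) hα0 hα1 (by positivity) (by positivity)
  obtain ⟨H0, hH0, hexp⟩ := lb_exp_hoelder (E := V3) α (|Real.log k'| + |Real.log K'| + 3 * μ)
    (18 * Cg * 3 ^ |ℓ| * b ^ (2 + δ)) hα0 hα1.le (by positivity) (by positivity)
  obtain ⟨C, hC, hsch⟩ := hsch (K' * Real.exp (3 * μ)) H0 (by positivity) hH0
  obtain ⟨ε', hε', hpar⟩ := lb_params γ δ ℓ m b Cc (K' * Real.exp (3 * μ)) ε CL c hγ hδ.1 hb hCc
    (by positivity) hε hCL hc hm hml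
  have h0T : (0 : ℝ) ∈ Set.Icc 0 T := ⟨le_rfl, hT.le⟩
  refine ⟨(C ^ 2 / k' ^ 2 + C / k') * (1 / (ε' ^ 2 * c)), by positivity, fun t ht v i j => ?_⟩
  obtain ⟨hR1, hRv⟩ := lb_jap_ge v
  set R := jap v with hR
  have hR0 : 0 < R := by linarith
  obtain ⟨p1, p2, p3, p4, p5, p6⟩ := hpar R hR1 _ rfl
  set r := ε' * R ^ (-m) with hr
  have hr0 : 0 < r := by positivity
  obtain ⟨L, n, hLn, hLb, hn, hcov⟩ := lb_cov (abar γ (g 0) v) (lb_abar_symm γ _ _) (c * R ^ γ) Ca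
    (by positivity) (hlow (g 0) (hdens 0 h0T) (fun w => (hmax 0 h0T w).1) v)
    (fun i j => (habar (g 0) (hdens 0 h0T) v i j).2)
  have hL : ∀ x, ‖L x‖ ≤ b * ‖x‖ := by
    intro x
    refine abs_le_of_sq_le_sq' ?_ (by positivity) |>.2
    refine (hLb x).trans ?_
    rw [mul_pow]
    refine mul_le_mul_of_nonneg_right ?_ (sq_nonneg _)
    nlinarith
  have hsol := lb_build γ hγ T hT μ k' K' hμ hk' hK' δ hδ ℓ Cg hCg g hg hC2δ hdens hmax hlogC2 hholder
    α hα0 hα1 hαδ v L n r b hr0 hb hL hLn p1 _ hn hcov CL hCL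
    (fun t ht => hlip (g t) (hdens t ht)) (c * R ^ γ) (hlow (g 0) (hdens 0 h0T) (fun w => (hmax 0 h0T w).1) v)
    p2 ε p3 Cc hCc (fun t ht => (hcb (g t) (hdens t ht)).2) p4 p5 p6 H0 hexp
  obtain ⟨h1, h2⟩ := hsch _ _ _ _ _ _ _ hsol t ht
  set G := Real.exp (-μ * ‖v‖ ^ 2) with hG
  have hG0 : 0 < G := Real.exp_pos _
  have hgk : G ≤ g t v / k' := by
    rw [le_div_iff₀ hk', mul_comm]; exact (hmax t ht v).1
  have hgp := hg.pos t ht v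
  have hv0 : v + (r • L) 0 = v := by simp
  have hrL : ∀ i, (r • L) (n i) = r • esingle i := by
    intro i
    rw [ContinuousLinearMap.smul_apply, hLn]
  have e1 : fderiv ℝ (g t) v (esingle i) = r⁻¹ * G * lbD1 (g t) v (r • L) G⁻¹ 0 (n i) := by
    rw [lbD1_apply, hv0, hrL, map_smul, smul_eq_mul]
    field_simp
  have e2 : hess (g t) v i j = r⁻¹ ^ 2 * G * lbD2 (g t) v (r • L) G⁻¹ 0 (n i) (n j) := by
    rw [lbD2_apply, hv0, hrL, hrL, lb_hess_eq, map_smul (fderiv ℝ (fderiv ℝ (g t)) v),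
      ContinuousLinearMap.smul_apply, map_smul, smul_eq_mul, smul_eq_mul]
    field_simp
  have hrr : r⁻¹ ^ 2 * (1 / (c * R ^ γ)) = 1 / (ε' ^ 2 * c) * R ^ (2 * m - γ) := by
    have : R ^ (2 * m - γ) = (R ^ (-m) * R ^ (-m) * R ^ γ)⁻¹ := by
      rw [← Real.rpow_add hR0, ← Real.rpow_add hR0, ← Real.rpow_neg hR0.le]
      congr 1; ring
    rw [this, hr]
    field_simp
  set P := R ^ (2 * m - γ) with hP
  have hP0 : 0 < P := by positivity
  set N := 1 / (c * R ^ γ) with hNd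
  have hN0 : 0 < N := by positivity
  set W := 1 / (ε' ^ 2 * c) with hW
  have hW0 : 0 < W := by positivity
  have hnn : ‖n i‖ * ‖n j‖ ≤ N := by
    nlinarith [hn i, hn j, sq_nonneg (‖n i‖ - ‖n j‖)]
  constructor
  · rw [e1]
    have a1 : |lbD1 (g t) v (r • L) G⁻¹ 0 (n i)| ≤ C * ‖n i‖ :=
      ((lbD1 (g t) v (r • L) G⁻¹ 0).le_opNorm (n i)).trans (mul_le_mul_of_nonneg_right h1 (norm_nonneg _))
    have a2 : (lbD1 (g t) v (r • L) G⁻¹ 0 (n i)) ^ 2 ≤ C ^ 2 * N := by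
      rw [← sq_abs]
      calc _ ≤ (C * ‖n i‖) ^ 2 := pow_le_pow_left₀ (abs_nonneg _) a1 2
        _ = C ^ 2 * ‖n i‖ ^ 2 := by ring
        _ ≤ _ := mul_le_mul_of_nonneg_left (hn i) (sq_nonneg _)
    have a3 : G ^ 2 ≤ (g t v / k') ^ 2 := pow_le_pow_left₀ hG0.le hgk 2
    calc (r⁻¹ * G * lbD1 (g t) v (r • L) G⁻¹ 0 (n i)) ^ 2
        = r⁻¹ ^ 2 * (G ^ 2 * (lbD1 (g t) v (r • L) G⁻¹ 0 (n i)) ^ 2) := by ring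
      _ ≤ r⁻¹ ^ 2 * ((g t v / k') ^ 2 * (C ^ 2 * N)) := by gcongr
      _ = (C ^ 2 / k' ^ 2) * (r⁻¹ ^ 2 * N) * (g t v) ^ 2 := by ring
      _ = (C ^ 2 / k' ^ 2) * (W * P) * (g t v) ^ 2 := by rw [hrr]
      _ ≤ (C ^ 2 / k' ^ 2 + C / k') * (W * P) * (g t v) ^ 2 := by
        gcongr
        have : 0 ≤ C / k' := by positivity
        linarith
      _ = _ := by ring
  · rw [e2, abs_mul, abs_of_pos (by positivity)]
    have a1 : |lbD2 (g t) v (r • L) G⁻¹ 0 (n i) (n j)| ≤ C * N := by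
      refine ((lbD2 (g t) v (r • L) G⁻¹ 0).le_opNorm₂ (n i) (n j)).trans ?_
      rw [mul_assoc]
      exact mul_le_mul h2 hnn (by positivity) hC
    calc r⁻¹ ^ 2 * G * |lbD2 (g t) v (r • L) G⁻¹ 0 (n i) (n j)|
        ≤ r⁻¹ ^ 2 * (g t v / k') * (C * N) := by gcongr
      _ = (C / k') * (r⁻¹ ^ 2 * N) * (g t v) := by ring
      _ = (C / k') * (W * P) * (g t v) := by rw [hrr]
      _ ≤ (C ^ 2 / k' ^ 2 + C / k') * (W * P) * (g t v) := by
        gcongr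
        have : 0 ≤ C ^ 2 / k' ^ 2 := by positivity
        linarith
      _ = _ := by ring

open MeasureTheory Real
open scoped ENNReal RealInnerProductSpace

lemma lb_grad_norm (p : V3 → ℝ) (v : V3) (B : ℝ)
    (h : ∀ i, (fderiv ℝ p v (esingle i)) ^ 2 ≤ B) : ‖gradient p v‖ ^ 2 ≤ 3 * B := by
  have e : ∀ i, (gradient p v) i = fderiv ℝ p v (esingle i) := by
    intro i
    have h1 : ⟪gradient p v, esingle i⟫ = fderiv ℝ p v (esingle i) := by
      rw [gradient, InnerProductSpace.toDual_symm_apply]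
    rw [← h1]
    generalize gradient p v = x
    simp [esingle, EuclideanSpace.inner_single_right]
  rw [EuclideanSpace.norm_sq_eq]
  simp only [Fin.sum_univ_three, Real.norm_eq_abs, sq_abs, e]
  linarith [h 0, h 1, h 2]

lemma lb_matNorm (A : Mat3) (B : ℝ) (hB : 0 ≤ B) (h : ∀ i j, |A i j| ≤ B) : matNorm A ≤ 3 * B := by
  unfold matNorm
  rw [Real.sqrt_le_left (by positivity)]
  have h2 : ∀ i j, (A i j) ^ 2 ≤ B ^ 2 := fun i j => sq_le_sq' (abs_le.1 (h i j)).1 (abs_le.1 (h i j)).2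
  simp only [Fin.sum_univ_three]
  linarith [h2 0 0, h2 0 1, h2 0 2, h2 1 0, h2 1 1, h2 1 2, h2 2 0, h2 2 1, h2 2 2]

/-- logarithmic bounds for a classical solution satisfying a
Maxwellian sandwich (Proposition 5 of the paper). -/
theorem logarithmic_bounds
    (γ : ℝ) (hγ : γ ∈ Set.Icc (-3 : ℝ) (-2)) (T : ℝ) (hT : 0 < T)
    (μ k' K' : ℝ) (hμ : 0 < μ) (hk' : 0 < k') (hK' : 0 < K')
    (δ : ℝ) (hδ : δ ∈ Set.Ioo (0 : ℝ) 1) (ℓ Cg : ℝ) (hCg : 0 < Cg)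
    (g : ℝ → V3 → ℝ)
    (hg : IsClassicalSolution γ (Set.Icc 0 T) g)
    -- C^{2+δ} in velocity on every bounded cylinder
    (hC2δ : ∀ R : ℝ, 0 < R → ∃ Cb : ℝ, ∀ t ∈ Set.Icc (0 : ℝ) T,
      ∀ v ∈ Metric.ball (0 : V3) R, ∀ w ∈ Metric.ball (0 : V3) R, ∀ i j : Fin 3,
        |hess (g t) v i j - hess (g t) w i j| ≤ Cb * ‖v - w‖ ^ δ)
    (hint : ∀ t ∈ Set.Icc (0 : ℝ) T, Integrable (g t))
    (hmass : ∀ t ∈ Set.Icc (0 : ℝ) T, (∫ v, g t v) = 1)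
    -- Maxwellian sandwich
    (hmax : ∀ t ∈ Set.Icc (0 : ℝ) T, ∀ v : V3,
      k' * Real.exp (-μ * ‖v‖ ^ 2) ≤ g t v ∧ g t v ≤ K' * Real.exp (-μ * ‖v‖ ^ 2))
    -- initial datum: ln g₀ locally C^{2+δ} with polynomial growth of the seminorm
    (hlogC2 : ContDiff ℝ 2 (fun v => Real.log (g 0 v)))
    (hholder : ∀ R : ℝ, 1 ≤ R → ∀ i j : Fin 3,
      ∀ v ∈ Metric.ball (0 : V3) R, ∀ w ∈ Metric.ball (0 : V3) R,
        |logHess (g 0) v i j - logHess (g 0) w i j| ≤ Cg * R ^ ℓ * ‖v - w‖ ^ δ) :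
    ∃ K : ℝ, 0 < K ∧
      ∀ t ∈ Set.Icc (0 : ℝ) T, ∀ v : V3,
        ‖logGrad (g t) v‖ ≤
          K * jap v ^ (2 * max (2 + (ℓ - 2) / (2 + δ)) 1 + (2 - γ) / δ) ∧
        matNorm (logHess (g t) v) ≤
          K * jap v ^ (2 * (2 * max (2 + (ℓ - 2) / (2 + δ)) 1 + (2 - γ) / δ)) ∧
        |derivWithin (fun s => Real.log (g s v)) (Set.Icc 0 T) t| ≤
          K * jap v ^ (2 * max (2 + (ℓ - 2) / (2 + δ)) 1 + (4 - 2 * γ) / δ) := by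
  set β := max (2 + (ℓ - 2) / (2 + δ)) 1 with hβ
  have hβ1 : 1 ≤ β := le_max_right _ _
  have hδ0 := hδ.1
  have hβ2 : ℓ ≤ (β + 2) * (2 + δ) := by
    have h1 : 2 + (ℓ - 2) / (2 + δ) ≤ β := le_max_left _ _
    have h2 := mul_le_mul_of_nonneg_right h1 (by linarith : 0 ≤ 2 + δ)
    rw [add_mul, div_mul_cancel₀ _ (by linarith : (2 + δ) ≠ 0)] at h2
    nlinarith
  have hdens : ∀ t ∈ Set.Icc (0 : ℝ) T, LBDens K' (g t) := by
    intro t ht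
    refine ⟨fun w => (hg.pos t ht w).le, fun w => ?_, hint t ht, hmass t ht⟩
    refine (hmax t ht w).2.trans (mul_le_of_le_one_right hK'.le ?_)
    rw [Real.exp_le_one_iff]
    nlinarith [sq_nonneg ‖w‖]
  obtain ⟨C, hC, hmain⟩ := lb_main γ hγ T hT μ k' K' hμ hk' hK' δ hδ ℓ Cg hCg g hg hC2δ hdens hmax
    hlogC2 hholder (β + 2) (by linarith) hβ2
  obtain ⟨Ca, hCa, habar⟩ := lb_abar_int K' γ hγ
  obtain ⟨α, hα0, hα1, hαδ, Cc, hCc, hcb⟩ := lb_cbar K' γ δ hK' hγ hδ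
  have hCaC : 0 ≤ Ca * C := mul_nonneg hCa hC
  refine ⟨1 + 6 * C + 9 * (Ca * C) + Cc, by positivity, fun t ht v => ?_⟩
  obtain ⟨hR1, -⟩ := lb_jap_ge v
  set R := jap v with hR
  have hR0 : 0 < R := by linarith
  set X := R ^ (2 * (β + 2) - γ) with hX
  have hX1 : 1 ≤ X := Real.one_le_rpow hR1 (by linarith [hγ.2])
  have hd1 : 2 - γ ≤ (2 - γ) / δ := by
    rw [le_div_iff₀ hδ0]; nlinarith [hγ.2, hδ.2]
  have hd2 : 4 - 2 * γ ≤ (4 - 2 * γ) / δ := by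
    rw [le_div_iff₀ hδ0]; nlinarith [hγ.2, hδ.2]
  have hXκ : X ≤ R ^ (2 * (2 * β + (2 - γ) / δ)) :=
    Real.rpow_le_rpow_of_exponent_le hR1 (by linarith [hγ.2])
  have hXν : X ≤ R ^ (2 * β + (4 - 2 * γ) / δ) :=
    Real.rpow_le_rpow_of_exponent_le hR1 (by linarith [hγ.2])
  have hgp := hg.pos t ht
  have hgv := hgp v
  have hgC2 := hg.velC2 t ht
  have hpC2 : ContDiff ℝ 2 (fun w => Real.log (g t w)) := hgC2.log fun w => (hgp w).ne'
  have hf1 : ∀ φ : V3 → ℝ, ContDiff ℝ 2 φ → (∀ x, HasFDerivAt φ (fderiv ℝ φ x) x) ∧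
      ∀ x, HasFDerivAt (fderiv ℝ φ) (fderiv ℝ (fderiv ℝ φ) x) x := by
    intro φ hφ
    refine ⟨fun x => (hφ.differentiable (by norm_num) x).hasFDerivAt, fun x => ?_⟩
    have : ContDiff ℝ 1 (fderiv ℝ φ) := hφ.fderiv_right (by norm_num)
    exact (this.differentiable (by norm_num) x).hasFDerivAt
  obtain ⟨d1, d2⟩ := lb_exp_deriv2 (fun w => Real.log (g t w)) (g t) _ _ _ _ (hf1 _ hpC2).1 (hf1 _ hpC2).2
    (hf1 _ hgC2).1 (hf1 _ hgC2).2 (fun x => (Real.exp_log (hgp x)).symm)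
  have hP1 : ∀ i, (fderiv ℝ (fun w => Real.log (g t w)) v (esingle i)) ^ 2 ≤ C * X := by
    intro i
    have h1 := (hmain t ht v i i).1
    rw [d1, Real.exp_log hgv, mul_pow, mul_comm] at h1
    exact le_of_mul_le_mul_right h1 (by positivity)
  have hCX : 0 ≤ C * X := by positivity
  have hP2 : ∀ i j, |logHess (g t) v i j| ≤ 2 * (C * X) := by
    intro i j
    have h1 := (hmain t ht v i j).2
    unfold logHess
    rw [lb_hess_eq] at h1 ⊢
    rw [d2, Real.exp_log hgv, abs_mul, abs_of_pos hgv, mul_comm] at h1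
    have h2 := le_of_mul_le_mul_right h1 hgv
    have h3 := hP1 i
    have h4 := hP1 j
    set a := fderiv ℝ (fun w => Real.log (g t w)) v (esingle i)
    set b := fderiv ℝ (fun w => Real.log (g t w)) v (esingle j)
    have h5 := abs_le.1 h2
    rw [abs_le]
    constructor <;> nlinarith [sq_nonneg (a - b), sq_nonneg (a + b)]
  refine ⟨?_, ?_, ?_⟩
  · refine (abs_le_of_sq_le_sq' ?_ (by positivity)).2
    refine (lb_grad_norm _ v (C * X) hP1).trans ?_
    rw [mul_pow, ← Real.rpow_two (R ^ _), ← Real.rpow_mul hR0.le, mul_comm _ (2 : ℝ), ← mul_assoc]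
    refine mul_le_mul ?_ hXκ (by positivity) (by positivity)
    nlinarith
  · refine (lb_matNorm _ _ (by positivity) hP2).trans ?_
    calc 3 * (2 * (C * X)) = (6 * C) * X := by ring
      _ ≤ _ := mul_le_mul (by linarith) hXκ (by positivity) (by positivity)
  · have hd : DifferentiableWithinAt ℝ (fun s => g s v) (Set.Icc 0 T) t :=
      ((hg.timeC1 v).differentiableOn (by norm_num)) t ht
    have hu : UniqueDiffWithinAt ℝ (Set.Icc 0 T) t := uniqueDiffOn_Icc hT t ht
    have e := (hd.hasDerivWithinAt.log hgv.ne').derivWithin hu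
    rw [e, hg.eqn t ht v, abs_div, abs_of_pos hgv, div_le_iff₀ hgv]
    have h1 : |matDot (abar γ (g t) v) (hess (g t) v)| ≤ 9 * (Ca * (C * X * g t v)) := by
      refine lb_sum9 (fun i j => abar γ (g t) v i j * hess (g t) v i j) _ fun i j => ?_
      rw [abs_mul]
      exact mul_le_mul (habar (g t) (hdens t ht) v i j).2 (hmain t ht v i j).2 (abs_nonneg _) hCa
    have h2 : |cbar γ (g t) v * g t v| ≤ Cc * g t v := by
      rw [abs_mul, abs_of_pos hgv]
      exact mul_le_mul_of_nonneg_right ((hcb (g t) (hdens t ht)).1 v) hgv.le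
    refine (abs_add_le _ _).trans ((add_le_add h1 h2).trans ?_)
    calc 9 * (Ca * (C * X * g t v)) + Cc * g t v ≤ ((9 * (Ca * C) + Cc) * X) * g t v := by
          have := mul_le_mul_of_nonneg_left hX1 (mul_nonneg hCc hgv.le)
          linarith
      _ ≤ _ := by
        refine mul_le_mul_of_nonneg_right ?_ hgv.le
        exact mul_le_mul (by linarith) hXν (by positivity) (by positivity)


end
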